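/- Let γ ∈ C³_b(ℝ^{n−1}), p ∈ [1,∞), ε ∈ (0,1], and suppose ρ satisfies Assumptions (A1) and (A2) with M = I. If ‖γ‖_{C¹_b(ℝ^{n−1})} is sufficiently small, then the nonlocal operator u ↦ L_ε^{ℝⁿ_γ} u := P.V. ∫_{ℝⁿ_γ} J_ε(·−y)(u(·) − u(y)) dy, initially defined on C_c²(cl ℝⁿ_γ) ∩ W^{2,p}_I(ℝⁿ_γ), extends to a bounded linear operator L_ε^{ℝⁿ_γ} : W^{2,p}_I(ℝⁿ_γ) → L^p(ℝⁿ_γ) with ‖L_ε^{ℝⁿ_γ} u‖_{L^p(ℝⁿ_γ)} ≤ c_γ ‖u‖_{W^{2,p}(ℝⁿ_γ)} for all u ∈ W^{2,p}_I(ℝⁿ_γ), where c_γ > 0 depends only on γ, ρ and p. -/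

import Mathlib

open MeasureTheory Filter Topology ENNReal Matrix

noncomputable section

abbrev EV (n : ℕ) := EuclideanSpace ℝ (Fin n)

/-- The kernel `J(x) = ρ(x)/|x|²`. -/
def kernelJ {n : ℕ} (ρ : EV n → ℝ) (x : EV n) : ℝ := ρ x / ‖x‖ ^ 2

/-- The rescaled density `ρ_ε(x) = ε^{-n} ρ(x/ε)`. -/
def scaled {n : ℕ} (ρ : EV n → ℝ) (ε : ℝ) (x : EV n) : ℝ := (ε ^ n)⁻¹ * ρ (ε⁻¹ • x)

/-- Assumption (A1): `ρ` is measurable, nonnegative, not a.e. zero, even,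
and `∫ ρ(x)(1+|x|) dx < ∞`. -/
def A1 {n : ℕ} (ρ : EV n → ℝ) : Prop :=
  Measurable ρ ∧ (∀ x, 0 ≤ ρ x) ∧ ¬ (ρ =ᵐ[volume] (fun _ => (0 : ℝ))) ∧
  (∀ᵐ x : EV n ∂volume, ρ (-x) = ρ x) ∧
  Integrable (fun x : EV n => ρ x * (1 + ‖x‖)) volume

/-- `L_ε u (x) = ∫_{ℝⁿ} J_ε(x-y) (u(x) - u(y) - ∇u(x)·(x-y)) dy`. -/
def nlOp {n : ℕ} (ρ : EV n → ℝ) (ε : ℝ) (u : EV n → ℝ) (x : EV n) : ℝ :=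
  ∫ y : EV n, kernelJ (scaled ρ ε) (x - y) * (u x - u y - fderiv ℝ u x (x - y))

/-- The classical partial derivative `∂ᵢ u`. -/
def partialD {n : ℕ} (i : Fin n) (u : EV n → ℝ) : EV n → ℝ :=
  fun x => fderiv ℝ u x (EuclideanSpace.single i 1)

/-- Iterated classical partial derivatives along a list of directions. -/
def partialDList {n : ℕ} : List (Fin n) → (EV n → ℝ) → (EV n → ℝ)
  | [], u => u
  | i :: l, u => partialD i (partialDList l u)

/-- The momentum matrix `M = (1/2)∫_{ℝⁿ} J(z) z ⊗ z dz`. -/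
def momentum {n : ℕ} (ρ : EV n → ℝ) : Matrix (Fin n) (Fin n) ℝ :=
  Matrix.of fun i j => (1 / 2 : ℝ) * ∫ z : EV n, kernelJ ρ z * z i * z j

/-- Multiplication of a vector of `ℝⁿ` by a matrix. -/
def mulVecE {m : ℕ} (Q : Matrix (Fin m) (Fin m) ℝ) (x : EV m) : EV m :=
  (WithLp.equiv 2 (Fin m → ℝ)).symm (Q.mulVec ((WithLp.equiv 2 (Fin m → ℝ)) x))

/-- The point `(z', zₙ) ∈ ℝⁿ` with first coordinates `z' ∈ ℝ^{n-1}` and last coordinate `zₙ`. -/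
def snocE {n : ℕ} (z' : EV n) (t : ℝ) : EV (n + 1) :=
  (WithLp.equiv 2 (Fin (n + 1) → ℝ)).symm
    (Fin.snoc ((WithLp.equiv 2 (Fin n → ℝ)) z') t)

/-- `v = ∂ᵢ u` weakly on `Ω`. -/
def WeakDerivOn {n : ℕ} (Ω : Set (EV n)) (i : Fin n) (u v : EV n → ℝ) : Prop :=
  ∀ φ : EV n → ℝ, ContDiff ℝ (⊤ : ℕ∞) φ → HasCompactSupport φ → tsupport φ ⊆ Ω →
    ∫ x in Ω, u x * partialD i φ x = - ∫ x in Ω, v x * φ x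

/-- `D` is a system of weak partial derivatives of `u` on `Ω` up to order `k`,
all lying in `L^p(Ω)`; i.e. `D` witnesses that `u ∈ W^{k,p}(Ω)`. -/
def IsSobDerivs {n : ℕ} (Ω : Set (EV n)) (k : ℕ) (p : ℝ≥0∞) (u : EV n → ℝ)
    (D : List (Fin n) → EV n → ℝ) : Prop :=
  D [] = u ∧
  (∀ l : List (Fin n), l.length < k → ∀ i : Fin n, WeakDerivOn Ω i (D l) (D (i :: l))) ∧
  (∀ l : List (Fin n), l.length ≤ k → MemLp (D l) p (volume.restrict Ω))

/-- `u ∈ W^{k,p}(Ω)`. -/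
def MemW {n : ℕ} (Ω : Set (EV n)) (k : ℕ) (p : ℝ≥0∞) (u : EV n → ℝ) : Prop :=
  ∃ D, IsSobDerivs Ω k p u D

/-- The `W^{k,p}`-norm computed from a system `D` of weak derivatives:
the sum of the `L^p` norms of all weak derivatives of order at most `k`. -/
def WNormD {n : ℕ} (k : ℕ) (p : ℝ≥0∞) (μ : Measure (EV n))
    (D : List (Fin n) → EV n → ℝ) : ℝ≥0∞ :=
  ∑' l : List (Fin n), if l.length ≤ k then eLpNorm (D l) p μ else 0

/-- The first `n` coordinates of a point of `ℝ^{n+1}`. -/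
def firstCoords {n : ℕ} (x : EV (n + 1)) : EV n :=
  (WithLp.equiv 2 (Fin n → ℝ)).symm (fun i => x i.castSucc)

/-- The curved half space `ℝⁿ_γ = {x : xₙ > γ(x₁,…,x_{n-1})}`. -/
def halfSpace {n : ℕ} (γ : EV n → ℝ) : Set (EV (n + 1)) :=
  {x : EV (n + 1) | γ (firstCoords x) < x (Fin.last n)}

/-- `γ ∈ C^k_b`: `γ` is `k` times continuously differentiable with bounded derivatives. -/
def Ckb {n : ℕ} (k : ℕ) (γ : EV n → ℝ) : Prop :=
  ContDiff ℝ k γ ∧ ∀ m : ℕ, m ≤ k → ∃ C : ℝ, ∀ x, ‖iteratedFDeriv ℝ m γ x‖ ≤ C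

/-- Assumption (A2): `ρ ∈ C¹(ℝⁿ∖{0})` with singularity bounds
`|ρ(x)| ≤ c₀|x|^{2-α-n}(1+|x|)^{-N}`, `|∇ρ(x)| ≤ c₁|x|^{1-α-n}(1+|x|)^{-N}` for some
`c₀, c₁ > 0`, `α ∈ (0,2)`, `N > 3-α`; and, with `A := √M`, the kernel satisfies
`∫_{ℝ^{n-1}} J(AQ(z', zₙ)) z' dz' = 0` for all `zₙ ∈ ℝ` and `Q ∈ SO(n)`.
(The ambient dimension is `n + 1`.) -/
def A2 {n : ℕ} (ρ : EV (n + 1) → ℝ) : Prop :=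
  ContDiffOn ℝ 1 ρ {(0 : EV (n + 1))}ᶜ ∧
  (∃ c₀ c₁ α N : ℝ, 0 < c₀ ∧ 0 < c₁ ∧ 0 < α ∧ α < 2 ∧ 3 - α < N ∧
    ∀ x : EV (n + 1), x ≠ 0 →
      |ρ x| ≤ c₀ * ‖x‖ ^ ((2 : ℝ) - α - (n + 1 : ℝ)) * (1 + ‖x‖) ^ (-N) ∧
      ‖fderiv ℝ ρ x‖ ≤ c₁ * ‖x‖ ^ ((1 : ℝ) - α - (n + 1 : ℝ)) * (1 + ‖x‖) ^ (-N)) ∧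
  (∃ A : Matrix (Fin (n + 1)) (Fin (n + 1)) ℝ, A.PosDef ∧ A * A = momentum ρ ∧
    ∀ t : ℝ, ∀ Q : Matrix (Fin (n + 1)) (Fin (n + 1)) ℝ, Qᵀ * Q = 1 → Q.det = 1 →
      (∫ z' : EV n, kernelJ ρ (mulVecE (A * Q) (snocE z' t)) • z') = 0)

/-- The homogeneous conormal boundary condition `M∇u · n = 0` on `∂Ω`, formulated weakly:
for any system of weak derivatives of `u ∈ W^{2,p}(Ω)` and any test function
`φ ∈ C_c^∞(ℝⁿ)`, Green's formula holds on `Ω` with no boundary contribution. -/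
def NeumannBC {m : ℕ} (Ω : Set (EV m)) (Mm : Matrix (Fin m) (Fin m) ℝ) (p : ℝ≥0∞)
    (u : EV m → ℝ) : Prop :=
  ∀ D : List (Fin m) → EV m → ℝ, IsSobDerivs Ω 2 p u D →
    ∀ φ : EV m → ℝ, ContDiff ℝ (⊤ : ℕ∞) φ → HasCompactSupport φ →
      (∑ i : Fin m, ∑ j : Fin m, Mm i j * ∫ x in Ω, D [i, j] x * φ x)
        = - ∑ i : Fin m, ∑ j : Fin m, Mm i j * ∫ x in Ω, D [j] x * partialD i φ x

/-- `u ∈ W^{k,p}(Ω)` together with the boundary condition `M∇u · n = 0` on `∂Ω`. -/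
def MemWN {m : ℕ} (Ω : Set (EV m)) (Mm : Matrix (Fin m) (Fin m) ℝ) (k : ℕ) (p : ℝ≥0∞)
    (u : EV m → ℝ) : Prop :=
  MemW Ω k p u ∧ NeumannBC Ω Mm p u

/-- `l` is the principal value `P.V. ∫_Ω J_ε(x-y)(u(x)-u(y)) dy` at the point `x`. -/
def pvAt {m : ℕ} (Ω : Set (EV m)) (ρ : EV m → ℝ) (ε : ℝ) (u : EV m → ℝ) (x : EV m)
    (l : ℝ) : Prop :=
  Tendsto
    (fun r : ℝ =>
      ∫ y in Ω ∩ {y : EV m | r ≤ dist x y}, kernelJ (scaled ρ ε) (x - y) * (u x - u y))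
    (𝓝[>] 0) (𝓝 l)

/-- `L` is a bounded linear extension to `W^{2,p}_M(Ω)` (Sobolev functions with the
boundary condition `M∇u · n = 0`), with operator bound `C`, of the nonlocal operator
`P.V. ∫_Ω J_ε(·-y)(u(·)-u(y)) dy` defined on `C_c²(cl Ω) ∩ W^{2,p}_M(Ω)`. -/
def IsNLExtOn {m : ℕ} (Ω : Set (EV m)) (Mm : Matrix (Fin m) (Fin m) ℝ) (ρ : EV m → ℝ)
    (p : ℝ≥0∞) (ε C : ℝ) (L : (EV m → ℝ) → EV m → ℝ) : Prop :=
  (∀ u : EV m → ℝ, ContDiff ℝ 2 u → HasCompactSupport u → MemWN Ω Mm 2 p u →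
    ∀ᵐ x ∂(volume.restrict Ω), pvAt Ω ρ ε u x (L u x)) ∧
  (∀ u v : EV m → ℝ, MemWN Ω Mm 2 p u → MemWN Ω Mm 2 p v → ∀ a b : ℝ,
    L (fun x => a * u x + b * v x) =ᵐ[volume.restrict Ω] fun x => a * L u x + b * L v x) ∧
  (∀ u : EV m → ℝ, MemWN Ω Mm 2 p u → MemLp (L u) p (volume.restrict Ω)) ∧
  (∀ u D, MemWN Ω Mm 2 p u → IsSobDerivs Ω 2 p u D →
    eLpNorm (L u) p (volume.restrict Ω)
      ≤ ENNReal.ofReal C * WNormD 2 p (volume.restrict Ω) D)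

/-- `Ω ⊆ ℝ^{n+1}` is an open set whose boundary is locally, up to a rotation, the region
above the graph of a `C^k` function with bounded derivatives (a domain of class `C^k`). -/
def IsGraphDomain {n : ℕ} (k : ℕ) (Ω : Set (EV (n + 1))) : Prop :=
  IsOpen Ω ∧ ∀ z ∈ frontier Ω,
    ∃ (U : Set (EV (n + 1))) (Q : Matrix (Fin (n + 1)) (Fin (n + 1)) ℝ) (γ : EV n → ℝ),
      IsOpen U ∧ z ∈ U ∧ Qᵀ * Q = 1 ∧ Q.det = 1 ∧ Ckb k γ ∧
      Ω ∩ U = (mulVecE Q '' halfSpace γ) ∩ U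

/-- weighted Jensen inequality -/
lemma wjensen {Θ : Type*} [MeasurableSpace Θ] (ν : Measure Θ) (w g : Θ → ℝ≥0∞)
    (hw : AEMeasurable w ν) (hg : AEMeasurable g ν) (q : ℝ) (hq : 1 ≤ q) (A : ℝ≥0∞)
    (hA : ∫⁻ θ, w θ ∂ν ≤ A) :
    (∫⁻ θ, w θ * g θ ∂ν) ^ q ≤ A ^ (q - 1) * ∫⁻ θ, w θ * g θ ^ q ∂ν := by
  have hq0 : 0 < q := by linarith
  have h1 : ∫⁻ θ, w θ * g θ ∂ν ≤
      (∫⁻ θ, w θ * g θ ^ q ∂ν) ^ (1 / q) * (∫⁻ θ, w θ ∂ν) ^ (1 - 1 / q) := by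
    refine le_trans (le_of_eq ?_) (ENNReal.lintegral_mul_norm_pow_le
      (hw.mul (hg.pow_const q)) hw (by positivity) ?_ (by ring))
    · congr 1; ext θ
      change _ = (w θ * g θ ^ q) ^ (1 / q) * _
      rw [ENNReal.mul_rpow_of_nonneg _ _ (by positivity), ← ENNReal.rpow_mul,
        mul_one_div_cancel hq0.ne', ENNReal.rpow_one]
      have : w θ ^ (1/q) * w θ ^ (1 - 1/q) = w θ := by
        rw [← ENNReal.rpow_add_of_nonneg _ _ (by positivity)]
        · simp
        · rw [sub_nonneg, div_le_one hq0]; exact hq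
      nth_rewrite 1 [← this]; ring
    · rw [sub_nonneg, div_le_one hq0]; exact hq
  calc _ ≤ ((∫⁻ θ, w θ * g θ ^ q ∂ν) ^ (1 / q) * (∫⁻ θ, w θ ∂ν) ^ (1 - 1 / q)) ^ q :=
        ENNReal.rpow_le_rpow h1 hq0.le
    _ = (∫⁻ θ, w θ * g θ ^ q ∂ν) * (∫⁻ θ, w θ ∂ν) ^ (q - 1) := by
        rw [ENNReal.mul_rpow_of_nonneg _ _ hq0.le, ← ENNReal.rpow_mul, ← ENNReal.rpow_mul,
          one_div_mul_cancel hq0.ne', ENNReal.rpow_one]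
        congr 2; field_simp
    _ ≤ _ := by
        rw [mul_comm]; gcongr

/-- Schur test in the form used below. -/
lemma schur {X Θ : Type*} [MeasurableSpace X] [MeasurableSpace Θ] (μ : Measure X) (ν : Measure Θ)
    [SFinite μ] [SFinite ν] (w g : X → Θ → ℝ≥0∞)
    (hw : Measurable (Function.uncurry w)) (hg : Measurable (Function.uncurry g))
    (q : ℝ) (hq : 1 ≤ q) (A : ℝ≥0∞)
    (hA : ∀ᵐ x ∂μ, ∫⁻ θ, w x θ ∂ν ≤ A) :
    ∫⁻ x, (∫⁻ θ, w x θ * g x θ ∂ν) ^ q ∂μ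
      ≤ A ^ (q - 1) * ∫⁻ θ, ∫⁻ x, w x θ * g x θ ^ q ∂μ ∂ν := by
  have hm : Measurable (Function.uncurry fun x θ => w x θ * g x θ ^ q) :=
    hw.mul (hg.pow_const q)
  rw [lintegral_lintegral_swap (f := fun θ x => w x θ * g x θ ^ q)
    (hm.comp measurable_swap).aemeasurable]
  rw [← lintegral_const_mul _ (Measurable.lintegral_prod_right hm)]
  refine lintegral_mono_ae ?_
  filter_upwards [hA] with x hx
  exact wjensen ν _ _ (hw.comp measurable_prodMk_left).aemeasurable
    (hg.comp measurable_prodMk_left).aemeasurable q hq A hx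

lemma eLpNorm_pow {X F : Type*} [MeasurableSpace X] [TopologicalSpace F] [ContinuousENorm F]
    (μ : Measure X) (f : X → F) (p : ℝ≥0∞)
    (hp1 : 1 ≤ p) (hp : p ≠ ⊤) :
    (eLpNorm f p μ) ^ p.toReal = ∫⁻ x, ‖f x‖ₑ ^ p.toReal ∂μ := by
  have h0 : p ≠ 0 := by rintro rfl; simp at hp1
  rw [eLpNorm_eq_lintegral_rpow_enorm_toReal h0 hp, ← ENNReal.rpow_mul, one_div,
    inv_mul_cancel₀ (ENNReal.toReal_pos h0 hp).ne', ENNReal.rpow_one]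

/-- Minkowski-type inequality. -/
lemma mink {X Θ : Type*} [MeasurableSpace X] [MeasurableSpace Θ] (μ : Measure X) (ν : Measure Θ)
    [SFinite μ] [SFinite ν] (w : Θ → ℝ≥0∞) (g : X → Θ → ℝ≥0∞)
    (hw : Measurable w) (hg : Measurable (Function.uncurry g))
    (p : ℝ≥0∞) (hp1 : 1 ≤ p) (hp : p ≠ ⊤) (A B : ℝ≥0∞)
    (hA : ∫⁻ θ, w θ ∂ν ≤ A) (hB : ∀ᵐ θ ∂ν, eLpNorm (fun x => g x θ) p μ ≤ B) :
    eLpNorm (fun x => ∫⁻ θ, w θ * g x θ ∂ν) p μ ≤ A * B := by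
  have h0 : p ≠ 0 := by rintro rfl; simp at hp1
  have hq0 := ENNReal.toReal_pos h0 hp
  have hq : 1 ≤ p.toReal := by
    rw [← ENNReal.toReal_one]; exact (ENNReal.toReal_le_toReal (by simp) hp).2 hp1
  rw [← ENNReal.rpow_le_rpow_iff hq0, eLpNorm_pow _ _ _ hp1 hp]
  refine (schur μ ν (fun _ θ => w θ) g (hw.comp measurable_snd) hg p.toReal hq A
    (Eventually.of_forall fun _ => hA)).trans ?_
  calc A ^ (p.toReal - 1) * ∫⁻ θ, ∫⁻ x, w θ * g x θ ^ p.toReal ∂μ ∂ν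
      ≤ A ^ (p.toReal - 1) * ∫⁻ θ, w θ * B ^ p.toReal ∂ν := by
        refine mul_le_mul' le_rfl (lintegral_mono_ae ?_)
        filter_upwards [hB] with θ hθ
        have hgm : Measurable (fun x => g x θ) := hg.comp measurable_prodMk_right
        rw [lintegral_const_mul _ (hgm.pow_const _)]
        gcongr
        have := eLpNorm_pow μ (fun x => g x θ) p hp1 hp
        simp only [enorm_eq_self] at this
        refine this.symm.le.trans ?_
        gcongr
    _ ≤ A ^ (p.toReal - 1) * (A * B ^ p.toReal) := by
        rw [lintegral_mul_const _ hw]; gcongr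
    _ = (A * B) ^ p.toReal := by
        rw [ENNReal.mul_rpow_of_nonneg _ _ hq0.le, ← mul_assoc]
        congr 1
        have h2 : A ^ (p.toReal - 1) * A ^ (1:ℝ) = A ^ p.toReal := by
          rw [← ENNReal.rpow_add_of_nonneg _ _ (by linarith) (by norm_num)]; congr 1; ring
        simpa using h2

/-- weak directional derivative on `Ω`, for functions on the whole space. -/
def WD {m : ℕ} (Ω : Set (EV m)) (v : EV m) (F H : EV m → ℝ) : Prop :=
  ∀ φ : EV m → ℝ, ContDiff ℝ (⊤ : ℕ∞) φ → HasCompactSupport φ → tsupport φ ⊆ Ω →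
    ∫ x, F x * fderiv ℝ φ x v = - ∫ x, H x * φ x

lemma skew_mp {m : ℕ} (w : EV m) (ν : Measure ℝ) [SFinite ν] :
    MeasurePreserving (fun q : ℝ × EV m => (q.1, q.2 + q.1 • w))
      (ν.prod volume) (ν.prod volume) := by
  refine (MeasurePreserving.id ν).skew_product (g := fun s x => x + s • w) ?_ ?_
  · exact (by fun_prop : Measurable fun q : ℝ × EV m => q.2 + q.1 • w)
  · exact Eventually.of_forall fun s => (measurePreserving_add_right volume (s • w)).map_eq

lemma prodint_P {m : ℕ} (w : EV m) (H : EV m → ℝ) (hH : LocallyIntegrable H volume)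
    (φ : EV m → ℝ) (hφ : Measurable φ) (C : ℝ) (hC : ∀ x, |φ x| ≤ C) (K : Set (EV m))
    (hK : IsCompact K) (hφK : ∀ x, x ∉ K → φ x = 0) :
    Integrable (fun q : ℝ × EV m => φ (q.2 - q.1 • w) * H q.2)
      ((volume.restrict (Set.Icc (0:ℝ) 1)).prod volume) := by
  have hC0 : 0 ≤ C := (abs_nonneg _).trans (hC 0)
  set K' : Set (EV m) := (fun q : ℝ × EV m => q.2 + q.1 • w) '' (Set.Icc (0:ℝ) 1 ×ˢ K) with hK'
  have hK'c : IsCompact K' := (isCompact_Icc.prod hK).image (by fun_prop)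
  have h1 : Integrable (K'.indicator H) volume :=
    (integrable_indicator_iff hK'c.measurableSet).2 (hH.integrableOn_isCompact hK'c)
  have h2 : Integrable (fun q : ℝ × EV m => C * ‖K'.indicator H q.2‖)
      ((volume.restrict (Set.Icc (0:ℝ) 1)).prod volume) :=
    (h1.norm.comp_snd _).const_mul C
  refine h2.mono' ?_ ?_
  · refine AEStronglyMeasurable.mul ?_ ?_
    · exact (hφ.comp (by fun_prop)).aestronglyMeasurable
    · exact hH.aestronglyMeasurable.comp_snd
  · have : ∀ᵐ q ∂((volume.restrict (Set.Icc (0:ℝ) 1)).prod (volume : Measure (EV m))),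
        q.1 ∈ Set.Icc (0:ℝ) 1 := by
      have := (ae_restrict_mem (μ := (volume : Measure ℝ)) (measurableSet_Icc (a := (0:ℝ)) (b := 1)))
      exact Measure.quasiMeasurePreserving_fst.ae this
    filter_upwards [this] with q hq
    by_cases hx : q.2 - q.1 • w ∈ K
    · have : q.2 ∈ K' := ⟨(q.1, q.2 - q.1 • w), ⟨hq, hx⟩, by simp⟩
      rw [Set.indicator_of_mem this, norm_mul]
      exact mul_le_mul_of_nonneg_right (hC _) (norm_nonneg _)
    · rw [hφK _ hx]; simp; positivity

lemma prodint_Q {m : ℕ} (w : EV m) (H : EV m → ℝ) (hH : LocallyIntegrable H volume)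
    (φ : EV m → ℝ) (hφ : Measurable φ) (C : ℝ) (hC : ∀ x, |φ x| ≤ C) (K : Set (EV m))
    (hK : IsCompact K) (hφK : ∀ x, x ∉ K → φ x = 0) :
    Integrable (fun q : ℝ × EV m => φ q.2 * H (q.2 + q.1 • w))
      ((volume.restrict (Set.Icc (0:ℝ) 1)).prod volume) := by
  have h := (skew_mp w (volume.restrict (Set.Icc (0:ℝ) 1))).integrable_comp_of_integrable
    (prodint_P w H hH φ hφ C hC K hK hφK)
  simpa [Function.comp_def] using h

lemma locint_G {m : ℕ} (w : EV m) (H : EV m → ℝ) (hH : LocallyIntegrable H volume) :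
    LocallyIntegrable (fun x => ∫ s in Set.Icc (0:ℝ) 1, H (x + s • w)) volume := by
  rw [locallyIntegrable_iff]
  intro K hK
  rw [← integrable_indicator_iff hK.measurableSet]
  have := (prodint_Q w H hH (K.indicator fun _ => (1:ℝ))
    (measurable_const.indicator hK.measurableSet) 1 (fun x => by
      by_cases hx : x ∈ K <;> simp [hx]) K hK (fun x hx => by simp [hx])).integral_prod_right
  refine this.congr (Eventually.of_forall fun x => ?_)
  by_cases hx : x ∈ K <;> simp [hx]

lemma cc_bdd {m : ℕ} (φ : EV m → ℝ) (h : Continuous φ) (hs : HasCompactSupport φ) :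
    ∃ C, ∀ x, |φ x| ≤ C := by
  obtain ⟨C, hC⟩ := hs.exists_bound_of_continuous h
  exact ⟨C, hC⟩

lemma cc_int {m : ℕ} (F : EV m → ℝ) (hF : LocallyIntegrable F volume)
    (φ : EV m → ℝ) (h : Continuous φ) (hs : HasCompactSupport φ) :
    Integrable (fun x => F x * φ x) volume := by
  simpa [smul_eq_mul, mul_comm] using hF.integrable_smul_left_of_hasCompactSupport h hs

lemma ftc {m : ℕ} (Ω : Set (EV m)) (hΩ : IsOpen Ω) (w : EV m)
    (hw : ∀ x ∈ Ω, ∀ s ∈ Set.Icc (0:ℝ) 1, x + s • w ∈ Ω) (F H : EV m → ℝ)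
    (hF : LocallyIntegrable F volume) (hH : LocallyIntegrable H volume) (hWD : WD Ω w F H) :
    ∀ᵐ x : EV m ∂volume, x ∈ Ω →
      F (x + w) - F x = ∫ s in Set.Icc (0:ℝ) 1, H (x + s • w) := by
  have hFw : LocallyIntegrable (fun x => F (x + w)) volume := by
    rw [locallyIntegrable_iff] at hF ⊢
    intro K hK
    have h1 := hF _ (hK.image (continuous_add_const w))
    have := ((measurePreserving_add_right volume w).integrableOn_image
      (MeasurableEquiv.addRight w).measurableEmbedding (f := F) (s := K)).1 h1
    exact this
  have hG := locint_G w H hH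
  have key := IsOpen.ae_eq_zero_of_integral_contDiff_smul_eq_zero (μ := volume) hΩ
    (f := fun x => F (x + w) - F x - ∫ s in Set.Icc (0:ℝ) 1, H (x + s • w))
    (((hFw.sub hF).sub hG).locallyIntegrableOn _) ?_
  · filter_upwards [key] with x hx hxΩ
    exact sub_eq_zero.1 (hx hxΩ)
  intro φ hφ hcs hsupp
  obtain ⟨C, hC⟩ := cc_bdd φ hφ.continuous hcs
  have hd : Continuous (fun x => fderiv ℝ φ x w) :=
    (hφ.continuous_fderiv (by simp)).clm_apply continuous_const
  have hdcs : HasCompactSupport (fun x => fderiv ℝ φ x w) := by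
    refine (hcs.fderiv (𝕜 := ℝ)).mono ?_
    intro x hx h0; apply hx; simp [h0]
  obtain ⟨C', hC'⟩ := cc_bdd _ hd hdcs
  have iQ := prodint_Q w H hH φ hφ.continuous.measurable C hC (tsupport φ) hcs
    (fun x hx => image_eq_zero_of_notMem_tsupport hx)
  have iP := prodint_P w F hF _ hd.measurable C' hC' _ hdcs
    (fun x hx => image_eq_zero_of_notMem_tsupport (f := fun x => fderiv ℝ φ x w) hx)
  have e1 : ∫ x, F (x + w) * φ x = ∫ y, F y * φ (y - w) := by
    have := integral_add_right_eq_self (μ := volume) (fun y => F y * φ (y - w)) w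
    simpa using this
  have e2 : ∫ x, (∫ s in Set.Icc (0:ℝ) 1, H (x + s • w)) * φ x
      = ∫ y, F y * (φ (y - w) - φ y) := by
    calc ∫ x, (∫ s in Set.Icc (0:ℝ) 1, H (x + s • w)) * φ x
        = ∫ x, (∫ s in Set.Icc (0:ℝ) 1, φ x * H (x + s • w)) := by
          congr 1; ext x; rw [integral_const_mul, mul_comm]
      _ = ∫ s in Set.Icc (0:ℝ) 1, ∫ x, φ x * H (x + s • w) := by
          rw [integral_integral_swap]; exact iQ.swap
      _ = ∫ s in Set.Icc (0:ℝ) 1, ∫ y, -(fderiv ℝ φ (y - s • w) w * F y) := by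
          refine setIntegral_congr_fun measurableSet_Icc fun s hs => ?_
          have a1 : ∫ x, φ x * H (x + s • w) = ∫ y, H y * φ (y - s • w) := by
            have := integral_add_right_eq_self (μ := volume) (fun y => H y * φ (y - s • w)) (s • w)
            rw [← this]; simp [mul_comm]
          have a2 := hWD (fun y => φ (y - s • w)) (hφ.comp (contDiff_id.sub contDiff_const))
            (hcs.comp_homeomorph (Homeomorph.subRight (s • w))) ?_
          · rw [a1, integral_neg, ← neg_eq_iff_eq_neg, ← a2]
            congr 1; ext y
            rw [fderiv_comp_sub]; ring
          · intro y hy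
            have hy' : y - s • w ∈ tsupport φ := by
              have := tsupport_comp_subset_preimage φ (f := fun y : EV m => y - s • w) (by fun_prop)
              exact this hy
            have := hw _ (hsupp hy') s hs
            simpa using this
      _ = ∫ y, ∫ s in Set.Icc (0:ℝ) 1, -(fderiv ℝ φ (y - s • w) w * F y) := by
          rw [integral_integral_swap]; exact iP.neg
      _ = _ := by
          congr 1; ext y
          rw [integral_neg, integral_mul_const, mul_comm, ← mul_neg]
          congr 1
          rw [integral_Icc_eq_integral_Ioc, ← intervalIntegral.integral_of_le zero_le_one]
          have := intervalIntegral.integral_eq_sub_of_hasDerivAt (a := (0:ℝ)) (b := 1)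
            (f := fun s => - φ (y - s • w)) (f' := fun s => fderiv ℝ φ (y - s • w) w) ?_ ?_
          · rw [this]; simp; ring
          · intro s _
            have h1 : HasDerivAt (fun s : ℝ => y - s • w) (-w) s := by
              simpa using ((hasDerivAt_id s).smul_const w).const_sub y
            have h2 := ((hφ.differentiable (by simp)) (y - s • w)).hasFDerivAt.comp_hasDerivAt s h1
            simpa [Function.comp_def] using h2.fun_neg
          · apply Continuous.intervalIntegrable
            exact hd.comp (by fun_prop)
  have i1 : Integrable (fun x => F (x + w) * φ x) := cc_int _ hFw φ hφ.continuous hcs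
  have i2 : Integrable (fun x => F x * φ x) := cc_int _ hF φ hφ.continuous hcs
  have i3 := cc_int _ hG φ hφ.continuous hcs
  have i4 : Integrable (fun x => F x * φ (x - w)) :=
    cc_int _ hF _ (hφ.continuous.comp (by fun_prop))
      (hcs.comp_homeomorph (Homeomorph.subRight w))
  calc ∫ x, φ x • (F (x + w) - F x - ∫ s in Set.Icc (0:ℝ) 1, H (x + s • w))
      = ∫ x, (F (x + w) * φ x - F x * φ x) - (∫ s in Set.Icc (0:ℝ) 1, H (x + s • w)) * φ x := by
        congr 1; ext x; simp only [smul_eq_mul]; ring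
    _ = 0 := by
        have i12 : Integrable (fun x => F (x + w) * φ x - F x * φ x) := i1.sub i2
        rw [integral_sub i12 i3, integral_sub i1 i2, e1, e2]
        simp only [mul_sub]
        rw [integral_sub i4 i2]; ring

/-- Sobolev data: everything measurable, defined on the whole space, zero off `Ω`. -/
structure SD {m : ℕ} (Ω : Set (EV m)) (p : ℝ≥0∞) (U : EV m → ℝ) (G : Fin m → EV m → ℝ)
    (H : Fin m → Fin m → EV m → ℝ) : Prop where
  mU : Measurable U
  mG : ∀ i, Measurable (G i)
  mH : ∀ i j, Measurable (H i j)
  zU : ∀ x, x ∉ Ω → U x = 0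
  zG : ∀ i x, x ∉ Ω → G i x = 0
  zH : ∀ i j x, x ∉ Ω → H i j x = 0
  lU : MemLp U p volume
  lG : ∀ i, MemLp (G i) p volume
  lH : ∀ i j, MemLp (H i j) p volume
  wU : ∀ i, WD Ω (EuclideanSpace.single i 1) U (G i)
  wG : ∀ i j, WD Ω (EuclideanSpace.single i 1) (G j) (H i j)

lemma enorm_integral_sub_le {Θ : Type*} [MeasurableSpace Θ] (ν : Measure Θ) [IsProbabilityMeasure ν]
    (h : Θ → ℝ) (hh : Measurable h) (c : ℝ) :
    ‖(∫ s, h s ∂ν) - c‖ₑ ≤ ∫⁻ s, ‖h s - c‖ₑ ∂ν := by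
  by_cases hi : Integrable (fun s => h s - c) ν
  · have h1 : Integrable h ν :=
      (hi.add (integrable_const c)).congr (Eventually.of_forall fun s => by simp)
    have : (∫ s, h s ∂ν) - c = ∫ s, (h s - c) ∂ν := by
      rw [integral_sub h1 (integrable_const c)]; simp
    rw [this]; exact enorm_integral_le_lintegral_enorm _
  · have : ∫⁻ s, ‖h s - c‖ₑ ∂ν = ⊤ := by
      by_contra hne
      exact hi ⟨(hh.sub_const c).aestronglyMeasurable, lt_top_iff_ne_top.2 hne⟩
    rw [this]; exact le_top

instance : IsProbabilityMeasure ((volume : Measure ℝ).restrict (Set.Icc (0:ℝ) 1)) :=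
  ⟨by simp⟩

lemma eLpNorm_shift {m : ℕ} (f : EV m → ℝ) (hf : Measurable f) (p : ℝ≥0∞) (z : EV m) :
    eLpNorm (fun x => f (x + z)) p volume = eLpNorm f p volume :=
  eLpNorm_comp_measurePreserving hf.aestronglyMeasurable (measurePreserving_add_right volume z)

lemma sum_single {m : ℕ} (w : EV m) : w = ∑ i, w i • EuclideanSpace.single i (1:ℝ) := by
  ext j
  simp [Pi.single_apply]

lemma WD_lin {m : ℕ} (Ω : Set (EV m)) (F : EV m → ℝ) (Fi : Fin m → EV m → ℝ)
    (hF : LocallyIntegrable F volume) (hFi : ∀ i, LocallyIntegrable (Fi i) volume)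
    (h : ∀ i, WD Ω (EuclideanSpace.single i 1) F (Fi i)) (w : EV m) :
    WD Ω w F (fun x => ∑ i, w i * Fi i x) := by
  intro φ hφ hcs hs
  have hd : ∀ v, Continuous (fun x => fderiv ℝ φ x v) := fun v =>
    (hφ.continuous_fderiv (by simp)).clm_apply continuous_const
  have hdcs : ∀ v, HasCompactSupport (fun x => fderiv ℝ φ x v) := by
    intro v
    refine (hcs.fderiv (𝕜 := ℝ)).mono ?_
    intro x hx h0; apply hx; simp [h0]
  have e1 : ∀ x, F x * fderiv ℝ φ x w
      = ∑ i, w i * (F x * fderiv ℝ φ x (EuclideanSpace.single i 1)) := by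
    intro x
    conv_lhs => rw [sum_single w]
    rw [map_sum, Finset.mul_sum]
    refine Finset.sum_congr rfl fun i _ => ?_
    rw [map_smul, smul_eq_mul]; ring
  simp_rw [e1, Finset.sum_mul]
  rw [integral_finsetSum _ (fun i _ => ((cc_int F hF _ (hd _) (hdcs _)).const_mul _)),
    integral_finsetSum, ← Finset.sum_neg_distrib]
  · refine Finset.sum_congr rfl fun i _ => ?_
    rw [integral_const_mul, h i φ hφ hcs hs]
    simp_rw [mul_assoc]; rw [integral_const_mul]; ring
  · intro i _
    simp_rw [mul_assoc]
    exact (cc_int _ (hFi i) _ hφ.continuous hcs).const_mul _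

/-- star-shapedness of `Ω` in direction `w` -/
def StarDir {m : ℕ} (Ω : Set (EV m)) (w : EV m) : Prop :=
  ∀ x ∈ Ω, ∀ s ∈ Set.Icc (0:ℝ) 1, x + s • w ∈ Ω

lemma StarDir.smul {m : ℕ} {Ω : Set (EV m)} {w : EV m} (h : StarDir Ω w) {s : ℝ}
    (hs : s ∈ Set.Icc (0:ℝ) 1) : StarDir Ω (s • w) := by
  intro x hx t ht
  rw [smul_smul]
  exact h x hx _ ⟨mul_nonneg ht.1 hs.1, mul_le_one₀ ht.2 hs.1 hs.2⟩

lemma diff_est {m : ℕ} (Ω : Set (EV m)) (hΩ : IsOpen Ω) (w : EV m) (hw : StarDir Ω w)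
    (p : ℝ≥0∞) (hp1 : 1 ≤ p) (hp : p ≠ ⊤) (F H : EV m → ℝ)
    (mH : Measurable H) (lF : LocallyIntegrable F volume)
    (lH : MemLp H p volume) (h : WD Ω w F H) :
    eLpNorm (Ω.indicator fun x => F (x + w) - F x) p volume ≤ eLpNorm H p volume := by
  have h1 := ftc Ω hΩ w hw F H lF (lH.locallyIntegrable hp1) h
  have h2 : eLpNorm (Ω.indicator fun x => F (x + w) - F x) p volume ≤
      eLpNorm (fun x => ∫⁻ s in Set.Icc (0:ℝ) 1, 1 * ‖H (x + s • w)‖ₑ) p volume := by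
    refine eLpNorm_mono_enorm_ae ?_
    filter_upwards [h1] with x hx
    by_cases hxΩ : x ∈ Ω
    · rw [Set.indicator_of_mem hxΩ, hx hxΩ]
      simpa using enorm_integral_le_lintegral_enorm _
    · simp [hxΩ]
  refine h2.trans ?_
  refine (mink volume (volume.restrict (Set.Icc (0:ℝ) 1)) (fun _ => 1)
    (fun x s => ‖H (x + s • w)‖ₑ) measurable_const ?_ p hp1 hp 1 (eLpNorm H p volume) (by simp)
    ?_).trans (by simp)
  · exact (mH.comp (by fun_prop : Measurable fun q : EV m × ℝ => q.1 + q.2 • w)).enorm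
  · refine Eventually.of_forall fun s => ?_
    rw [eLpNorm_enorm, eLpNorm_shift H mH]

section
variable {m : ℕ} {Ω : Set (EV m)} {p : ℝ≥0∞} {U : EV m → ℝ} {G : Fin m → EV m → ℝ}
    {H : Fin m → Fin m → EV m → ℝ}

/-- sum of the norms of second derivatives -/
def SH (p : ℝ≥0∞) (H : Fin m → Fin m → EV m → ℝ) : ℝ≥0∞ := ∑ j, ∑ i, eLpNorm (H i j) p volume

lemma coord_le (w : EV m) (i : Fin m) : |w i| ≤ ‖w‖ := by
  simpa using PiLp.norm_apply_le w i

lemma diffG (hΩ : IsOpen Ω) (hp1 : 1 ≤ p) (hp : p ≠ ⊤) (S : SD Ω p U G H) (w : EV m)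
    (hw : StarDir Ω w) (j : Fin m) :
    eLpNorm (Ω.indicator fun x => G j (x + w) - G j x) p volume
      ≤ ENNReal.ofReal ‖w‖ * SH p H := by
  refine (diff_est Ω hΩ w hw p hp1 hp (G j) (fun x => ∑ i, w i * H i j x)
    (Finset.measurable_fun_sum _ fun i _ => (S.mH i j).const_mul _)
    ((S.lG j).locallyIntegrable hp1)
    (memLp_finsetSum _ fun i _ => (S.lH i j).const_mul _)
    (WD_lin Ω _ _ ((S.lG j).locallyIntegrable hp1)
      (fun i => (S.lH i j).locallyIntegrable hp1) (fun i => S.wG i j) w)).trans ?_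
  have : (fun x => ∑ i, w i * H i j x) = ∑ i, w i • H i j := by ext x; simp
  rw [this]
  refine (eLpNorm_sum_le (fun i _ => ((S.mH i j).const_smul _).aestronglyMeasurable) hp1).trans ?_
  calc ∑ i, eLpNorm (w i • H i j) p volume
      ≤ ∑ i, ENNReal.ofReal ‖w‖ * eLpNorm (H i j) p volume := by
        refine Finset.sum_le_sum fun i _ => ?_
        rw [eLpNorm_const_smul]
        gcongr
        rw [← ofReal_norm]
        exact ENNReal.ofReal_le_ofReal (coord_le w i)
    _ = ENNReal.ofReal ‖w‖ * ∑ i, eLpNorm (H i j) p volume := by rw [Finset.mul_sum]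
    _ ≤ _ := by
        unfold SH
        refine mul_le_mul_right ?_ _
        exact Finset.single_le_sum (f := fun j => ∑ i, eLpNorm (H i j) p volume)
          (fun _ _ => zero_le) (Finset.mem_univ j)

lemma sum_diffG (hΩ : IsOpen Ω) (hp1 : 1 ≤ p) (hp : p ≠ ⊤) (S : SD Ω p U G H) (w : EV m)
    (hw : StarDir Ω w) (a : EV m) :
    eLpNorm (Ω.indicator fun x => ∑ j, a j * (G j (x + w) - G j x)) p volume
      ≤ m * ENNReal.ofReal ‖a‖ * ENNReal.ofReal ‖w‖ * SH p H := by
  have : (Ω.indicator fun x => ∑ j, a j * (G j (x + w) - G j x))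
      = ∑ j, a j • (Ω.indicator fun x => G j (x + w) - G j x) := by
    ext x
    by_cases hx : x ∈ Ω <;> simp [hx]
  rw [this]
  have mm : ∀ j, Measurable (Ω.indicator fun x => G j (x + w) - G j x) := fun j =>
    (((S.mG j).comp (measurable_add_const w)).sub (S.mG j)).indicator hΩ.measurableSet
  refine (eLpNorm_sum_le (fun i _ => ((mm i).const_smul _).aestronglyMeasurable) hp1).trans ?_
  calc ∑ i, eLpNorm (a i • (Ω.indicator fun x => G i (x + w) - G i x)) p volume
      ≤ ∑ _i : Fin m, ENNReal.ofReal ‖a‖ * (ENNReal.ofReal ‖w‖ * SH p H) := by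
        refine Finset.sum_le_sum fun i _ => ?_
        rw [eLpNorm_const_smul]
        gcongr
        · rw [← ofReal_norm]
          exact ENNReal.ofReal_le_ofReal (coord_le a i)
        · exact diffG hΩ hp1 hp S w hw i
    _ = _ := by simp [mul_assoc]

/-- Taylor remainder -/
def Rem (U : EV m → ℝ) (G : Fin m → EV m → ℝ) (x z : EV m) : ℝ :=
  U (x + z) - U x - ∑ j, z j * G j x

lemma rem_est (hΩ : IsOpen Ω) (hp1 : 1 ≤ p) (hp : p ≠ ⊤) (S : SD Ω p U G H) (w : EV m)
    (hw : StarDir Ω w) :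
    eLpNorm (Ω.indicator fun x => Rem U G x w) p volume
      ≤ m * ENNReal.ofReal ‖w‖ * ENNReal.ofReal ‖w‖ * SH p H := by
  have h1 := ftc Ω hΩ w hw U (fun x => ∑ j, w j * G j x) (S.lU.locallyIntegrable hp1)
    ((memLp_finsetSum _ fun i _ => (S.lG i).const_mul _).locallyIntegrable hp1)
    (WD_lin Ω _ _ (S.lU.locallyIntegrable hp1)
      (fun i => (S.lG i).locallyIntegrable hp1) S.wU w)
  have mK : Measurable (fun x => ∑ j, w j * G j x) :=
    Finset.measurable_fun_sum _ fun i _ => (S.mG i).const_mul _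
  have h2 : eLpNorm (Ω.indicator fun x => Rem U G x w) p volume ≤
      eLpNorm (fun x => ∫⁻ s in Set.Icc (0:ℝ) 1, 1 *
        ‖Ω.indicator (fun x => ∑ j, w j * (G j (x + s • w) - G j x)) x‖ₑ) p volume := by
    refine eLpNorm_mono_enorm_ae ?_
    filter_upwards [h1] with x hx
    by_cases hxΩ : x ∈ Ω
    · simp only [Set.indicator_of_mem hxΩ, Rem]
      rw [hx hxΩ, enorm_eq_self]
      refine (enorm_integral_sub_le _ _ (mK.comp (by fun_prop)) _).trans (le_of_eq ?_)
      congr 1; ext s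
      simp only [Function.comp]
      rw [one_mul, ← Finset.sum_sub_distrib]
      congr 2; ext j; ring
    · simp [hxΩ]
  refine h2.trans ?_
  refine (mink volume (volume.restrict (Set.Icc (0:ℝ) 1)) (fun _ => 1)
    (fun x s => ‖Ω.indicator (fun x => ∑ j, w j * (G j (x + s • w) - G j x)) x‖ₑ)
    measurable_const ?_ p hp1 hp 1
    (m * ENNReal.ofReal ‖w‖ * ENNReal.ofReal ‖w‖ * SH p H) (by simp)
    ?_).trans (by simp)
  · apply Measurable.enorm
    have : Measurable (fun q : EV m × ℝ => ∑ j, w j * (G j (q.1 + q.2 • w) - G j q.1)) :=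
      Finset.measurable_fun_sum _ fun i _ => (((S.mG i).comp (by fun_prop)).sub
        ((S.mG i).comp measurable_fst)).const_mul _
    have := this.indicator (hΩ.measurableSet.preimage measurable_fst)
    exact this
  · filter_upwards [ae_restrict_mem measurableSet_Icc] with s hs
    rw [eLpNorm_enorm]
    refine (sum_diffG hΩ hp1 hp S (s • w) (hw.smul hs) w).trans ?_
    gcongr
    rw [norm_smul, Real.norm_of_nonneg hs.1]
    exact mul_le_of_le_one_left (norm_nonneg _) hs.2
end

section
variable {n : ℕ}

lemma fc_apply (x : EV (n+1)) (i : Fin n) : firstCoords x i = x i.castSucc := rfl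

lemma fc_add (x y : EV (n+1)) : firstCoords (x + y) = firstCoords x + firstCoords y := by
  ext i; simp [fc_apply]

lemma fc_sub (x y : EV (n+1)) : firstCoords (x - y) = firstCoords x - firstCoords y := by
  ext i; simp [fc_apply]

lemma fc_smul (s : ℝ) (x : EV (n+1)) : firstCoords (s • x) = s • firstCoords x := by
  ext i; simp [fc_apply]

lemma fc_norm_sq (x : EV (n+1)) : ‖x‖^2 = ‖firstCoords x‖^2 + (x (Fin.last n))^2 := by
  simp [EuclideanSpace.norm_sq_eq, Fin.sum_univ_castSucc, fc_apply]

lemma fc_norm_le (x : EV (n+1)) : ‖firstCoords x‖ ≤ ‖x‖ := by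
  have := fc_norm_sq x
  exact abs_le_of_sq_le_sq' (by nlinarith [sq_nonneg (x (Fin.last n))]) (norm_nonneg _) |>.2

/-- the linear map `firstCoords` as a continuous linear map -/
def fcL (n : ℕ) : EV (n+1) →L[ℝ] EV n :=
  LinearMap.mkContinuous
    { toFun := firstCoords, map_add' := fc_add, map_smul' := fc_smul } 1
    (fun x => by simpa using fc_norm_le x)

lemma fcL_apply (x : EV (n+1)) : fcL n x = firstCoords x := rfl

lemma fc_cont : Continuous (firstCoords (n := n)) := (fcL n).continuous

/-- last basis vector -/
def eN (n : ℕ) : EV (n+1) := EuclideanSpace.single (Fin.last n) 1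

lemma eN_last : (eN n) (Fin.last n) = 1 := by simp [eN]
lemma eN_cast (i : Fin n) : (eN n) i.castSucc = 0 := by
  simp [eN, (Fin.castSucc_lt_last i).ne]
lemma eN_norm : ‖eN n‖ = 1 := by simp [eN]
lemma fc_eN : firstCoords (eN n) = 0 := by ext i; simp [fc_apply, eN_cast]

variable {γ : EV n → ℝ}

/-- Lipschitz with constant one -/
def Lip1 (γ : EV n → ℝ) : Prop := ∀ a b, |γ a - γ b| ≤ ‖a - b‖

lemma Lip1.cont (h : Lip1 γ) : Continuous γ := by
  have : LipschitzWith 1 γ := LipschitzWith.of_dist_le_mul fun a b => by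
    simpa [dist_eq_norm] using h a b
  exact this.continuous

lemma hs_open (h : Lip1 γ) : IsOpen (halfSpace γ) :=
  isOpen_lt (h.cont.comp fc_cont) (by fun_prop)

lemma hs_star (h : Lip1 γ) (w : EV (n+1)) (hw : ‖firstCoords w‖ ≤ w (Fin.last n)) :
    StarDir (halfSpace γ) w := by
  intro x hx s hs
  simp only [halfSpace, Set.mem_ofPred_eq] at hx ⊢
  have := h (firstCoords (x + s • w)) (firstCoords x)
  rw [fc_add, fc_smul] at *
  have h2 : ‖firstCoords x + s • firstCoords w - firstCoords x‖ = s * ‖firstCoords w‖ := by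
    rw [add_sub_cancel_left, norm_smul, Real.norm_of_nonneg hs.1]
  rw [h2] at this
  have h3 := (abs_le.1 this).2
  have h4 := mul_le_mul_of_nonneg_left hw hs.1
  simp only [PiLp.add_apply, PiLp.smul_apply, smul_eq_mul]
  linarith

lemma rem_both {p : ℝ≥0∞} {U : EV (n+1) → ℝ} {G : Fin (n+1) → EV (n+1) → ℝ}
    {H : Fin (n+1) → Fin (n+1) → EV (n+1) → ℝ} (h : Lip1 γ)
    (hp1 : 1 ≤ p) (hp : p ≠ ⊤) (S : SD (halfSpace γ) p U G H) (z : EV (n+1)) :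
    eLpNorm ((halfSpace γ).indicator fun x =>
        (halfSpace γ).indicator (fun _ => Rem U G x z) (x + z)) p volume
      ≤ 23 * (n+1 : ℕ) * ENNReal.ofReal (‖z‖^2) * SH p H := by
  set Ω := halfSpace γ
  have hΩ : IsOpen Ω := hs_open h
  set e' : EV (n+1) := (2 * ‖z‖) • eN n with he'
  set w : EV (n+1) := z + e' with hwdef
  have he1 : StarDir Ω e' := hs_star h _ (by
    rw [he', fc_smul, fc_eN]; simp [eN_last])
  have hw1 : StarDir Ω w := hs_star h _ (by
    rw [hwdef, he', fc_add, fc_smul, fc_eN]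
    have h1 := fc_norm_le z
    have h2 := (abs_le.1 (coord_le z (Fin.last n))).1
    simp [eN_last]; linarith)
  have hen : ‖e'‖ = 2 * ‖z‖ := by rw [he', norm_smul, eN_norm]; simp
  have hwn : ‖w‖ ≤ 3 * ‖z‖ := by
    refine (norm_add_le _ _).trans ?_; rw [hen]; linarith
  set f1 := Ω.indicator fun x => Rem U G x w with hf1
  set f2 := Ω.indicator fun x => Rem U G x e' with hf2
  set f3 := Ω.indicator fun x => ∑ j, e' j * (G j (x + w) - G j x) with hf3
  set f4 := Ω.indicator fun x => ∑ j, e' j * (G j (x + e') - G j x) with hf4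
  have mRem : ∀ v, Measurable fun x => Rem U G x v := fun v =>
    ((S.mU.comp (measurable_add_const v)).sub S.mU).sub
      (Finset.measurable_fun_sum _ fun i _ => (S.mG i).const_mul _)
  have mS : ∀ v, Measurable fun x => ∑ j, e' j * (G j (x + v) - G j x) := fun v =>
    Finset.measurable_fun_sum _ fun i _ =>
      (((S.mG i).comp (measurable_add_const v)).sub (S.mG i)).const_mul _
  have m1 : Measurable f1 := (mRem _).indicator hΩ.measurableSet
  have m2 : Measurable f2 := (mRem _).indicator hΩ.measurableSet
  have m3 : Measurable f3 := (mS _).indicator hΩ.measurableSet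
  have m4 : Measurable f4 := (mS _).indicator hΩ.measurableSet
  have m2' : Measurable (fun x => f2 (x + z)) := m2.comp (measurable_add_const z)
  have m4' : Measurable (fun x => f4 (x + z)) := m4.comp (measurable_add_const z)
  have hpt : ∀ x, ‖(Ω.indicator fun x => Ω.indicator (fun _ => Rem U G x z) (x + z)) x‖ₑ
      ≤ ‖((f1 - fun x => f2 (x + z)) - f3 + fun x => f4 (x + z)) x‖ₑ := by
    intro x
    by_cases hx : x ∈ Ω
    · by_cases hxz : x + z ∈ Ω
      · apply le_of_eq; congr 1
        simp only [Set.indicator_of_mem hx, Set.indicator_of_mem hxz, Pi.sub_apply, Pi.add_apply,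
          hf1, hf2, hf3, hf4, Rem]
        have : x + w = x + z + e' := by rw [hwdef, add_assoc]
        rw [this]
        have e1 : ∑ j, w j * G j x = ∑ j, z j * G j x + ∑ j, e' j * G j x := by
          rw [← Finset.sum_add_distrib]; refine Finset.sum_congr rfl fun j _ => ?_
          simp [hwdef]; ring
        rw [e1]
        simp_rw [mul_sub, Finset.sum_sub_distrib]
        ring
      · rw [Set.indicator_of_mem hx, Set.indicator_of_notMem hxz]; simp
    · simp [hx]
  refine (eLpNorm_mono_enorm hpt).trans ?_
  refine (eLpNorm_add_le ((m1.sub m2').sub m3).aestronglyMeasurable m4'.aestronglyMeasurable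
    hp1).trans ?_
  refine (add_le_add_left ((eLpNorm_sub_le (m1.sub m2').aestronglyMeasurable
    m3.aestronglyMeasurable hp1).trans (add_le_add_left (eLpNorm_sub_le m1.aestronglyMeasurable
    m2'.aestronglyMeasurable hp1) _)) _).trans ?_
  rw [eLpNorm_shift f2 m2, eLpNorm_shift f4 m4]
  have b1 := rem_est hΩ hp1 hp S w hw1
  have b2 := rem_est hΩ hp1 hp S e' he1
  have b3 := sum_diffG hΩ hp1 hp S w hw1 e'
  have b4 := sum_diffG hΩ hp1 hp S e' he1 e'
  have c1 : ENNReal.ofReal ‖w‖ ≤ 3 * ENNReal.ofReal ‖z‖ := by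
    refine (ENNReal.ofReal_le_ofReal hwn).trans ?_
    rw [ENNReal.ofReal_mul (by norm_num)]; simp
  have c2 : ENNReal.ofReal ‖e'‖ = 2 * ENNReal.ofReal ‖z‖ := by
    rw [hen, ENNReal.ofReal_mul (by norm_num)]; simp
  rw [c2] at b2 b3 b4
  have c3 : ENNReal.ofReal (‖z‖^2) = ENNReal.ofReal ‖z‖ * ENNReal.ofReal ‖z‖ := by
    rw [pow_two, ENNReal.ofReal_mul (norm_nonneg _)]
  rw [c3]
  set Z := ENNReal.ofReal ‖z‖
  set k := SH p H
  calc _ ≤ (n+1:ℕ) * (3*Z) * (3*Z) * k + (n+1:ℕ) * (2*Z) * (2*Z) * k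
        + (n+1:ℕ) * (2*Z) * (3*Z) * k + (n+1:ℕ) * (2*Z) * (2*Z) * k := by
        refine add_le_add (add_le_add (add_le_add (b1.trans ?_) b2) (b3.trans ?_)) b4
        · gcongr
        · gcongr
    _ = _ := by ring
end

section
variable {n : ℕ} {γ : EV n → ℝ}

lemma mRem2 {m : ℕ} {U : EV m → ℝ} {G : Fin m → EV m → ℝ} (mU : Measurable U)
    (mG : ∀ i, Measurable (G i)) :
    Measurable (fun q : EV m × EV m => Rem U G q.1 q.2) := by
  unfold Rem
  refine ((mU.comp (measurable_fst.add measurable_snd)).sub (mU.comp measurable_fst)).sub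
      (Finset.measurable_fun_sum _ fun i _ => ?_)
  exact (by fun_prop : Measurable fun q : EV m × EV m => q.2 i).mul ((mG i).comp measurable_fst)

lemma mJ {m : ℕ} {r : EV m → ℝ} (mr : Measurable r) : Measurable (kernelJ r) := by
  unfold kernelJ; exact mr.div (by fun_prop)

/-- absolute version of the remainder part of the operator -/
def TT {m : ℕ} (Ω : Set (EV m)) (r U : EV m → ℝ) (G : Fin m → EV m → ℝ) (x : EV m) : ℝ≥0∞ :=
  ∫⁻ y in Ω, ‖kernelJ r (x - y) * Rem U G x (y - x)‖ₑ

lemma TT_bound {p : ℝ≥0∞} {U : EV (n+1) → ℝ} {G : Fin (n+1) → EV (n+1) → ℝ}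
    {H : Fin (n+1) → Fin (n+1) → EV (n+1) → ℝ} (h : Lip1 γ)
    (hp1 : 1 ≤ p) (hp : p ≠ ⊤) (S : SD (halfSpace γ) p U G H)
    (r : EV (n+1) → ℝ) (mr : Measurable r) (A : ℝ≥0∞) (hA : ∫⁻ z, ‖r z‖ₑ ≤ A) :
    eLpNorm ((halfSpace γ).indicator (TT (halfSpace γ) r U G)) p volume
      ≤ A * (23 * (n+1 : ℕ) * SH p H) := by
  set Ω := halfSpace γ
  have hΩ : IsOpen Ω := hs_open h
  set F : EV (n+1) → EV (n+1) → ℝ := fun z => Ω.indicator fun x =>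
        Ω.indicator (fun _ => Rem U G x z) (x + z) with hF
  have mF : Measurable (fun q : EV (n+1) × EV (n+1) => F q.2 q.1) := by
    have h1 := (mRem2 S.mU S.mG).indicator ((hΩ.measurableSet.preimage
      (measurable_fst.add measurable_snd : Measurable fun q : EV (n+1) × EV (n+1) => q.1 + q.2)))
    exact h1.indicator (hΩ.measurableSet.preimage measurable_fst)
  have e1 : ∀ x, Ω.indicator (TT Ω r U G) x
      = ∫⁻ z, ‖r (-z)‖ₑ * ‖(‖z‖^2)⁻¹ • F z x‖ₑ := by
    intro x
    by_cases hx : x ∈ Ω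
    · rw [Set.indicator_of_mem hx, TT, ← lintegral_indicator hΩ.measurableSet,
        ← lintegral_add_left_eq_self _ x]
      congr 1; ext z
      simp only [hF, Set.indicator_of_mem hx]
      by_cases hz : x + z ∈ Ω
      · simp only [Set.indicator_of_mem hz, kernelJ]
        rw [← enorm_mul, add_sub_cancel_left, sub_add_cancel_left, norm_neg, smul_eq_mul]
        congr 1; ring
      · simp [hz]
    · simp [hF, hx]
  have e2 : eLpNorm (Ω.indicator (TT Ω r U G)) p volume
      = eLpNorm (fun x => ∫⁻ z, ‖r (-z)‖ₑ * ‖(‖z‖^2)⁻¹ • F z x‖ₑ) p volume := by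
    congr 1; ext x; exact e1 x
  rw [e2]
  refine mink volume volume (fun z => ‖r (-z)‖ₑ) (fun x z => ‖(‖z‖^2)⁻¹ • F z x‖ₑ)
    (mr.comp measurable_neg).enorm ?_ p hp1 hp A _ ?_ ?_
  · apply Measurable.enorm
    exact Measurable.smul (by fun_prop : Measurable fun q : EV (n+1) × EV (n+1) => (‖q.2‖^2)⁻¹) mF
  · rw [lintegral_neg_eq_self (fun z => ‖r z‖ₑ)]
    exact hA
  · refine Eventually.of_forall fun z => ?_
    rw [eLpNorm_enorm]
    have := eLpNorm_const_smul ((‖z‖^2)⁻¹) (F z) p (volume : Measure (EV (n+1)))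
    refine (le_of_eq this).trans ?_
    by_cases hz : z = 0
    · subst hz; simp
    have hz2 : 0 < ‖z‖^2 := by positivity
    calc _ ≤ ‖(‖z‖^2)⁻¹‖ₑ * (23 * (n+1 : ℕ) * ENNReal.ofReal (‖z‖^2) * SH p H) := by
          gcongr; exact rem_both h hp1 hp S z
      _ = (ENNReal.ofReal (‖z‖^2)⁻¹ * ENNReal.ofReal (‖z‖^2)) * (23 * (n+1 : ℕ) * SH p H) := by
          rw [Real.enorm_of_nonneg (by positivity)]; ring
      _ = _ := by
          rw [← ENNReal.ofReal_mul (by positivity), inv_mul_cancel₀ hz2.ne']; simp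
end

section
variable {m : ℕ}

/-- basic kernel facts -/
structure KF (r : EV m → ℝ) : Prop where
  mr : Measurable r
  nn : ∀ x, 0 ≤ r x
  ev : ∀ᵐ x : EV m, r (-x) = r x
  ii : Integrable r volume

lemma A1.kf {ρ : EV m → ℝ} (h : A1 ρ) : KF ρ := by
  obtain ⟨a, b, c, d, e⟩ := h
  refine ⟨a, b, d, ?_⟩
  refine e.mono' a.aestronglyMeasurable (Eventually.of_forall fun x => ?_)
  rw [Real.norm_of_nonneg (b x)]
  nlinarith [b x, norm_nonneg x, mul_nonneg (b x) (norm_nonneg x)]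

lemma KF.scaled {ρ : EV m → ℝ} (h : KF ρ) {ε : ℝ} (hε : 0 < ε) : KF (scaled ρ ε) := by
  have hm : Measurable fun x : EV m => ε⁻¹ • x := measurable_const_smul _
  refine ⟨(h.mr.comp hm).const_mul _, fun x => mul_nonneg (by positivity) (h.nn _), ?_, ?_⟩
  · have : ∀ᵐ x : EV m, ρ (-(ε⁻¹ • x)) = ρ (ε⁻¹ • x) := by
      have hq : Measure.QuasiMeasurePreserving (fun x : EV m => ε⁻¹ • x) volume volume := by
        refine ⟨hm, ?_⟩
        have := Measure.map_addHaar_smul (volume : Measure (EV m)) (r := ε⁻¹) (by positivity)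
        rw [this]
        exact Measure.smul_absolutelyContinuous
      exact hq.ae h.ev
    filter_upwards [this] with x hx
    simp [_root_.scaled, ← hx]
  · unfold _root_.scaled
    exact ((integrable_comp_smul_iff volume ρ (by positivity : ε⁻¹ ≠ 0)).2 h.ii).const_mul _

lemma scaled_integral (ρ : EV m → ℝ) {ε : ℝ} (hε : 0 < ε) : 
    ∫ x, scaled ρ ε x = ∫ x, ρ x := by
  unfold _root_.scaled
  rw [integral_const_mul, Measure.integral_comp_inv_smul]
  simp [abs_of_pos hε]
  field_simp

lemma KF.lint {r : EV m → ℝ} (h : KF r) : ∫⁻ z, ‖r z‖ₑ = ENNReal.ofReal (∫ z, r z) := by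
  rw [ofReal_integral_eq_lintegral_ofReal h.ii (Eventually.of_forall h.nn)]
  congr 1; ext z; rw [Real.enorm_of_nonneg (h.nn z)]

lemma KF.Jnn {r : EV m → ℝ} (h : KF r) (x : EV m) : 0 ≤ kernelJ r x :=
  div_nonneg (h.nn x) (by positivity)

lemma KF.Jev {r : EV m → ℝ} (h : KF r) : ∀ᵐ x : EV m, kernelJ r (-x) = kernelJ r x := by
  filter_upwards [h.ev] with x hx
  simp [kernelJ, hx]

/-- linear form -/
def lin (a : Fin m → ℝ) (z : EV m) : ℝ := ∑ j, z j * a j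

lemma lin_cont (a : Fin m → ℝ) : Continuous (lin a) := by unfold lin; fun_prop
lemma lin_neg (a : Fin m → ℝ) (z : EV m) : lin a (-z) = - lin a z := by simp [lin]
lemma lin_le (a : Fin m → ℝ) (z : EV m) : |lin a z| ≤ ‖z‖ * ∑ j, |a j| := by
  unfold lin
  refine (Finset.abs_sum_le_sum_abs _ _).trans ?_
  rw [Finset.mul_sum]
  refine Finset.sum_le_sum fun j _ => ?_
  rw [abs_mul]
  gcongr
  exact coord_le z j

lemma KF.Jlin_int {r : EV m → ℝ} (h : KF r) (a : Fin m → ℝ) {d : ℝ} (hd : 0 < d) :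
    IntegrableOn (fun z => kernelJ r z * lin a z) {z | d ≤ ‖z‖} volume := by
  have hms : MeasurableSet {z : EV m | d ≤ ‖z‖} := measurableSet_le (by fun_prop) (by fun_prop)
  refine Integrable.mono' (g := fun z => (d⁻¹ * ∑ j, |a j|) * r z)
    (h.ii.const_mul _).restrict
    ((mJ h.mr).mul (lin_cont a).measurable).aestronglyMeasurable ?_
  filter_upwards [ae_restrict_mem hms] with z hz
  have hz' : d ≤ ‖z‖ := hz
  have hz0 : 0 < ‖z‖ := hd.trans_le hz'
  rw [norm_mul, Real.norm_of_nonneg (h.Jnn z), Real.norm_eq_abs]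
  have hS : 0 ≤ ∑ j, |a j| := Finset.sum_nonneg fun _ _ => abs_nonneg _
  calc kernelJ r z * |lin a z| ≤ kernelJ r z * (‖z‖ * ∑ j, |a j|) := by
        gcongr
        · exact h.Jnn z
        · exact lin_le a z
    _ = (‖z‖⁻¹ * ∑ j, |a j|) * r z := by
        unfold kernelJ; field_simp
    _ ≤ (d⁻¹ * ∑ j, |a j|) * r z := by
        have := h.nn z
        gcongr

lemma odd_int (f : EV m → ℝ) (hf : ∀ᵐ z, f (-z) = - f z) : ∫ z, f z = 0 := by
  have h1 := integral_neg_eq_self f (volume : Measure (EV m))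
  rw [integral_congr_ae hf, integral_neg] at h1
  linarith

lemma KF.odd_set {r : EV m → ℝ} (h : KF r) (a : Fin m → ℝ) (A : Set (EV m)) (hA : MeasurableSet A)
    (hs : ∀ z, z ∈ A → -z ∈ A) : ∫ z in A, kernelJ r z * lin a z = 0 := by
  rw [← integral_indicator hA]
  apply odd_int
  filter_upwards [h.Jev] with z hz
  by_cases hzA : z ∈ A
  · rw [Set.indicator_of_mem hzA, Set.indicator_of_mem (hs z hzA), hz, lin_neg]; ring
  · have : -z ∉ A := fun hh => hzA (by simpa using hs _ hh)
    simp [hzA, this]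

/-- shift of a set integral -/
lemma shift_set (x : EV m) (A : Set (EV m)) (hA : MeasurableSet A) (f : EV m → ℝ) :
    ∫ y in A, f y = ∫ z in {z | x + z ∈ A}, f (x + z) := by
  have hA' : MeasurableSet {z | x + z ∈ A} := hA.preimage (measurable_const_add x)
  rw [← integral_indicator hA, ← integral_indicator hA', ← integral_add_left_eq_self _ x]
  rfl

/-- boundary part -/
def BB (Ω : Set (EV m)) (r : EV m → ℝ) (d : ℝ) (a : Fin m → ℝ) (x : EV m) : ℝ :=
  ∫ z in {z | x + z ∈ Ω} ∩ {z | d ≤ ‖z‖}, kernelJ r z * lin a z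

/-- remainder part -/
def TI (Ω : Set (EV m)) (r U : EV m → ℝ) (G : Fin m → EV m → ℝ) (x : EV m) : ℝ :=
  ∫ y in Ω, kernelJ r (x - y) * Rem U G x (y - x)

lemma pv_main {Ω : Set (EV m)} (hΩ : MeasurableSet Ω) {r U : EV m → ℝ} (h : KF r)
    {G : Fin m → EV m → ℝ} (mU : Measurable U) (mG : ∀ i, Measurable (G i)) {x : EV m}
    {d : ℝ} (hd : 0 < d) (hball : Metric.ball x d ⊆ Ω) (hT : TT Ω r U G x < ⊤) :
    Tendsto (fun s : ℝ =>
      ∫ y in Ω ∩ {y : EV m | s ≤ dist x y}, kernelJ r (x - y) * (U x - U y))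
      (𝓝[>] 0) (𝓝 (- TI Ω r U G x - BB Ω r d (fun j => G j x) x)) := by
  have mS : ∀ s, MeasurableSet {y : EV m | s ≤ dist x y} := fun s =>
    measurableSet_le (by fun_prop) (by fun_prop)
  set f : EV m → ℝ := fun y => kernelJ r (x - y) * Rem U G x (y - x) with hf
  have mf : Measurable f := ((mJ h.mr).comp (by fun_prop)).mul
    ((mRem2 mU mG).comp (by fun_prop : Measurable fun y : EV m => (x, y - x)))
  have hfi : IntegrableOn f Ω volume := ⟨mf.aestronglyMeasurable, hT⟩
  set a := fun j => G j x
  -- the remainder part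
  have h1 : Tendsto (fun s : ℝ => ∫ y in Ω ∩ {y : EV m | s ≤ dist x y}, f y) (𝓝[>] 0)
      (𝓝 (∫ y in Ω, f y)) := by
    have e : ∀ s : ℝ, ∫ y in Ω ∩ {y : EV m | s ≤ dist x y}, f y
        = ∫ y in Ω, {y : EV m | s ≤ dist x y}.indicator f y := by
      intro s; rw [setIntegral_indicator (mS s)]
    simp_rw [e]
    refine tendsto_integral_filter_of_dominated_convergence (fun y => ‖f y‖)
      (Eventually.of_forall fun s => (mf.indicator (mS s)).aestronglyMeasurable)
      (Eventually.of_forall fun s => Eventually.of_forall fun y => norm_indicator_le_norm_self _ _)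
      hfi.norm (Eventually.of_forall fun y => ?_)
    by_cases hy : y = x
    · have : f y = 0 := by simp [hf, hy, kernelJ]
      have h2 : ∀ s, {y : EV m | s ≤ dist x y}.indicator f y = 0 := fun s => by
        by_cases hh : y ∈ {y : EV m | s ≤ dist x y} <;> simp [this, Set.indicator]
      simp only [h2, this]; exact tendsto_const_nhds
    · have hpos : 0 < dist x y := dist_pos.2 (Ne.symm hy)
      refine tendsto_const_nhds.congr' ?_
      filter_upwards [Ioo_mem_nhdsGT hpos] with s hs
      rw [Set.indicator_of_mem]; exact hs.2.le
  have h2 : ∀ᶠ s in 𝓝[>] (0:ℝ), ∫ y in Ω ∩ {y : EV m | s ≤ dist x y},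
      kernelJ r (x - y) * (U x - U y)
      = - (∫ y in Ω ∩ {y : EV m | s ≤ dist x y}, f y) - BB Ω r d a x := by
    filter_upwards [Ioo_mem_nhdsGT hd] with s hs
    -- linear part
    have mset : MeasurableSet (Ω ∩ {y : EV m | s ≤ dist x y}) := hΩ.inter (mS s)
    have ms0 : ∀ t : ℝ, MeasurableSet {z : EV m | t ≤ ‖z‖} := fun t =>
      measurableSet_le (by fun_prop) (by fun_prop)
    have mΩx : MeasurableSet {z | x + z ∈ Ω} := hΩ.preimage (measurable_const_add x)
    have hset : {z | x + z ∈ Ω ∩ {y : EV m | s ≤ dist x y}} = {z | x + z ∈ Ω} ∩ {z | s ≤ ‖z‖} := by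
      ext z; simp [dist_eq_norm]
    have gae : ∀ᵐ z : EV m, kernelJ r (x - (x + z)) * lin a (x + z - x) = kernelJ r z * lin a z := by
      filter_upwards [h.Jev] with z hz
      rw [add_sub_cancel_left, sub_add_cancel_left, hz]
    have i0 : IntegrableOn (fun z => kernelJ r z * lin a z) ({z | x + z ∈ Ω} ∩ {z | s ≤ ‖z‖}) :=
      (h.Jlin_int a hs.1).mono_set Set.inter_subset_right
    have i1 : IntegrableOn (fun y => kernelJ r (x - y) * lin a (y - x))
        (Ω ∩ {y : EV m | s ≤ dist x y}) volume := by
      have i2 : Integrable ((({z | x + z ∈ Ω} ∩ {z | s ≤ ‖z‖}).indicator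
        (fun z => kernelJ r (x - (x+z)) * lin a ((x + z) - x)))) volume := by
        rw [integrable_indicator_iff (mΩx.inter (ms0 s))]
        exact i0.congr (ae_restrict_of_ae (gae.mono fun z hz => hz.symm))
      have i3 := i2.comp_sub_right x
      rw [← integrable_indicator_iff mset]
      refine i3.congr (Eventually.of_forall fun y => ?_)
      simp only [Set.indicator]
      congr 1
      · simp [dist_eq_norm, norm_sub_rev]
      · simp
    have lin_part : ∫ y in Ω ∩ {y : EV m | s ≤ dist x y}, kernelJ r (x - y) * lin a (y - x)
        = BB Ω r d a x := by
      rw [shift_set x _ mset, hset, setIntegral_congr_ae (g := fun z => kernelJ r z * lin a z)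
        (mΩx.inter (ms0 s)) (gae.mono fun z hz _ => hz)]
      have hsplit : {z | x + z ∈ Ω} ∩ {z | s ≤ ‖z‖}
          = ({z | x + z ∈ Ω} ∩ {z | d ≤ ‖z‖}) ∪ {z | s ≤ ‖z‖ ∧ ‖z‖ < d} := by
        ext z
        constructor
        · rintro ⟨h1, h2⟩
          rcases le_or_gt d ‖z‖ with h3 | h3
          · exact Or.inl ⟨h1, h3⟩
          · exact Or.inr ⟨h2, h3⟩
        · rintro (⟨h1, h2⟩ | ⟨h1, h2⟩)
          · exact ⟨h1, hs.2.le.trans h2⟩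
          · exact ⟨hball (by simpa [dist_eq_norm] using h2), h1⟩
      have mann : MeasurableSet {z : EV m | s ≤ ‖z‖ ∧ ‖z‖ < d} :=
        (ms0 s).inter (measurableSet_lt (f := fun z : EV m => ‖z‖) (by fun_prop) (by fun_prop))
      rw [hsplit, setIntegral_union]
      · rw [h.odd_set a _ mann (fun z hz => by simpa using hz), add_zero]; rfl
      · rw [Set.disjoint_left]; rintro z ⟨_, h1⟩ ⟨_, h2⟩; exact absurd h1 (not_le.2 h2)
      · exact mann
      · exact (h.Jlin_int a hd).mono_set Set.inter_subset_right
      · exact (h.Jlin_int a hs.1).mono_set fun z hz => hz.1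
    rw [← lin_part, ← integral_neg, ← integral_sub]
    · congr 1; ext y
      simp only [hf, Rem, lin, a]
      rw [add_sub_cancel]
      ring
    · exact (hfi.mono_set Set.inter_subset_left).neg
    · exact i1
  have h3 := (h1.neg.sub_const (BB Ω r d a x)).congr' (h2.mono fun s hs => hs.symm)
  exact h3
end

section
variable {n : ℕ}

lemma snocE_last (z : EV n) (t : ℝ) : snocE z t (Fin.last n) = t := by
  simp [snocE]
lemma snocE_cast (z : EV n) (t : ℝ) (i : Fin n) : snocE z t i.castSucc = z i := by
  simp [snocE]
lemma fc_snocE (z : EV n) (t : ℝ) : firstCoords (snocE z t) = z := by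
  ext i; rw [fc_apply, snocE_cast]

lemma snocE_mp : MeasurePreserving (fun q : EV n × ℝ => snocE q.1 q.2)
    (volume.prod volume) volume := by
  have h1 : MeasurePreserving (fun q : EV n × ℝ => (q.2, (WithLp.ofLp q.1 : Fin n → ℝ)))
      (volume.prod volume) (volume.prod volume) :=
    ((MeasurePreserving.id _).prod (PiLp.volume_preserving_ofLp (Fin n))).comp
      Measure.measurePreserving_swap
  have h2 := (volume_preserving_piFinSuccAbove (fun _ : Fin (n+1) => ℝ) (Fin.last n)).symm
  have h3 := PiLp.volume_preserving_toLp (Fin (n+1))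
  have := h3.comp (h2.comp h1)
  have e : (fun q : EV n × ℝ => snocE q.1 q.2) = (WithLp.toLp 2 ∘
        ⇑(MeasurableEquiv.piFinSuccAbove (fun x => ℝ) (Fin.last n)).symm ∘ fun q : EV n × ℝ =>
          (q.2, q.1.ofLp)) := by
    funext q
    simp [snocE, MeasurableEquiv.piFinSuccAbove]
    rfl
  rw [e]; exact this

lemma householder (u : Fin (n+1) → ℝ) :
    ((1 : Matrix (Fin (n+1)) (Fin (n+1)) ℝ) - (2 / (u ⬝ᵥ u)) • vecMulVec u u)ᵀ *
    (1 - (2 / (u ⬝ᵥ u)) • vecMulVec u u) = 1 := by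
  have ht : ((1 : Matrix (Fin (n+1)) (Fin (n+1)) ℝ) - (2 / (u ⬝ᵥ u)) • vecMulVec u u)ᵀ
      = 1 - (2 / (u ⬝ᵥ u)) • vecMulVec u u := by
    rw [transpose_sub, transpose_one, transpose_smul, transpose_vecMulVec]
  rw [ht]
  set c := 2 / (u ⬝ᵥ u) with hc
  have hm : vecMulVec u u * vecMulVec u u = (u ⬝ᵥ u) • vecMulVec u u := by
    rw [vecMulVec_mul_vecMulVec]
    ext i j; simp [vecMulVec_apply]; ring
  rw [sub_mul, mul_sub, mul_sub, one_mul, mul_one, one_mul, smul_mul_smul_comm, hm, smul_smul]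
  have : (c * c * (u ⬝ᵥ u)) = 2 * c := by
    by_cases h0 : u ⬝ᵥ u = 0
    · simp [hc, h0]
    · rw [hc]; field_simp
  rw [this]
  module

lemma exists_rot (v : Fin (n+1) → ℝ) (hv : v ⬝ᵥ v = 1) (hpos : 0 < v (Fin.last n)) :
    ∃ Q : Matrix (Fin (n+1)) (Fin (n+1)) ℝ, Qᵀ * Q = 1 ∧ Q.det = 1 ∧
      Q *ᵥ (Pi.single (Fin.last n) 1) = v := by
  rcases n with _ | n
  · refine ⟨1, by simp, by simp, ?_⟩
    have h0 : v 0 = 1 := by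
      simp [dotProduct] at hv hpos
      nlinarith
    ext i; fin_cases i; simp [h0]
  set e : Fin (n+1+1) → ℝ := Pi.single (Fin.last (n+1)) 1 with he
  set u := v - e with hu
  set Q := ((1 : Matrix (Fin (n+1+1)) (Fin (n+1+1)) ℝ) - (2 / (u ⬝ᵥ u)) • vecMulVec u u) with hQ
  have hQQ : Qᵀ * Q = 1 := householder u
  have hee : e ⬝ᵥ e = 1 := by simp [he]
  have huu : u ⬝ᵥ u = 2 - 2 * (u ⬝ᵥ e + 1) := by
    rw [hu]; simp only [sub_dotProduct, dotProduct_sub, hv, hee, dotProduct_comm e v]; ring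
  have hQe : Q *ᵥ e = v := by
    rw [hQ, sub_mulVec, one_mulVec, smul_mulVec, vecMulVec_mulVec]
    by_cases h0 : u ⬝ᵥ u = 0
    · have : u = 0 := dotProduct_self_eq_zero.1 h0
      rw [this]; simp only [smul_zero, sub_zero]
      exact (sub_eq_zero.1 this).symm
    · have h1 : u ⬝ᵥ e = -(u ⬝ᵥ u)/2 := by linarith
      rw [h1, ← sub_eq_zero]
      ext i
      simp only [Pi.sub_apply, Pi.smul_apply, Pi.zero_apply, smul_eq_mul, MulOpposite.smul_eq_mul_unop, MulOpposite.unop_op]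
      field_simp
      rw [hu]; simp
  have hd : Q.det * Q.det = 1 := by
    have := congrArg det hQQ
    simpa using this
  rcases mul_self_eq_one_iff.1 hd with h1 | h1
  · exact ⟨Q, hQQ, h1, hQe⟩
  · set R : Matrix (Fin (n+1+1)) (Fin (n+1+1)) ℝ := diagonal (Function.update 1 0 (-1)) with hR
    have hRR : R * R = 1 := by
      rw [hR, diagonal_mul_diagonal, ← diagonal_one]
      congr 1; ext i
      by_cases hi : i = 0
      · subst hi; simp
      · simp [Function.update_of_ne hi]
    refine ⟨Q * R, ?_, ?_, ?_⟩
    · rw [transpose_mul, Matrix.mul_assoc, ← Matrix.mul_assoc Qᵀ, hQQ, Matrix.one_mul]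
      rw [hR, diagonal_transpose]; exact hRR
    · rw [det_mul, h1, hR, det_diagonal, Finset.prod_update_of_mem (Finset.mem_univ _)]
      simp
    · rw [← mulVec_mulVec]
      have : R *ᵥ e = e := by
        ext i
        rw [hR, mulVec_diagonal]
        by_cases hi : i = 0
        · subst hi; simp [he]
        · simp [Function.update_of_ne hi]
      rw [this, hQe]

lemma mulVecE_apply (Q : Matrix (Fin (n+1)) (Fin (n+1)) ℝ) (y : EV (n+1)) :
    (mulVecE Q y).ofLp = Q *ᵥ y.ofLp := rfl

lemma lin_eq (a : Fin (n+1) → ℝ) (z : EV (n+1)) : lin a z = a ⬝ᵥ z.ofLp := by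
  simp [lin, dotProduct, mul_comm]

lemma lin_mulVecE (Q : Matrix (Fin (n+1)) (Fin (n+1)) ℝ) (a : Fin (n+1) → ℝ) (y : EV (n+1)) :
    lin a (mulVecE Q y) = lin (Qᵀ *ᵥ a) y := by
  rw [lin_eq, lin_eq, mulVecE_apply, dotProduct_mulVec, mulVec_transpose]

lemma mulVecE_norm (Q : Matrix (Fin (n+1)) (Fin (n+1)) ℝ) (hQ : Qᵀ * Q = 1) (y : EV (n+1)) :
    ‖mulVecE Q y‖ = ‖y‖ := by
  have h : ∀ z : EV (n+1), ‖z‖^2 = lin z.ofLp z := by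
    intro z; rw [EuclideanSpace.norm_sq_eq]; simp [lin, pow_two]
  have : ‖mulVecE Q y‖^2 = ‖y‖^2 := by
    rw [h, h, lin_mulVecE, mulVecE_apply, mulVec_mulVec, hQ, one_mulVec]
  exact (pow_left_inj₀ (norm_nonneg _) (norm_nonneg _) two_ne_zero).1 this

lemma mulVecE_mp (Q : Matrix (Fin (n+1)) (Fin (n+1)) ℝ) (hQ : Qᵀ * Q = 1) :
    MeasurePreserving (mulVecE Q) volume volume := by
  let L : EV (n+1) →ₗᵢ[ℝ] EV (n+1) :=
    { toFun := mulVecE Q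
      map_add' := fun x y => by ext i; simp [mulVecE_apply, mulVec_add]
      map_smul' := fun s x => by ext i; simp [mulVecE_apply, mulVec_smul]
      norm_map' := mulVecE_norm Q hQ }
  exact (L.toLinearIsometryEquiv rfl).measurePreserving

/-- the slice condition -/
def OddSl (r : EV (n+1) → ℝ) : Prop :=
  ∀ t : ℝ, ∀ Q : Matrix (Fin (n + 1)) (Fin (n + 1)) ℝ, Qᵀ * Q = 1 → Q.det = 1 →
      (∫ z' : EV n, kernelJ r (mulVecE Q (snocE z' t)) • z') = 0

lemma A2.oddSl {ρ : EV (n+1) → ℝ} (h : A2 ρ) (hM : momentum ρ = 1) : OddSl ρ := by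
  obtain ⟨_, _, A, hA, hAA, hh⟩ := h
  have hA1 : A = 1 := by
    rw [hM] at hAA
    have h1 : (A + 1).PosDef := hA.add PosDef.one
    have h2 : (A - 1) * (A + 1) = 0 := by
      rw [sub_mul, mul_add, hAA]; simp [add_comm]
    have h3 := h1.isUnit
    have h4 := h3.mul_left_eq_zero.1 h2
    exact sub_eq_zero.1 h4
  intro t Q hQ hd
  have := hh t Q hQ hd
  rwa [hA1, Matrix.one_mul] at this

lemma kernel_scaled {m : ℕ} (ρ : EV m → ℝ) {ε : ℝ} (hε : 0 < ε) (z : EV m) :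
    kernelJ (scaled ρ ε) z = (ε^m * ε^2)⁻¹ * kernelJ ρ (ε⁻¹ • z) := by
  by_cases hz : z = 0
  · subst hz; simp [kernelJ]
  have : ‖z‖ ≠ 0 := norm_ne_zero_iff.2 hz
  simp only [kernelJ, scaled, norm_smul, norm_inv, Real.norm_of_nonneg hε.le]
  field_simp

lemma OddSl.scaled {ρ : EV (n+1) → ℝ} (h : OddSl ρ) {ε : ℝ} (hε : 0 < ε) :
    OddSl (scaled ρ ε) := by
  intro t Q hQ hd
  have e1 : ∀ z' : EV n, kernelJ (_root_.scaled ρ ε) (mulVecE Q (snocE z' t)) • z'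
      = (ε^(n+1) * ε^2)⁻¹ • ε • ((fun w : EV n =>
        kernelJ ρ (mulVecE Q (snocE w (ε⁻¹ * t))) • w) (ε⁻¹ • z')) := by
    intro z'
    rw [kernel_scaled ρ hε]
    have : ε⁻¹ • mulVecE Q (snocE z' t) = mulVecE Q (snocE (ε⁻¹ • z') (ε⁻¹ * t)) := by
      have h1 : snocE (ε⁻¹ • z') (ε⁻¹ * t) = ε⁻¹ • snocE z' t := by
        ext i
        refine Fin.lastCases ?_ (fun i => ?_) i
        · simp [snocE_last]
        · simp [snocE_cast]
      rw [h1]; ext i; simp [mulVecE_apply, mulVec_smul]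
    rw [this]
    simp only [smul_smul]
    congr 1
    field_simp
  rw [integral_congr_ae (Eventually.of_forall e1)]
  rw [integral_smul, integral_smul, Measure.integral_comp_inv_smul volume
    (fun w : EV n => kernelJ ρ (mulVecE Q (snocE w (ε⁻¹ * t))) • w), h _ Q hQ hd]
  simp

lemma half_zero {r : EV (n+1) → ℝ} (hr : KF r) (ho : OddSl r) (N τ : Fin (n+1) → ℝ)
    (hN : N (Fin.last n) = 1) (hτ : τ ⬝ᵥ N = 0) {D : ℝ} (hD : 0 < D) :
    ∫ z in {z | D ≤ lin N z}, kernelJ r z * lin τ z = 0 := by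
  set ℓ := Real.sqrt (N ⬝ᵥ N) with hℓ
  have hNN : 0 < N ⬝ᵥ N := by
    have : 0 ≤ N ⬝ᵥ N := Finset.sum_nonneg fun i _ => mul_self_nonneg _
    refine lt_of_le_of_ne this fun h => ?_
    have := dotProduct_self_eq_zero.1 h.symm
    simp [this] at hN
  have hℓp : 0 < ℓ := Real.sqrt_pos.2 hNN
  have hℓℓ : ℓ * ℓ = N ⬝ᵥ N := Real.mul_self_sqrt hNN.le
  obtain ⟨Q, hQ, hdet, hQe⟩ := exists_rot (ℓ⁻¹ • N)
    (by rw [smul_dotProduct, dotProduct_smul, ← hℓℓ]; simp; field_simp)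
    (by simp [hN, hℓp])
  set e : Fin (n+1) → ℝ := Pi.single (Fin.last n) 1 with he
  set b := Qᵀ *ᵥ τ with hb
  have hbl : b (Fin.last n) = 0 := by
    have : b ⬝ᵥ e = 0 := by
      rw [hb, mulVec_transpose, ← dotProduct_mulVec, hQe, dotProduct_smul, hτ]; simp
    simpa [he] using this
  have hQN : Qᵀ *ᵥ N = ℓ • e := by
    have : N = ℓ • (Q *ᵥ e) := by rw [hQe, smul_smul, mul_inv_cancel₀ hℓp.ne', one_smul]
    rw [this, mulVec_smul, mulVec_mulVec, hQ, one_mulVec]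
  set Φ : EV n × ℝ → EV (n+1) := fun q => mulVecE Q (snocE q.1 q.2) with hΦ
  have hmp : MeasurePreserving Φ (volume.prod volume) volume := (mulVecE_mp Q hQ).comp snocE_mp
  have hset : MeasurableSet {z | D ≤ lin N z} := 
    measurableSet_le measurable_const (lin_cont N).measurable
  have hΦn : ∀ q, ‖Φ q‖^2 = ‖q.1‖^2 + q.2^2 := by
    intro q; rw [hΦ]; simp only; rw [mulVecE_norm Q hQ, fc_norm_sq, fc_snocE, snocE_last]
  have mI : Measurable ({z | D ≤ lin N z}.indicator (fun z => kernelJ r z * lin τ z)) :=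
    ((mJ hr.mr).mul (lin_cont τ).measurable).indicator hset
  rw [← integral_indicator hset, ← hmp.map_eq, integral_map hmp.measurable.aemeasurable
    mI.aestronglyMeasurable]
  set F : EV n × ℝ → EV n := fun q => {t : ℝ | D ≤ ℓ * t}.indicator
    (fun _ => kernelJ r (Φ q) • q.1) q.2 with hF
  set b' : EV n := WithLp.toLp 2 (fun i => b i.castSucc) with hb'
  have e1 : ∀ q, {z | D ≤ lin N z}.indicator (fun z => kernelJ r z * lin τ z) (Φ q)
      = inner ℝ b' (F q) := by
    intro q
    have l1 : lin N (Φ q) = ℓ * q.2 := by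
      rw [hΦ]; simp only; rw [lin_mulVecE, hQN, lin_eq]; simp [he, snocE_last]
    have l2 : lin τ (Φ q) = inner ℝ b' q.1 := by
      rw [hΦ]; simp only; rw [lin_mulVecE, ← hb]
      simp [lin, Fin.sum_univ_castSucc, hbl, snocE_cast, PiLp.inner_apply, hb']
    simp only [Set.indicator, Set.mem_ofPred_eq, l1, l2, hF]
    split_ifs
    · rw [inner_smul_right]
    · simp
  simp_rw [e1]
  have mF : Measurable F := by
    have : F = ({q : EV n × ℝ | D ≤ ℓ * q.2}.indicator
      (fun q => kernelJ r (Φ q) • q.1)) := by ext q; rfl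
    rw [this]
    refine Measurable.indicator ?_ (measurableSet_le (by fun_prop) (by fun_prop))
    exact ((mJ hr.mr).comp hmp.measurable).smul measurable_fst
  have iF : Integrable F (volume.prod volume) := by
    have := (hmp.integrable_comp hr.mr.aestronglyMeasurable).2 hr.ii
    refine Integrable.mono' (this.const_mul (ℓ / D)) mF.aestronglyMeasurable
      (Eventually.of_forall fun q => ?_)
    simp only [hF, Set.indicator, Set.mem_ofPred_eq, Function.comp]
    have hnn := hr.nn (Φ q)
    split_ifs with hq
    · have hq2 : D / ℓ ≤ q.2 := by rw [div_le_iff₀ hℓp]; linarith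
      have hp1 : 0 < D / ℓ := by positivity
      have hN1 : D / ℓ ≤ ‖Φ q‖ := by
        refine (pow_le_pow_iff_left₀ (by positivity) (norm_nonneg _) two_ne_zero).1 ?_
        rw [hΦn]; nlinarith [sq_nonneg ‖q.1‖]
      have hN2 : ‖q.1‖ ≤ ‖Φ q‖ := by
        refine (pow_le_pow_iff_left₀ (by positivity) (norm_nonneg _) two_ne_zero).1 ?_
        rw [hΦn]; nlinarith [sq_nonneg q.2]
      have hp2 : 0 < ‖Φ q‖ := hp1.trans_le hN1
      rw [norm_smul, Real.norm_of_nonneg (hr.Jnn _)]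
      calc kernelJ r (Φ q) * ‖q.1‖ ≤ kernelJ r (Φ q) * ‖Φ q‖ := by
            gcongr
            exact hr.Jnn _
        _ = ‖Φ q‖⁻¹ * r (Φ q) := by unfold kernelJ; field_simp
        _ ≤ (D / ℓ)⁻¹ * r (Φ q) := by gcongr
        _ = _ := by rw [inv_div]
    · simp; positivity
  rw [integral_inner iF b', integral_prod_symm F iF]
  have : ∀ t : ℝ, ∫ z' : EV n, F (z', t) = 0 := by
    intro t
    simp only [hF, Set.indicator, Set.mem_ofPred_eq, hΦ]
    split_ifs
    · exact ho t Q hQ hdet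
    · simp
  simp [this]
end

section
variable {n : ℕ}

lemma lint_scale {m : ℕ} (f : EV m → ℝ≥0∞) (hf : Measurable f) {ε : ℝ} (hε : 0 < ε) :
    ∫⁻ z, f (ε⁻¹ • z) = ENNReal.ofReal (ε^m) * ∫⁻ z, f z := by
  rw [← lintegral_map hf (measurable_const_smul ε⁻¹),
    Measure.map_addHaar_smul volume (by positivity : ε⁻¹ ≠ 0), lintegral_smul_measure]
  simp [abs_of_pos hε]

lemma radial_int {α N : ℝ} (h2 : α < 2) (hN : 3 - α < N) :
    Integrable (fun w : EV n => ‖w‖ ^ ((2:ℝ) - α - n) * (1 + ‖w‖) ^ (-N)) volume := by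
  rcases n with _ | n
  · have : IsFiniteMeasure (volume : Measure (EV 0)) := 
      ⟨by
        have : (Set.univ : Set (EV 0)) = {0} := by
          ext x; simp [Subsingleton.elim x 0]
        rw [this]; exact isCompact_singleton.measure_lt_top⟩
    have : (fun w : EV 0 => ‖w‖ ^ ((2:ℝ) - α - (0:ℕ)) * (1 + ‖w‖) ^ (-N))
        = fun _ => (0:ℝ) ^ ((2:ℝ) - α - (0:ℕ)) * (1 + 0) ^ (-N) := by
      ext w; rw [Subsingleton.elim w 0]; simp
    rw [this]; exact integrable_const _
  · rw [integrable_fun_norm_addHaar volume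
      (f := fun y : ℝ => y ^ ((2:ℝ) - α - (n+1:ℕ)) * (1 + y) ^ (-N))]
    have e : Set.EqOn (fun y : ℝ => y ^ (Module.finrank ℝ (EV (n+1)) - 1) •
        (y ^ ((2:ℝ) - α - (n+1:ℕ)) * (1 + y) ^ (-N)))
        (fun y => y ^ (1 - α) * (1 + y) ^ (-N)) (Set.Ioi 0) := by
      intro y hy
      have hy : 0 < y := hy
      simp only [finrank_euclideanSpace, Fintype.card_fin, Nat.add_sub_cancel, smul_eq_mul]
      rw [← mul_assoc, ← Real.rpow_natCast y n, ← Real.rpow_add hy]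
      congr 2
      push_cast; ring
    rw [integrableOn_congr_fun e measurableSet_Ioi]
    have hm : Measurable fun y : ℝ => y ^ (1 - α) * (1 + y) ^ (-N) := by fun_prop
    rw [← Set.Ioo_union_Ici_eq_Ioi (zero_lt_one' ℝ)]
    refine IntegrableOn.union ?_ ?_
    · refine Integrable.mono' ((intervalIntegral.integrableOn_Ioo_rpow_iff zero_lt_one).2
        (by linarith : -1 < 1 - α)) hm.aestronglyMeasurable ?_
      filter_upwards [ae_restrict_mem measurableSet_Ioo] with y hy
      have hy0 := hy.1
      rw [Real.norm_of_nonneg (by positivity)]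
      refine mul_le_of_le_one_right (by positivity) ?_
      exact Real.rpow_le_one_of_one_le_of_nonpos (by linarith) (by linarith)
    · rw [integrableOn_Ici_iff_integrableOn_Ioi]
      refine Integrable.mono' (integrableOn_Ioi_rpow_of_lt
        (by linarith : 1 - α - N < -1) zero_lt_one) hm.aestronglyMeasurable ?_
      filter_upwards [ae_restrict_mem measurableSet_Ioi] with y hy
      have hy1 : 1 < y := hy
      have hy0 : 0 < y := by linarith
      rw [Real.norm_of_nonneg (by positivity), sub_eq_add_neg (1-α), Real.rpow_add hy0]
      refine mul_le_mul_of_nonneg_left ?_ (by positivity)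
      exact Real.rpow_le_rpow_of_nonpos hy0 (by linarith) (by linarith)

lemma thin {ρ : EV (n+1) → ℝ} (h1 : KF ρ) (h2 : A2 ρ) :
    ∃ K : ℝ, 0 ≤ K ∧ ∀ (b : EV n → ℝ), Measurable b → ∀ s : ℝ, 0 ≤ s →
      ∫⁻ w in {w : EV (n+1) | |w (Fin.last n) - b (firstCoords w)| ≤ s * ‖firstCoords w‖^2},
        ENNReal.ofReal (ρ w / ‖w‖) ≤ ENNReal.ofReal (s * K) := by
  obtain ⟨_, ⟨c₀, c₁, α, N, hc0, hc1, hα0, hα2, hN, hb⟩, _⟩ := h2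
  have hIntg := radial_int (n := n) hα2 hN
  set k : EV n → ℝ := fun w => ‖w‖ ^ ((2:ℝ) - α - n) * (1 + ‖w‖) ^ (-N) with hk
  have hk0 : ∀ w, 0 ≤ k w := fun w => by simp only [hk]; positivity
  refine ⟨2 * c₀ * ∫ w, k w, mul_nonneg (by positivity) (integral_nonneg hk0), ?_⟩
  intro b hbm s hs
  set A := {w : EV (n+1) | |w (Fin.last n) - b (firstCoords w)| ≤ s * ‖firstCoords w‖^2} with hA
  have mA : MeasurableSet A := by
    have := fc_cont (n := n)
    have h3 : Measurable fun w : EV (n+1) => b (firstCoords w) := hbm.comp this.measurable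
    exact measurableSet_le (by fun_prop) (by fun_prop)
  have mf : Measurable (A.indicator fun w => ENNReal.ofReal (ρ w / ‖w‖)) :=
    ((h1.mr.div (by fun_prop)).ennreal_ofReal).indicator mA
  have mf2 : Measurable (fun q : EV n × ℝ =>
      A.indicator (fun w => ENNReal.ofReal (ρ w / ‖w‖)) (snocE q.1 q.2)) :=
    mf.comp snocE_mp.measurable
  rw [← lintegral_indicator mA, ← snocE_mp.lintegral_comp mf, lintegral_prod _ mf2.aemeasurable]
  have key : ∀ w : EV n, ∫⁻ t : ℝ, A.indicator (fun w => ENNReal.ofReal (ρ w / ‖w‖)) (snocE w t)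
      ≤ ENNReal.ofReal (s * (2 * c₀)) * ENNReal.ofReal (k w) := by
    intro w
    by_cases hw : w = 0
    · have : ∫⁻ t : ℝ, A.indicator (fun w => ENNReal.ofReal (ρ w / ‖w‖)) (snocE w t) = 0 := by
        refine (lintegral_congr_ae (g := fun _ => 0) ?_).trans lintegral_zero
        have h4 : ∀ᵐ t : ℝ, t ≠ b w := by
          simp [ae_iff]
        filter_upwards [h4] with t ht
        apply Set.indicator_of_notMem
        simp only [hA, Set.mem_ofPred_eq, fc_snocE, snocE_last, hw]
        simp only [hw] at ht
        simpa [sub_eq_zero] using ht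
      rw [this]; exact zero_le
    have hw0 : 0 < ‖w‖ := norm_pos_iff.2 hw
    set M := c₀ * (‖w‖ ^ (-α - n) * (1 + ‖w‖) ^ (-N)) with hM
    have hM0 : 0 ≤ M := by positivity
    have h5 : ∀ t : ℝ, A.indicator (fun w => ENNReal.ofReal (ρ w / ‖w‖)) (snocE w t)
        ≤ (Metric.closedBall (b w) (s * ‖w‖^2)).indicator (fun _ => ENNReal.ofReal M) t := by
      intro t
      by_cases ht : snocE w t ∈ A
      · have ht' : t ∈ Metric.closedBall (b w) (s * ‖w‖^2) := by
          rw [Metric.mem_closedBall, Real.dist_eq]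
          simpa only [hA, Set.mem_ofPred_eq, fc_snocE, snocE_last] using ht
        rw [Set.indicator_of_mem ht, Set.indicator_of_mem ht']
        apply ENNReal.ofReal_le_ofReal
        set y := snocE w t with hy
        have hwy : ‖w‖ ≤ ‖y‖ := by
          have := fc_norm_le y
          rwa [hy, fc_snocE] at this
        have hy0 : 0 < ‖y‖ := hw0.trans_le hwy
        have h6 := (hb y (norm_pos_iff.1 hy0)).1
        rw [abs_of_nonneg (h1.nn y)] at h6
        calc ρ y / ‖y‖ ≤ c₀ * ‖y‖ ^ ((2:ℝ) - α - (n+1)) * (1 + ‖y‖) ^ (-N) / ‖y‖ := by gcongr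
          _ = c₀ * (‖y‖ ^ (-α - n) * (1 + ‖y‖) ^ (-N)) := by
              have : ‖y‖ ^ ((2:ℝ) - α - (n+1)) = ‖y‖ ^ (-α - n) * ‖y‖ := by
                rw [← Real.rpow_add_one hy0.ne']; congr 1; ring
              rw [this]; field_simp
          _ ≤ M := by
              rw [hM]
              have hn0 : (0:ℝ) ≤ n := Nat.cast_nonneg n
              exact mul_le_mul_of_nonneg_left (mul_le_mul
                (Real.rpow_le_rpow_of_nonpos hw0 hwy (by linarith))
                (Real.rpow_le_rpow_of_nonpos (by positivity) (by linarith) (by linarith))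
                (by positivity) (by positivity)) hc0.le
      · rw [Set.indicator_of_notMem ht]; exact zero_le
    refine (lintegral_mono h5).trans ?_
    rw [lintegral_indicator_const measurableSet_closedBall, Real.volume_closedBall,
      ← ENNReal.ofReal_mul hM0, ← ENNReal.ofReal_mul (by positivity)]
    apply ENNReal.ofReal_le_ofReal
    apply le_of_eq
    have : ‖w‖ ^ ((2:ℝ) - α - n) = ‖w‖ ^ (-α - n) * ‖w‖^2 := by
      rw [← Real.rpow_natCast ‖w‖ 2, ← Real.rpow_add hw0]; congr 1; push_cast; ring
    simp only [hk, hM, this]; ring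
  refine (lintegral_mono key).trans ?_
  rw [lintegral_const_mul' _ _ ENNReal.ofReal_ne_top,
    ← ofReal_integral_eq_lintegral_ofReal hIntg (Eventually.of_forall hk0),
    ← ENNReal.ofReal_mul (by positivity)]
  apply ENNReal.ofReal_le_ofReal; apply le_of_eq; ring

/-- thin-set bound for a kernel -/
def Thin (r : EV (n+1) → ℝ) (K : ℝ) : Prop := 
  ∀ (b : EV n → ℝ), Measurable b → ∀ s : ℝ, 0 ≤ s →
      ∫⁻ w in {w : EV (n+1) | |w (Fin.last n) - b (firstCoords w)| ≤ s * ‖firstCoords w‖^2},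
        ENNReal.ofReal (kernelJ r w * ‖w‖) ≤ ENNReal.ofReal (s * K)

lemma thin_scaled {ρ : EV (n+1) → ℝ} (h1 : KF ρ) (h2 : A2 ρ) :
    ∃ K : ℝ, 0 ≤ K ∧ ∀ ε : ℝ, 0 < ε → Thin (scaled ρ ε) K := by
  obtain ⟨K, hK, h⟩ := thin h1 h2
  refine ⟨K, hK, fun ε hε b hb s hs => ?_⟩
  have hb' : Measurable (fun w : EV n => ε⁻¹ * b (ε • w)) := 
    (hb.comp (measurable_const_smul ε)).const_mul _
  have h3 := h _ hb' (s * ε) (by positivity)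
  set A := {w : EV (n+1) | |w (Fin.last n) - b (firstCoords w)| ≤ s * ‖firstCoords w‖^2} with hA
  set A' := {w : EV (n+1) | |w (Fin.last n) - ε⁻¹ * b (ε • firstCoords w)|
    ≤ s * ε * ‖firstCoords w‖^2} with hA'
  have hfc := (fc_cont (n := n)).measurable
  have mA : MeasurableSet A := by
    have h3 : Measurable fun w : EV (n+1) => b (firstCoords w) := hb.comp hfc
    exact measurableSet_le (by fun_prop) (by fun_prop)
  have mA' : MeasurableSet A' := by
    have h3 : Measurable fun w : EV (n+1) => ε⁻¹ * b (ε • firstCoords w) := hb'.comp hfc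
    exact measurableSet_le (by fun_prop) (by fun_prop)
  rw [← lintegral_indicator mA'] at h3
  rw [← lintegral_indicator mA]
  set f := A'.indicator fun w => ENNReal.ofReal (ρ w / ‖w‖) with hf
  have mf : Measurable f := ((h1.mr.div (by fun_prop)).ennreal_ofReal).indicator mA'
  have e : ∀ z, A.indicator (fun w => ENNReal.ofReal (kernelJ (scaled ρ ε) w * ‖w‖)) z
      = ENNReal.ofReal ((ε^(n+1) * ε)⁻¹) * f (ε⁻¹ • z) := by
    intro z
    have hmem : ε⁻¹ • z ∈ A' ↔ z ∈ A := by
      simp only [hA, hA', Set.mem_ofPred_eq, fc_smul, norm_smul, PiLp.smul_apply, smul_eq_mul,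
        norm_inv, Real.norm_of_nonneg hε.le, smul_smul]
      rw [mul_inv_cancel₀ hε.ne', one_smul, ← mul_sub, abs_mul, abs_of_pos (inv_pos.2 hε)]
      rw [inv_mul_le_iff₀ hε]
      apply iff_of_eq; congr 1; field_simp
    by_cases hz : z ∈ A
    · rw [hf, Set.indicator_of_mem hz, Set.indicator_of_mem (hmem.2 hz),
        ← ENNReal.ofReal_mul (by positivity)]
      congr 1
      by_cases hz0 : z = 0
      · subst hz0; simp
      have : ‖z‖ ≠ 0 := norm_ne_zero_iff.2 hz0
      simp only [kernelJ, scaled, norm_smul, norm_inv, Real.norm_of_nonneg hε.le]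
      field_simp
    · rw [hf, Set.indicator_of_notMem hz, Set.indicator_of_notMem (fun h => hz (hmem.1 h))]; simp
  simp_rw [e]
  rw [lintegral_const_mul' _ _ ENNReal.ofReal_ne_top, lint_scale f mf hε]
  calc _ ≤ ENNReal.ofReal ((ε^(n+1) * ε)⁻¹) * (ENNReal.ofReal (ε^(n+1)) *
        ENNReal.ofReal (s * ε * K)) := by gcongr
    _ = _ := by
      rw [← ENNReal.ofReal_mul (by positivity), ← ENNReal.ofReal_mul (by positivity)]
      congr 1; field_simp
end

section
variable {n : ℕ}

/-- (unnormalized) inner normal vector -/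
def Nv (γ : EV n → ℝ) (y : EV n) : Fin (n+1) → ℝ :=
  Fin.snoc (fun i : Fin n => - fderiv ℝ γ y (EuclideanSpace.single i 1)) 1

lemma Nv_last (γ : EV n → ℝ) (y : EV n) : Nv γ y (Fin.last n) = 1 := by simp [Nv]
lemma Nv_cast (γ : EV n → ℝ) (y : EV n) (i : Fin n) :
    Nv γ y i.castSucc = - fderiv ℝ γ y (EuclideanSpace.single i 1) := by simp [Nv]

lemma Nv_le {γ : EV n → ℝ} {y : EV n} (h : ‖fderiv ℝ γ y‖ ≤ 1) (j : Fin (n+1)) :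
    |Nv γ y j| ≤ 1 := by
  refine Fin.lastCases ?_ (fun i => ?_) j
  · simp [Nv_last]
  · rw [Nv_cast, abs_neg, ← Real.norm_eq_abs]
    refine ((fderiv ℝ γ y).le_opNorm _).trans ?_
    simpa using h

lemma lin_Nv (γ : EV n → ℝ) (y : EV n) (z : EV (n+1)) :
    lin (Nv γ y) z = z (Fin.last n) - fderiv ℝ γ y (firstCoords z) := by
  conv_rhs => rw [sum_single (firstCoords z), map_sum]
  simp only [lin, Fin.sum_univ_castSucc, Nv_last, Nv_cast, map_smul, fc_apply, smul_eq_mul]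
  simp; ring

lemma KF.Jn_int {m : ℕ} {r : EV m → ℝ} (h : KF r) {d : ℝ} (hd : 0 < d) :
    IntegrableOn (fun z => kernelJ r z * ‖z‖) {z | d ≤ ‖z‖} volume ∧
    d * (∫ z in {z | d ≤ ‖z‖}, kernelJ r z * ‖z‖) ≤ ∫ z, r z := by
  have hms : MeasurableSet {z : EV m | d ≤ ‖z‖} := measurableSet_le (by fun_prop) (by fun_prop)
  have hle : ∀ z ∈ {z : EV m | d ≤ ‖z‖}, kernelJ r z * ‖z‖ ≤ d⁻¹ * r z := by
    intro z hz
    have hz' : d ≤ ‖z‖ := hz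
    have hz0 : 0 < ‖z‖ := hd.trans_le hz'
    have := h.nn z
    calc kernelJ r z * ‖z‖ = ‖z‖⁻¹ * r z := by unfold kernelJ; field_simp
      _ ≤ _ := by gcongr
  have hi : IntegrableOn (fun z => kernelJ r z * ‖z‖) {z | d ≤ ‖z‖} volume := by
    refine Integrable.mono' (g := fun z => d⁻¹ * r z) (h.ii.const_mul _).restrict
      ((mJ h.mr).mul measurable_norm).aestronglyMeasurable ?_
    filter_upwards [ae_restrict_mem hms] with z hz
    rw [Real.norm_of_nonneg (mul_nonneg (h.Jnn z) (norm_nonneg z))]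
    exact hle z hz
  refine ⟨hi, ?_⟩
  have h1 : ∫ z in {z | d ≤ ‖z‖}, kernelJ r z * ‖z‖ ≤ ∫ z in {z | d ≤ ‖z‖}, d⁻¹ * r z :=
    setIntegral_mono_on hi (h.ii.const_mul _).integrableOn hms hle
  have h2 : ∫ z in {z | d ≤ ‖z‖}, d⁻¹ * r z ≤ ∫ z, d⁻¹ * r z :=
    setIntegral_le_integral (h.ii.const_mul _)
      (Eventually.of_forall fun z => mul_nonneg (by positivity) (h.nn z))
  rw [integral_const_mul (μ := volume)] at h2
  calc _ ≤ d * (d⁻¹ * ∫ z, r z) := by gcongr; exact h1.trans h2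
    _ = _ := by field_simp

/-- weight -/
def kk {m : ℕ} (r : EV m → ℝ) (d : ℝ) : ℝ := ∫ z in {z | d ≤ ‖z‖}, kernelJ r z * ‖z‖

lemma Jlin_abs {m : ℕ} {r : EV m → ℝ} (h : KF r) (a : Fin m → ℝ) {d : ℝ} (hd : 0 < d)
    (A : Set (EV m)) (hA : A ⊆ {z | d ≤ ‖z‖}) :
    |∫ z in A, kernelJ r z * lin a z| ≤ (∑ j, |a j|) * kk r d := by
  have h1 := (h.Jn_int hd).1
  calc |∫ z in A, kernelJ r z * lin a z| ≤ ∫ z in A, |kernelJ r z * lin a z| :=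
        abs_integral_le_integral_abs
    _ ≤ ∫ z in {z | d ≤ ‖z‖}, |kernelJ r z * lin a z| :=
        setIntegral_mono_set (h.Jlin_int a hd).abs
          (Eventually.of_forall fun z => abs_nonneg _) (LE.le.eventuallyLE hA)
    _ ≤ ∫ z in {z | d ≤ ‖z‖}, (∑ j, |a j|) * (kernelJ r z * ‖z‖) := by
        refine integral_mono (h.Jlin_int a hd).abs (h1.const_mul _) fun z => ?_
        simp only
        rw [abs_mul, abs_of_nonneg (h.Jnn z)]
        calc _ ≤ kernelJ r z * (‖z‖ * ∑ j, |a j|) := 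
              mul_le_mul_of_nonneg_left (lin_le a z) (h.Jnn z)
          _ = _ := by ring
    _ = _ := by rw [integral_const_mul]; rfl

lemma BB_bound {r : EV (n+1) → ℝ} (h : KF r) (ho : OddSl r) {K : ℝ} (hK : 0 ≤ K) (hT : Thin r K)
    {γ : EV n → ℝ} (hγ : Lip1 γ) {C : ℝ} (hC : 0 ≤ C) (hd1 : ∀ y, ‖fderiv ℝ γ y‖ ≤ 1)
    (hC2 : ∀ y v, |γ (y + v) - γ y - fderiv ℝ γ y v| ≤ C * ‖v‖^2)
    (x : EV (n+1)) {D : ℝ} (hDx : D = x (Fin.last n) - γ (firstCoords x)) (hD : 0 < D)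
    (a : Fin (n+1) → ℝ) :
    |BB (halfSpace γ) r (D/2) a x| ≤ (n+2) * (C * K) * (∑ j, |a j|)
      + (n+1) * kk r (D/2) * |a ⬝ᵥ Nv γ (firstCoords x)| := by
  set y := firstCoords x with hy
  set N := Nv γ y with hN
  set d := D/2 with hd
  have hd0 : 0 < d := by positivity
  set E := {z | x + z ∈ halfSpace γ} with hE
  have mE : MeasurableSet E := (hs_open hγ).measurableSet.preimage (measurable_const_add x)
  set Bd := {z : EV (n+1) | d ≤ ‖z‖} with hBd
  have mBd : MeasurableSet Bd := measurableSet_le (by fun_prop) (by fun_prop)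
  have hNle : ∀ j, |N j| ≤ 1 := Nv_le (hd1 y)
  have hNs : ∑ j, |N j| ≤ n + 1 := by
    refine (Finset.sum_le_sum fun j _ => hNle j).trans ?_; simp
  have hNN : 1 ≤ N ⬝ᵥ N := by
    unfold dotProduct
    rw [Fin.sum_univ_castSucc, hN, Nv_last]
    have := Finset.sum_nonneg (s := Finset.univ)
      (fun (i : Fin n) _ => mul_self_nonneg (Nv γ y i.castSucc))
    linarith
  set c := (a ⬝ᵥ N) / (N ⬝ᵥ N) with hc
  have hcle : |c| ≤ |a ⬝ᵥ N| := by
    rw [hc, abs_div, abs_of_pos (by linarith : 0 < N ⬝ᵥ N)]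
    exact div_le_self (abs_nonneg _) hNN
  set τ : Fin (n+1) → ℝ := a - c • N with hτ
  have hτN : τ ⬝ᵥ N = 0 := by
    rw [hτ, sub_dotProduct, smul_dotProduct, hc, smul_eq_mul]
    field_simp; ring
  have haN : |a ⬝ᵥ N| ≤ ∑ j, |a j| := by
    unfold dotProduct
    refine (Finset.abs_sum_le_sum_abs _ _).trans (Finset.sum_le_sum fun j _ => ?_)
    rw [abs_mul]; exact mul_le_of_le_one_right (abs_nonneg _) (hNle j)
  have hτs : ∑ j, |τ j| ≤ (n+2) * ∑ j, |a j| := by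
    calc ∑ j, |τ j| ≤ ∑ j, (|a j| + |c| * |N j|) := by
          refine Finset.sum_le_sum fun j _ => ?_
          rw [hτ, ← abs_mul]; exact abs_sub _ _
      _ = ∑ j, |a j| + |c| * ∑ j, |N j| := by rw [Finset.sum_add_distrib, Finset.mul_sum]
      _ ≤ ∑ j, |a j| + (∑ j, |a j|) * (n + 1) := by
          gcongr; exact hcle.trans haN
      _ = _ := by ring
  have hlin : ∀ z, lin a z = lin τ z + c * lin N z := by
    intro z; simp only [lin, hτ, Finset.mul_sum, ← Finset.sum_add_distrib]
    refine Finset.sum_congr rfl fun j _ => ?_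
    simp; ring
  have hlN : ∀ z, lin N z = z (Fin.last n) - fderiv ℝ γ y (firstCoords z) := lin_Nv γ y
  have hlNle : ∀ z, |lin N z| ≤ 2 * ‖z‖ := by
    intro z; rw [hlN]
    refine (abs_sub _ _).trans ?_
    have h1 := coord_le z (Fin.last n)
    have h2 := (fderiv ℝ γ y).le_opNorm (firstCoords z)
    rw [Real.norm_eq_abs] at h2
    have h3 := fc_norm_le z
    nlinarith [hd1 y, norm_nonneg (firstCoords z)]
  have iτ := h.Jlin_int τ hd0
  have iN := h.Jlin_int N hd0
  -- splitting
  have s1 : BB (halfSpace γ) r d a x = (∫ z in E ∩ Bd, kernelJ r z * lin τ z)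
      + c * ∫ z in E ∩ Bd, kernelJ r z * lin N z := by
    rw [← integral_const_mul, ← integral_add]
    · unfold BB
      congr 1; ext z; rw [hlin]; ring
    · exact iτ.mono_set Set.inter_subset_right
    · exact (iN.mono_set Set.inter_subset_right).const_mul c
  have b1 : |∫ z in E ∩ Bd, kernelJ r z * lin N z| ≤ (n+1) * kk r d := by
    refine (Jlin_abs h N hd0 _ Set.inter_subset_right).trans ?_
    have : 0 ≤ kk r d := integral_nonneg fun z => mul_nonneg (h.Jnn z) (norm_nonneg z)
    gcongr
  set Hs := {z : EV (n+1) | -D < lin N z} with hHs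
  have mHs : MeasurableSet Hs := measurableSet_lt measurable_const (lin_cont N).measurable
  -- half space
  have s2 : ∫ z in Hs ∩ Bd, kernelJ r z * lin τ z = 0 := by
    have hsp : Hs ∩ Bd = ({z | |lin N z| < D} ∩ Bd) ∪ {z | D ≤ lin N z} := by
      ext z
      constructor
      · rintro ⟨h1, h2⟩
        rcases lt_or_ge (lin N z) D with h3 | h3
        · exact Or.inl ⟨abs_lt.2 ⟨h1, h3⟩, h2⟩
        · exact Or.inr h3
      · rintro (⟨h1, h2⟩ | h1)
        · have h1' : |lin N z| < D := h1
          exact ⟨(abs_lt.1 h1').1, h2⟩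
        · have h1' : D ≤ lin N z := h1
          refine ⟨?_, ?_⟩
          · change -D < lin N z; linarith
          · change D/2 ≤ ‖z‖
            have := le_abs_self (lin N z)
            linarith [hlNle z]
    have mS : MeasurableSet ({z | |lin N z| < D} ∩ Bd) :=
      (measurableSet_lt (lin_cont N).abs.measurable measurable_const).inter mBd
    have mP : MeasurableSet {z | D ≤ lin N z} :=
      measurableSet_le measurable_const (lin_cont N).measurable
    rw [hsp, setIntegral_union _ mP]
    · rw [half_zero h ho N τ (Nv_last γ y) hτN hD, h.odd_set τ _ mS, add_zero]
      rintro z ⟨h1, h2⟩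
      refine ⟨?_, ?_⟩
      · change |lin N (-z)| < D
        rw [lin_neg, abs_neg]; exact h1
      · change d ≤ ‖-z‖
        rw [norm_neg]; exact h2
    · exact iτ.mono_set Set.inter_subset_right
    · refine iτ.mono_set fun z hz => ?_
      have : z ∈ Hs ∩ Bd := by rw [hsp]; exact Or.inr hz
      exact this.2
    · rw [Set.disjoint_left]
      rintro z ⟨h1, _⟩ h2
      have h1' : |lin N z| < D := h1
      have h2' : D ≤ lin N z := h2
      exact absurd (le_abs_self (lin N z)) (by linarith)
  -- thin part
  have b2 : |∫ z in E ∩ Bd, kernelJ r z * lin τ z| ≤ (∑ j, |τ j|) * (C * K) := by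
    have e1 : ∫ z in E ∩ Bd, kernelJ r z * lin τ z
        = ∫ z, ((E ∩ Bd).indicator (fun z => kernelJ r z * lin τ z) z
          - (Hs ∩ Bd).indicator (fun z => kernelJ r z * lin τ z) z) := by
      rw [integral_sub, integral_indicator (mE.inter mBd), integral_indicator (mHs.inter mBd), s2,
        sub_zero]
      · rw [integrable_indicator_iff (mE.inter mBd)]; exact iτ.mono_set Set.inter_subset_right
      · rw [integrable_indicator_iff (mHs.inter mBd)]; exact iτ.mono_set Set.inter_subset_right
    set St := {w : EV (n+1) | |w (Fin.last n) - (-D + fderiv ℝ γ y (firstCoords w))|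
      ≤ C * ‖firstCoords w‖^2} with hSt
    have mSt : MeasurableSet St := by
      have h3 : Continuous fun w : EV (n+1) => fderiv ℝ γ y (firstCoords w) :=
        (fderiv ℝ γ y).continuous.comp fc_cont
      have h4 : Continuous fun w : EV (n+1) => ‖firstCoords w‖ := fc_cont.norm
      have h5 : Continuous fun w : EV (n+1) => C * ‖firstCoords w‖^2 := continuous_const.mul (h4.pow 2)
      have h6 : Continuous fun w : EV (n+1) => |w (Fin.last n) - (-D + fderiv ℝ γ y (firstCoords w))| := by
        fun_prop
      exact measurableSet_le h6.measurable h5.measurable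
    have hT1 := hT (fun v => -D + fderiv ℝ γ y v) (by fun_prop) C hC
    have hEH : ∀ z, z ∉ St → (z ∈ E ↔ z ∈ Hs) := by
      intro z hz
      have h1 := hC2 y (firstCoords z)
      have h2 : C * ‖firstCoords z‖^2 < |z (Fin.last n) - (-D + fderiv ℝ γ y (firstCoords z))| := 
        not_le.1 hz
      have hEz : z ∈ E ↔ γ (y + firstCoords z) < x (Fin.last n) + z (Fin.last n) := by
        simp only [hE, halfSpace, Set.mem_ofPred_eq, fc_add, PiLp.add_apply, hy]
      have hHz : z ∈ Hs ↔ -D < z (Fin.last n) - fderiv ℝ γ y (firstCoords z) := by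
        simp only [hHs, Set.mem_ofPred_eq, hlN]
      rw [hEz, hHz]
      rw [abs_le] at h1
      constructor
      · intro h3
        by_contra h4
        rw [abs_of_nonpos (by linarith)] at h2
        linarith
      · intro h3
        by_contra h4
        rw [abs_of_nonneg (by linarith)] at h2
        linarith
    have b3 : ‖∫ z in E ∩ Bd, kernelJ r z * lin τ z‖ₑ ≤ ENNReal.ofReal ((∑ j, |τ j|) * (C * K)) := by
      have hsum : 0 ≤ ∑ j, |τ j| := Finset.sum_nonneg fun _ _ => abs_nonneg _
      rw [e1]
      refine (enorm_integral_le_lintegral_enorm _).trans ?_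
      rw [ENNReal.ofReal_mul hsum]
      refine le_trans ?_ (mul_le_mul_right hT1 _)
      rw [← lintegral_indicator mSt, ← lintegral_const_mul' _ _ ENNReal.ofReal_ne_top]
      refine lintegral_mono fun z => ?_
      by_cases hz : z ∈ St
      · rw [Set.indicator_of_mem hz, ← ENNReal.ofReal_mul hsum, Real.enorm_eq_ofReal_abs]
        apply ENNReal.ofReal_le_ofReal
        have hg : |kernelJ r z * lin τ z| ≤ (∑ j, |τ j|) * (kernelJ r z * ‖z‖) := by
          rw [abs_mul, abs_of_nonneg (h.Jnn z)]
          calc _ ≤ kernelJ r z * (‖z‖ * ∑ j, |τ j|) := 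
                mul_le_mul_of_nonneg_left (lin_le τ z) (h.Jnn z)
            _ = _ := by ring
        have hg0 := (abs_nonneg _).trans hg
        by_cases p1 : z ∈ E ∩ Bd <;> by_cases p2 : z ∈ Hs ∩ Bd <;> 
          simp only [p1, p2, Set.indicator_of_mem, Set.indicator_of_notMem, not_false_eq_true, 
            sub_zero, zero_sub, sub_self, abs_zero, abs_neg, hg, hg0]
      · have : (E ∩ Bd).indicator (fun z => kernelJ r z * lin τ z) z
          = (Hs ∩ Bd).indicator (fun z => kernelJ r z * lin τ z) z := by
          simp only [Set.indicator, Set.mem_inter_iff, hEH z hz]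
        rw [this, sub_self]; simp
    rw [Real.enorm_eq_ofReal_abs, ENNReal.ofReal_le_ofReal_iff (by positivity)] at b3
    exact b3
  rw [s1]
  calc _ ≤ |∫ z in E ∩ Bd, kernelJ r z * lin τ z|
        + |c| * |∫ z in E ∩ Bd, kernelJ r z * lin N z| := by
        rw [← abs_mul]; exact abs_add_le _ _
    _ ≤ ((n+2) * ∑ j, |a j|) * (C * K) + |a ⬝ᵥ N| * ((n+1) * kk r d) := by
        refine add_le_add (b2.trans ?_) (mul_le_mul hcle b1 (abs_nonneg _) (abs_nonneg _))
        gcongr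
    _ = _ := by ring
end

section
open Convolution ContinuousLinearMap

lemma moll_zero {m : ℕ} (g : EV m → ℝ) (K : Set (EV m)) (hK : ∀ x, x ∉ K → g x = 0)
    (b : ContDiffBump (0 : EV m)) {δ : ℝ} (hb : b.rOut ≤ δ) (x : EV m)
    (hx : x ∉ Metric.cthickening δ K) :
    (b.normed volume ⋆[lsmul ℝ ℝ, volume] g) x = 0 := by
  have hx0 : g x = 0 := hK x fun h => hx (Metric.self_subset_cthickening K h)
  rw [b.normed_convolution_eq_right, hx0]
  intro y hy
  rw [hx0]
  apply hK
  intro h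
  exact hx (Metric.mem_cthickening_of_dist_le x y δ K h (by
    rw [dist_comm]; exact (Metric.mem_ball.1 hy).le.trans hb))

lemma moll_lim {m : ℕ} (F g : EV m → ℝ) (hF : LocallyIntegrable F volume) (hg : Continuous g)
    (K : Set (EV m)) (hKc : IsCompact K)
    (hK : ∀ x, x ∉ K → g x = 0) (b : ℕ → ContDiffBump (0 : EV m)) {δ : ℝ}
    (hb : ∀ k, (b k).rOut ≤ δ) (hb0 : Tendsto (fun k => (b k).rOut) atTop (𝓝 0)) :
    Tendsto (fun k => ∫ x, F x * ((b k).normed volume ⋆[lsmul ℝ ℝ, volume] g) x) atTop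
      (𝓝 (∫ x, F x * g x)) := by
  have hcs : HasCompactSupport g := HasCompactSupport.intro hKc hK
  obtain ⟨C, hC⟩ := cc_bdd g hg hcs
  have hK' : IsCompact (Metric.cthickening δ K) := hKc.cthickening
  have hC0 : 0 ≤ C := (abs_nonneg _).trans (hC 0)
  refine tendsto_integral_of_dominated_convergence
    (fun x => (Metric.cthickening δ K).indicator (fun x => ‖F x‖ * (3 * C)) x) ?_ ?_ ?_ ?_
  · intro k
    refine hF.aestronglyMeasurable.mul ?_
    have : Continuous ((b k).normed volume ⋆[lsmul ℝ ℝ, volume] g) :=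
      (hcs.continuous_convolution_right (lsmul ℝ ℝ)
        ((b k).continuous_normed.locallyIntegrable) hg)
    exact this.aestronglyMeasurable
  · rw [integrable_indicator_iff hK'.measurableSet]
    exact ((hF.integrableOn_isCompact hK').norm).mul_const _
  · intro k
    refine Eventually.of_forall fun x => ?_
    by_cases hx : x ∈ Metric.cthickening δ K
    · rw [Set.indicator_of_mem hx, norm_mul]
      gcongr
      have h1 := (b k).dist_normed_convolution_le (μ := volume) (g := g) (x₀ := x) (ε := 2 * C)
        hg.aestronglyMeasurable (by
          intro y _
          rw [Real.dist_eq]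
          have := abs_sub (g y) (g x)
          linarith [hC y, hC x])
      rw [Real.dist_eq] at h1
      rw [Real.norm_eq_abs]
      have h2 := abs_sub_abs_le_abs_sub (((b k).normed volume ⋆[lsmul ℝ ℝ, volume] g) x) (g x)
      linarith [hC x]
    · rw [Set.indicator_of_notMem hx, moll_zero g K hK (b k) (hb k) x hx]; simp
  · refine Eventually.of_forall fun x => ?_
    exact (ContDiffBump.convolution_tendsto_right_of_continuous hb0 hg x).const_mul _

/-- weak derivative tested with `C^1` functions -/
lemma WD_C1 {m : ℕ} {Ω : Set (EV m)} (hΩ : IsOpen Ω) {v : EV m} {F H : EV m → ℝ}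
    (hF : LocallyIntegrable F volume) (hH : LocallyIntegrable H volume) (h : WD Ω v F H)
    (φ : EV m → ℝ) (hφ : ContDiff ℝ 1 φ) (hcs : HasCompactSupport φ) (hs : tsupport φ ⊆ Ω) :
    ∫ x, F x * fderiv ℝ φ x v = - ∫ x, H x * φ x := by
  obtain ⟨δ, hδ, hδs⟩ := hcs.exists_cthickening_subset_open hΩ hs
  let b : ℕ → ContDiffBump (0 : EV m) := fun k =>
    ⟨δ / (k+2) / 2, δ / (k+2), by positivity, by
      have : 0 < δ / ((k:ℝ)+2) := by positivity
      linarith⟩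
  have hb : ∀ k, (b k).rOut ≤ δ := by
    intro k
    change δ / ((k:ℝ)+2) ≤ δ
    apply div_le_self hδ.le
    have : (0:ℝ) ≤ k := Nat.cast_nonneg k
    linarith
  have hb0 : Tendsto (fun k => (b k).rOut) atTop (𝓝 0) := by
    change Tendsto (fun k : ℕ => δ / ((k:ℝ)+2)) atTop (𝓝 0)
    exact tendsto_const_nhds.div_atTop
      (tendsto_atTop_add_const_right _ _ tendsto_natCast_atTop_atTop)
  have hz : ∀ x, x ∉ tsupport φ → φ x = 0 := fun x hx => image_eq_zero_of_notMem_tsupport hx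
  have hdz : ∀ x, x ∉ tsupport φ → fderiv ℝ φ x v = 0 := fun x hx => by
    rw [image_eq_zero_of_notMem_tsupport (f := fderiv ℝ φ)
      (fun h => hx (tsupport_fderiv_subset ℝ h))]; simp
  have hdc : Continuous (fun x => fderiv ℝ φ x v) :=
    (hφ.continuous_fderiv (by simp)).clm_apply continuous_const
  have l1 := moll_lim H φ hH hφ.continuous _ hcs hz b hb hb0
  have l2 := moll_lim F _ hF hdc _ hcs hdz b hb hb0
  have key : ∀ k, ∫ x, F x * ((b k).normed volume ⋆[lsmul ℝ ℝ, volume]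
      (fun x => fderiv ℝ φ x v)) x
      = - ∫ x, H x * ((b k).normed volume ⋆[lsmul ℝ ℝ, volume] φ) x := by
    intro k
    have hli : LocallyIntegrable ((b k).normed volume) volume :=
      (b k).continuous_normed.locallyIntegrable
    have hz' := moll_zero φ _ hz (b k) (hb k)
    have hcs' : HasCompactSupport ((b k).normed volume ⋆[lsmul ℝ ℝ, volume] φ) :=
      HasCompactSupport.intro hcs.cthickening hz'
    rw [← h _ ((b k).hasCompactSupport_normed.contDiff_convolution_left (lsmul ℝ ℝ)
      (b k).contDiff_normed hφ.continuous.locallyIntegrable) hcs' ?_]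
    · congr 1; ext x
      rw [(hcs.hasFDerivAt_convolution_right (lsmul ℝ ℝ) hli hφ x).fderiv,
        convolution_precompR_apply (lsmul ℝ ℝ) hli (hcs.fderiv ℝ)
          (hφ.continuous_fderiv one_ne_zero)]
    · refine subset_trans (closure_minimal ?_ Metric.isClosed_cthickening) hδs
      intro x hx
      by_contra hc
      exact hx (hz' x hc)
  simp only [key] at l2
  exact tendsto_nhds_unique l2 l1.neg

end

section
variable {n : ℕ} {γ : EV n → ℝ}

/-- height above the graph -/
def Dh (γ : EV n → ℝ) (x : EV (n+1)) : ℝ := x (Fin.last n) - γ (firstCoords x)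

lemma Dh_cont (h : Lip1 γ) : Continuous (Dh γ) := by
  have := h.cont.comp (fc_cont (n := n))
  have h2 : Continuous fun x : EV (n+1) => γ (firstCoords x) := this
  exact (by fun_prop : Continuous fun x : EV (n+1) => x (Fin.last n)).sub h2

lemma mem_hs (x : EV (n+1)) : x ∈ halfSpace γ ↔ 0 < Dh γ x := by
  simp [halfSpace, Dh]

/-- cutoff -/
def chi (γ : EV n → ℝ) (k : ℕ) (x : EV (n+1)) : ℝ := Real.smoothTransition ((k+1) * Dh γ x - 1)

lemma chi_nonneg (k : ℕ) (x : EV (n+1)) : 0 ≤ chi γ k x := Real.smoothTransition.nonneg _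
lemma chi_le (k : ℕ) (x : EV (n+1)) : chi γ k x ≤ 1 := Real.smoothTransition.le_one _

lemma chi_lim (h : Lip1 γ) (F η : EV (n+1) → ℝ) (hF : LocallyIntegrable F volume)
    (hFz : ∀ x, x ∉ halfSpace γ → F x = 0) (hη : Continuous η) (hcs : HasCompactSupport η) :
    Tendsto (fun k => ∫ x, F x * (chi γ k x * η x)) atTop (𝓝 (∫ x, F x * η x)) := by
  have hi := cc_int F hF η hη hcs
  refine tendsto_integral_of_dominated_convergence (fun x => ‖F x * η x‖) ?_ hi.norm ?_ ?_
  · intro k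
    refine hF.aestronglyMeasurable.mul ?_
    have : Continuous (chi γ k) :=
      Real.smoothTransition.continuous.comp (((Dh_cont h).const_mul _).sub continuous_const)
    exact (this.mul hη).aestronglyMeasurable
  · intro k
    refine Eventually.of_forall fun x => ?_
    rw [norm_mul, norm_mul, norm_mul, Real.norm_of_nonneg (chi_nonneg k x)]
    gcongr
    exact mul_le_of_le_one_left (norm_nonneg _) (chi_le k x)
  · refine Eventually.of_forall fun x => ?_
    by_cases hx : x ∈ halfSpace γ
    · rw [mem_hs] at hx
      obtain ⟨N, hN⟩ := exists_nat_gt (2 / Dh γ x)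
      apply tendsto_const_nhds.congr'
      filter_upwards [eventually_ge_atTop N] with k hk
      have : chi γ k x = 1 := by
        apply Real.smoothTransition.one_of_one_le
        rw [div_lt_iff₀ hx] at hN
        have h2 : (N:ℝ) ≤ k := by exact_mod_cast hk
        nlinarith
      rw [this, one_mul]
    · simp [hFz x hx]

lemma tang (h : Lip1 γ) (hγ : ContDiff ℝ 2 γ) (i : Fin n) (f fi fn : EV (n+1) → ℝ)
    (lf : LocallyIntegrable f volume) (lfi : LocallyIntegrable fi volume)
    (lfn : LocallyIntegrable fn volume)
    (zf : ∀ x, x ∉ halfSpace γ → f x = 0) (zfi : ∀ x, x ∉ halfSpace γ → fi x = 0)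
    (zfn : ∀ x, x ∉ halfSpace γ → fn x = 0)
    (wi : WD (halfSpace γ) (EuclideanSpace.single i.castSucc 1) f fi)
    (wn : WD (halfSpace γ) (eN n) f fn)
    (φ : EV (n+1) → ℝ) (hφ : ContDiff ℝ (⊤ : ℕ∞) φ) (hcs : HasCompactSupport φ) :
    (∫ x, f x * fderiv ℝ φ x (EuclideanSpace.single i.castSucc 1))
      + (∫ x, f x * (fderiv ℝ γ (firstCoords x) (EuclideanSpace.single i 1) * fderiv ℝ φ x (eN n)))
    = - (∫ x, fi x * φ x)
      - ∫ x, fn x * (fderiv ℝ γ (firstCoords x) (EuclideanSpace.single i 1) * φ x) := by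
  set ei : EV (n+1) := EuclideanSpace.single i.castSucc 1 with hei
  set g : EV (n+1) → ℝ := fun x => fderiv ℝ γ (firstCoords x) (EuclideanSpace.single i 1) with hg
  have hfcei : firstCoords ei = EuclideanSpace.single i 1 := by
    ext j; simp [fc_apply, hei]
  have heil : ei (Fin.last n) = 0 := by
    simp [hei, Fin.ext_iff, i.2.ne']
  have hφ1 : ContDiff ℝ 1 φ := hφ.of_le (by exact_mod_cast le_top)
  have hg0 : ContDiff ℝ 1 (fun y => fderiv ℝ γ y (EuclideanSpace.single i 1)) :=
    (hγ.fderiv_right (m := 1) (by norm_num)).clm_apply contDiff_const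
  have hfcd : ContDiff ℝ 1 (firstCoords (n := n)) := (fcL n).contDiff
  have hg1 : ContDiff ℝ 1 g := hg0.comp hfcd
  have hgN : ∀ x, fderiv ℝ g x (eN n) = 0 := by
    intro x
    have h1 : HasFDerivAt g ((fderiv ℝ (fun y => fderiv ℝ γ y (EuclideanSpace.single i 1))
        (firstCoords x)).comp (fcL n)) x :=
      HasFDerivAt.comp x ((hg0.differentiable one_ne_zero _).hasFDerivAt) (fcL n).hasFDerivAt
    rw [h1.fderiv]
    simp only [ContinuousLinearMap.comp_apply, fcL_apply, fc_eN, map_zero]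
  have hγ1 : ContDiff ℝ 1 γ := hγ.of_le (by norm_num)
  have hD1 : ContDiff ℝ 1 (Dh γ) := by
    have : ContDiff ℝ 1 (fun x : EV (n+1) => γ (firstCoords x)) := hγ1.comp hfcd
    unfold Dh
    exact ContDiff.sub (by fun_prop) this
  have hDd : ∀ x v, fderiv ℝ (Dh γ) x v = v (Fin.last n) - fderiv ℝ γ (firstCoords x) (firstCoords v) := by
    intro x v
    have h1 : HasFDerivAt (fun x : EV (n+1) => γ (firstCoords x))
        ((fderiv ℝ γ (firstCoords x)).comp (fcL n)) x :=
      HasFDerivAt.comp x ((hγ1.differentiable one_ne_zero _).hasFDerivAt) (fcL n).hasFDerivAt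
    have h2 : HasFDerivAt (fun x : EV (n+1) => x (Fin.last n))
        (EuclideanSpace.proj (Fin.last n) : EV (n+1) →L[ℝ] ℝ) x :=
      (EuclideanSpace.proj (Fin.last n) : EV (n+1) →L[ℝ] ℝ).hasFDerivAt
    have h3 : HasFDerivAt (Dh γ) _ x := h2.sub h1
    rw [h3.fderiv]
    rfl
  have hei' : ∀ x, fderiv ℝ (Dh γ) x ei = - g x := by
    intro x; rw [hDd, hfcei, heil, zero_sub]
  have heN' : ∀ x, fderiv ℝ (Dh γ) x (eN n) = 1 := by
    intro x; rw [hDd, fc_eN, eN_last]; simp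
  have hdc : ∀ v, Continuous (fun x => fderiv ℝ φ x v) := fun v =>
    (hφ1.continuous_fderiv one_ne_zero).clm_apply continuous_const
  have hdcs : ∀ v, HasCompactSupport (fun x => fderiv ℝ φ x v) := fun v =>
    hcs.fderiv_apply ℝ v
  have step : ∀ k, (∫ x, f x * (chi γ k x * fderiv ℝ φ x ei))
      + (∫ x, f x * (chi γ k x * (g x * fderiv ℝ φ x (eN n))))
      = - (∫ x, fi x * (chi γ k x * φ x)) - ∫ x, fn x * (chi γ k x * (g x * φ x)) := by
    intro k
    have hc1 : ContDiff ℝ 1 (chi γ k) :=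
      (Real.smoothTransition.contDiff (n := 1)).comp ((contDiff_const.mul hD1).sub contDiff_const)
    have hcd : ∀ x v, fderiv ℝ (chi γ k) x v
        = deriv Real.smoothTransition ((k+1) * Dh γ x - 1) * ((k+1) * fderiv ℝ (Dh γ) x v) := by
      intro x v
      have h1 : HasFDerivAt (fun x => ((k:ℝ)+1) * Dh γ x - 1) (((k:ℝ)+1) • fderiv ℝ (Dh γ) x) x :=
        ((hD1.differentiable one_ne_zero x).hasFDerivAt.const_mul _).sub_const _
      have h2 : HasFDerivAt (chi γ k) _ x :=
        HasDerivAt.comp_hasFDerivAt x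
          (((Real.smoothTransition.contDiff (n := 1)).differentiable one_ne_zero _).hasDerivAt) h1
      rw [h2.fderiv]; simp
    have hsup : Function.support (chi γ k) ⊆ {x | 1 / ((k:ℝ)+1) ≤ Dh γ x} := by
      intro x hx
      by_contra hc
      have hc' : Dh γ x < 1 / ((k:ℝ)+1) := not_le.1 hc
      apply hx
      apply Real.smoothTransition.zero_of_nonpos
      rw [lt_div_iff₀ (by positivity)] at hc'
      linarith
    have hts : tsupport (chi γ k) ⊆ halfSpace γ := by
      refine (closure_minimal hsup (isClosed_le continuous_const (Dh_cont h))).trans ?_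
      intro x hx
      have hx' : 1 / ((k:ℝ)+1) ≤ Dh γ x := hx
      rw [mem_hs]
      exact lt_of_lt_of_le (by positivity) hx'
    have hψ1 : ContDiff ℝ 1 (fun x => chi γ k x * φ x) := hc1.mul hφ1
    have hψ2 : ContDiff ℝ 1 (fun x => g x * (chi γ k x * φ x)) := hg1.mul hψ1
    have hs1 : tsupport (fun x => chi γ k x * φ x) ⊆ halfSpace γ :=
      (tsupport_mul_subset_left (f := chi γ k) (g := φ)).trans hts
    have hcs1 : HasCompactSupport (fun x => chi γ k x * φ x) := hcs.mul_left
    have hs2 : tsupport (fun x => g x * (chi γ k x * φ x)) ⊆ halfSpace γ :=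
      (tsupport_mul_subset_right (f := g) (g := fun x => chi γ k x * φ x)).trans hs1
    have hcs2 : HasCompactSupport (fun x => g x * (chi γ k x * φ x)) := hcs1.mul_left
    have d1 : ∀ x v, fderiv ℝ (fun x => chi γ k x * φ x) x v
        = chi γ k x * fderiv ℝ φ x v + φ x * fderiv ℝ (chi γ k) x v := by
      intro x v
      rw [fderiv_fun_mul (hc1.differentiable one_ne_zero x) (hφ1.differentiable one_ne_zero x)]
      simp
    have d2 : ∀ x, fderiv ℝ (fun x => g x * (chi γ k x * φ x)) x (eN n)
        = g x * fderiv ℝ (fun x => chi γ k x * φ x) x (eN n) := by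
      intro x
      rw [fderiv_fun_mul (hg1.differentiable one_ne_zero x) (hψ1.differentiable one_ne_zero x)]
      simp [hgN]
    have e1 := WD_C1 (hs_open h) lf lfi wi _ hψ1 hcs1 hs1
    have e2 := WD_C1 (hs_open h) lf lfn wn _ hψ2 hcs2 hs2
    have hdi : ∀ (ψ : EV (n+1) → ℝ) (v), ContDiff ℝ 1 ψ → HasCompactSupport ψ →
        Integrable (fun x => f x * fderiv ℝ ψ x v) volume := fun ψ v a b =>
      cc_int f lf _ ((a.continuous_fderiv one_ne_zero).clm_apply continuous_const)
        (b.fderiv_apply ℝ v)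
    have hcc : Continuous (chi γ k) := hc1.continuous
    have hgc : Continuous g := hg1.continuous
    have e3 : (∫ x, f x * (chi γ k x * fderiv ℝ φ x ei))
      + (∫ x, f x * (chi γ k x * (g x * fderiv ℝ φ x (eN n))))
      = (∫ x, f x * fderiv ℝ (fun x => chi γ k x * φ x) x ei)
        + ∫ x, f x * fderiv ℝ (fun x => g x * (chi γ k x * φ x)) x (eN n) := by
      rw [← integral_add (hdi _ _ hψ1 hcs1) (hdi _ _ hψ2 hcs2), ← integral_add]
      · congr 1; ext x
        rw [d1, d2, d1, hcd, hcd, hei', heN']; ring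
      · exact cc_int f lf _ (hcc.mul (hdc ei)) (hdcs ei).mul_left
      · exact cc_int f lf _ (hcc.mul (hgc.mul (hdc (eN n)))) (hdcs (eN n)).mul_left.mul_left
    rw [e3, e1, e2, ← sub_eq_add_neg]
    congr 2; ext x; ring
  have hgc : Continuous g := hg1.continuous
  have L1 := chi_lim h f _ lf zf (hdc ei) (hdcs ei)
  have L2 := chi_lim h f _ lf zf (hgc.mul (hdc (eN n))) (hdcs (eN n)).mul_left
  have L3 := chi_lim h fi _ lfi zfi hφ.continuous hcs
  have L4 := chi_lim h fn _ lfn zfn (hgc.mul hφ.continuous) hcs.mul_left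
  refine tendsto_nhds_unique (L1.add L2) ?_
  refine Tendsto.congr (fun k => (step k).symm) (L3.neg.sub L4)

end

section
variable {n : ℕ} {γ : EV n → ℝ} {p : ℝ≥0∞} {U : EV (n+1) → ℝ} {G : Fin (n+1) → EV (n+1) → ℝ}
    {H : Fin (n+1) → Fin (n+1) → EV (n+1) → ℝ}

/-- pairing of a vector field with the normal -/
def WW (γ : EV n → ℝ) (G : Fin (n+1) → EV (n+1) → ℝ) (x : EV (n+1)) : ℝ :=
  (fun j => G j x) ⬝ᵥ Nv γ (firstCoords x)

lemma Nv_meas (hγ : ContDiff ℝ 2 γ) (j : Fin (n+1)) :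
    Continuous (fun x : EV (n+1) => Nv γ (firstCoords x) j) := by
  have h1 : Continuous (fderiv ℝ γ) := hγ.continuous_fderiv (by simp)
  refine Fin.lastCases ?_ (fun i => ?_) j
  · simp only [Nv_last]; exact continuous_const
  · simp only [Nv_cast]
    exact ((h1.comp fc_cont).clm_apply continuous_const).neg

lemma WW_meas (hγ : ContDiff ℝ 2 γ) (hG : ∀ j, Measurable (G j)) : Measurable (WW γ G) := by
  unfold WW dotProduct
  exact Finset.measurable_sum _ fun j _ => (hG j).mul (Nv_meas hγ j).measurable

lemma WW_le (hd1 : ∀ y, ‖fderiv ℝ γ y‖ ≤ 1) (x : EV (n+1)) : ‖WW γ G x‖ ≤ ∑ j, ‖G j x‖ := by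
  unfold WW dotProduct
  refine (norm_sum_le _ _).trans (Finset.sum_le_sum fun j _ => ?_)
  rw [norm_mul]
  exact mul_le_of_le_one_right (norm_nonneg _) (Nv_le (hd1 _) j)

lemma WW_eLp (hp1 : 1 ≤ p) (hd1 : ∀ y, ‖fderiv ℝ γ y‖ ≤ 1) (hG : ∀ j, Measurable (G j)) :
    eLpNorm (WW γ G) p volume ≤ ∑ j, eLpNorm (G j) p volume := by
  have h1 : eLpNorm (WW γ G) p volume ≤ eLpNorm (∑ j, fun x => ‖G j x‖) p volume := by
    apply eLpNorm_mono_real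
    intro x
    rw [Finset.sum_apply]
    exact WW_le hd1 x
  refine h1.trans ((eLpNorm_sum_le (fun j _ => (hG j).norm.aestronglyMeasurable) hp1).trans ?_)
  simp only [eLpNorm_norm]; exact le_rfl

lemma WW_loc (hp1 : 1 ≤ p) (hγ : ContDiff ℝ 2 γ) (hd1 : ∀ y, ‖fderiv ℝ γ y‖ ≤ 1)
    (hG : ∀ j, Measurable (G j)) (lG : ∀ j, MemLp (G j) p volume) :
    LocallyIntegrable (WW γ G) volume := by
  have : MemLp (WW γ G) p volume := ⟨(WW_meas hγ hG).aestronglyMeasurable,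
    (WW_eLp hp1 hd1 hG).trans_lt (ENNReal.sum_lt_top.2 fun j _ => (lG j).eLpNorm_lt_top)⟩
  exact this.locallyIntegrable hp1

lemma WW_WD (h : Lip1 γ) (hγ : ContDiff ℝ 2 γ) (hp1 : 1 ≤ p)
    (S : SD (halfSpace γ) p U G H)
    (hN : ∀ φ : EV (n+1) → ℝ, ContDiff ℝ (⊤ : ℕ∞) φ → HasCompactSupport φ →
      ∑ i, ∫ x, H i i x * φ x = - ∑ i, ∫ x, G i x * fderiv ℝ φ x (EuclideanSpace.single i 1)) :
    WD Set.univ (eN n) (WW γ G) (WW γ (H (Fin.last n))) := by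
  intro φ hφ hcs _
  have hφ1 : ContDiff ℝ 1 φ := hφ.of_le (by exact_mod_cast le_top)
  have hdc : ∀ v, Continuous (fun x => fderiv ℝ φ x v) := fun v =>
    (hφ1.continuous_fderiv one_ne_zero).clm_apply continuous_const
  have hdcs : ∀ v, HasCompactSupport (fun x => fderiv ℝ φ x v) := fun v =>
    hcs.fderiv_apply ℝ v
  have lG := fun i => (S.lG i).locallyIntegrable hp1
  have lH := fun i j => (S.lH i j).locallyIntegrable hp1
  have expand : ∀ (F : Fin (n+1) → EV (n+1) → ℝ) (ψ : EV (n+1) → ℝ),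
      (∀ j, LocallyIntegrable (F j) volume) → Continuous ψ → HasCompactSupport ψ →
      ∫ x, WW γ F x * ψ x = (∫ x, F (Fin.last n) x * ψ x)
        - ∑ i : Fin n, ∫ x, F i.castSucc x * (fderiv ℝ γ (firstCoords x) (EuclideanSpace.single i 1) * ψ x) := by
    intro F ψ hF hψ hψc
    have hIntg : ∀ j, Integrable (fun x => F j x * (Nv γ (firstCoords x) j * ψ x)) volume :=
      fun j => cc_int _ (hF j) _ ((Nv_meas hγ j).mul hψ) hψc.mul_left
    have e1 : ∀ x, WW γ F x * ψ x = ∑ j, F j x * (Nv γ (firstCoords x) j * ψ x) := by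
      intro x
      simp only [WW, dotProduct, Finset.sum_mul, mul_assoc]
    simp only [e1]
    rw [integral_finsetSum _ (fun j _ => hIntg j), Fin.sum_univ_castSucc]
    simp only [Nv_last, Nv_cast, one_mul, neg_mul, mul_neg, integral_neg, Finset.sum_neg_distrib]
    ring
  rw [expand _ _ lG (hdc _) (hdcs _), expand _ _ (lH _) hφ.continuous hcs]
  have hT := fun i : Fin n => tang h hγ i (G i.castSucc) (H i.castSucc i.castSucc)
    (H (Fin.last n) i.castSucc) (lG _) (lH _ _) (lH _ _) (S.zG _) (S.zH _ _) (S.zH _ _)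
    (S.wG _ _) (S.wG _ _) φ hφ hcs
  have hN' := hN φ hφ hcs
  rw [Fin.sum_univ_castSucc, Fin.sum_univ_castSucc] at hN'
  have hT' := Finset.sum_congr (rfl : (Finset.univ : Finset (Fin n)) = Finset.univ)
    (fun i _ => hT i)
  simp only [Finset.sum_add_distrib, Finset.sum_sub_distrib, Finset.sum_neg_distrib] at hT'
  unfold eN at hT' ⊢
  linarith

/-- extended weight -/
def kkE {m : ℕ} (r : EV m → ℝ) (d : ℝ) : ℝ≥0∞ :=
  ∫⁻ z, {z : EV m | d ≤ ‖z‖}.indicator (fun z => ENNReal.ofReal (kernelJ r z * ‖z‖)) z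

lemma kkE_meas2 {m : ℕ} {r : EV m → ℝ} (mr : Measurable r) :
    Measurable (fun q : ℝ × EV m => {z : EV m | q.1 ≤ ‖z‖}.indicator
      (fun z => ENNReal.ofReal (kernelJ r z * ‖z‖)) q.2) := by
  have : (fun q : ℝ × EV m => {z : EV m | q.1 ≤ ‖z‖}.indicator
      (fun z => ENNReal.ofReal (kernelJ r z * ‖z‖)) q.2)
      = {q : ℝ × EV m | q.1 ≤ ‖q.2‖}.indicator
        (fun q => ENNReal.ofReal (kernelJ r q.2 * ‖q.2‖)) := by
    ext q; simp [Set.indicator]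
  rw [this]
  refine Measurable.indicator ?_ (measurableSet_le (by fun_prop) (by fun_prop))
  exact (((mJ mr).comp measurable_snd).mul (by fun_prop)).ennreal_ofReal

lemma kkE_meas {m : ℕ} {r : EV m → ℝ} (mr : Measurable r) : Measurable (kkE r) :=
  (kkE_meas2 mr).lintegral_prod_right'

lemma kkE_eq {m : ℕ} {r : EV m → ℝ} (h : KF r) {d : ℝ} (hd : 0 < d) :
    ENNReal.ofReal (kk r d) = kkE r d := by
  have hms : MeasurableSet {z : EV m | d ≤ ‖z‖} := measurableSet_le (by fun_prop) (by fun_prop)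
  unfold kk kkE
  rw [ofReal_integral_eq_lintegral_ofReal (h.Jn_int hd).1
    (Eventually.of_forall fun z => mul_nonneg (h.Jnn z) (norm_nonneg z)), lintegral_indicator hms]

lemma J2_lint {m : ℕ} {r : EV m → ℝ} (h : KF r) :
    ∫⁻ z, ENNReal.ofReal (kernelJ r z * ‖z‖) * ENNReal.ofReal (2 * ‖z‖)
      ≤ ENNReal.ofReal (2 * ∫ z, r z) := by
  rw [← integral_const_mul, ofReal_integral_eq_lintegral_ofReal (h.ii.const_mul _)
    (Eventually.of_forall fun z => mul_nonneg (by norm_num) (h.nn z))]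
  refine lintegral_mono fun z => ?_
  rw [← ENNReal.ofReal_mul (mul_nonneg (h.Jnn z) (norm_nonneg z))]
  apply ENNReal.ofReal_le_ofReal
  by_cases hz : ‖z‖ = 0
  · simp [hz, h.nn z]
  · unfold kernelJ; apply le_of_eq; field_simp

lemma kkE_D {m : ℕ} {r : EV m → ℝ} (h : KF r) (D : ℝ) :
    kkE r (D/2) * ENNReal.ofReal D ≤ ENNReal.ofReal (2 * ∫ z, r z) := by
  refine le_trans ?_ (J2_lint h)
  unfold kkE
  rw [← lintegral_mul_const' _ _ ENNReal.ofReal_ne_top]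
  refine lintegral_mono fun z => ?_
  by_cases hz : D/2 ≤ ‖z‖
  · rw [Set.indicator_of_mem (by exact hz)]
    gcongr; linarith
  · rw [Set.indicator_of_notMem (by exact hz), zero_mul]; exact zero_le

lemma kkE_int {m : ℕ} {r : EV m → ℝ} (h : KF r) {D : ℝ} (hD : 0 ≤ D) :
    ∫⁻ τ in Set.Ici (0:ℝ), kkE r ((D + τ)/2) ≤ ENNReal.ofReal (2 * ∫ z, r z) := by
  refine le_trans ?_ (J2_lint h)
  unfold kkE
  have hm : Measurable (fun q : ℝ × EV m => {z : EV m | (D + q.1)/2 ≤ ‖z‖}.indicator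
      (fun z => ENNReal.ofReal (kernelJ r z * ‖z‖)) q.2) :=
    (kkE_meas2 h.mr).comp (by fun_prop : Measurable fun q : ℝ × EV m => ((D + q.1)/2, q.2))
  rw [lintegral_lintegral_swap hm.aemeasurable]
  refine lintegral_mono fun z => ?_
  calc ∫⁻ τ in Set.Ici (0:ℝ), {z : EV m | (D + τ)/2 ≤ ‖z‖}.indicator
        (fun z => ENNReal.ofReal (kernelJ r z * ‖z‖)) z
    _ ≤ ∫⁻ τ in Set.Ici (0:ℝ), (Set.Iic (2 * ‖z‖)).indicator
          (fun _ => ENNReal.ofReal (kernelJ r z * ‖z‖)) τ := by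
        refine setLIntegral_mono (measurable_const.indicator measurableSet_Iic) fun τ _ => ?_
        by_cases hz : (D + τ)/2 ≤ ‖z‖
        · rw [Set.indicator_of_mem (by exact hz), Set.indicator_of_mem]
          rw [Set.mem_Iic]; linarith
        · rw [Set.indicator_of_notMem (by exact hz)]; exact zero_le
    _ = _ := by
        rw [lintegral_indicator_const measurableSet_Iic, Measure.restrict_apply measurableSet_Iic,
          Set.inter_comm, Set.Ici_inter_Iic, Real.volume_Icc, sub_zero]

end

section
variable {n : ℕ} {γ : EV n → ℝ} {p : ℝ≥0∞}

lemma Dh_shift (x : EV (n+1)) (t : ℝ) : Dh γ (x + t • eN n) = Dh γ x + t := by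
  have h1 : firstCoords (x + t • eN n) = firstCoords x := by
    rw [fc_add, fc_smul, fc_eN, smul_zero, add_zero]
  have h2 : (x + t • eN n) (Fin.last n) = x (Fin.last n) + t := by
    rw [PiLp.add_apply, PiLp.smul_apply, eN_last]; simp
  unfold Dh; rw [h1, h2]; ring

lemma hardy_pt (W Z : EV (n+1) → ℝ) (mZ : Measurable Z) (lW : LocallyIntegrable W volume)
    (lZ : LocallyIntegrable Z volume) (zW : ∀ x, x ∉ halfSpace γ → W x = 0)
    (hWD : WD Set.univ (eN n) W Z) :
    ∀ᵐ x : EV (n+1), ‖W x‖ₑ ≤ ∫⁻ τ in Set.Ici (0:ℝ), ‖Z (x + (-τ) • eN n)‖ₑ := by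
  have h1 : ∀ R : ℕ, ∀ᵐ x : EV (n+1), x ∈ (Set.univ : Set (EV (n+1))) →
      W (x + (-((R:ℝ)+1)) • eN n) - W x
        = ∫ s in Set.Icc (0:ℝ) 1, (-((R:ℝ)+1)) * Z (x + s • ((-((R:ℝ)+1)) • eN n)) := by
    intro R
    refine ftc Set.univ isOpen_univ ((-((R:ℝ)+1)) • eN n) (fun _ _ _ _ => Set.mem_univ _) W
      (fun x => (-((R:ℝ)+1)) * Z x) lW ?_ ?_
    · exact lZ.smul (-((R:ℝ)+1))
    · intro φ hφ hcs hs
      have := hWD φ hφ hcs hs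
      simp only [map_smul, smul_eq_mul]
      calc ∫ x, W x * (-((R:ℝ)+1) * fderiv ℝ φ x (eN n))
          = -((R:ℝ)+1) * ∫ x, W x * fderiv ℝ φ x (eN n) := by
            rw [← integral_const_mul]; congr 1; ext x; ring
        _ = _ := by
            rw [this, mul_neg, ← integral_const_mul]; congr 2; ext x; ring
  rw [← ae_all_iff] at h1
  filter_upwards [h1] with x hx
  obtain ⟨R, hR⟩ := exists_nat_gt (Dh γ x)
  have h2 := hx R (Set.mem_univ _)
  have h3 : W (x + (-((R:ℝ)+1)) • eN n) = 0 := by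
    apply zW; rw [mem_hs, Dh_shift]; push Not; linarith
  rw [h3, zero_sub] at h2
  have hR0 : (0:ℝ) < R + 1 := by positivity
  rw [← enorm_neg, h2]
  refine (enorm_integral_le_lintegral_enorm _).trans ?_
  set f : ℝ → ℝ≥0∞ := fun τ => (Set.Ici (0:ℝ)).indicator (fun τ => ‖Z (x + (-τ) • eN n)‖ₑ) τ with hf
  have mf : Measurable f := by
    refine Measurable.indicator ?_ measurableSet_Ici
    exact (mZ.comp (by fun_prop)).enorm
  have h4 : ∫⁻ τ, f τ = ENNReal.ofReal (R+1) * ∫⁻ s, f ((R+1) * s) := by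
    conv_lhs => rw [← Real.smul_map_volume_mul_left hR0.ne']
    rw [lintegral_smul_measure, lintegral_map mf (by fun_prop), abs_of_pos hR0, smul_eq_mul]
  rw [← lintegral_indicator measurableSet_Ici]
  change _ ≤ ∫⁻ τ, f τ
  rw [h4, ← lintegral_const_mul' _ _ ENNReal.ofReal_ne_top, ← lintegral_indicator measurableSet_Icc]
  refine lintegral_mono fun s => ?_
  by_cases hs : s ∈ Set.Icc (0:ℝ) 1
  · rw [Set.indicator_of_mem hs, hf]
    have : (R+1) * s ∈ Set.Ici (0:ℝ) := mul_nonneg hR0.le hs.1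
    simp only [Set.indicator_of_mem this]
    rw [enorm_mul, enorm_neg, Real.enorm_of_nonneg hR0.le, smul_smul]
    apply le_of_eq; congr 5; ring
  · rw [Set.indicator_of_notMem hs]; exact zero_le

lemma hardy (h : Lip1 γ) (hp1 : 1 ≤ p) (hp : p ≠ ⊤) {r : EV (n+1) → ℝ} (hr : KF r)
    (W Z : EV (n+1) → ℝ) (mZ : Measurable Z) (lW : LocallyIntegrable W volume)
    (lZ : LocallyIntegrable Z volume) (zW : ∀ x, x ∉ halfSpace γ → W x = 0)
    (zZ : ∀ x, x ∉ halfSpace γ → Z x = 0)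
    (hWD : WD Set.univ (eN n) W Z) :
    eLpNorm (fun x => kkE r (Dh γ x / 2) * ‖W x‖ₑ) p volume
      ≤ ENNReal.ofReal (2 * ∫ z, r z) * eLpNorm Z p volume := by
  set A := ENNReal.ofReal (2 * ∫ z, r z) with hA
  have h0 : p ≠ 0 := by rintro rfl; simp at hp1
  have hq0 := ENNReal.toReal_pos h0 hp
  have hq : 1 ≤ p.toReal := by
    rw [← ENNReal.toReal_one]; exact (ENNReal.toReal_le_toReal (by simp) hp).2 hp1
  set q := p.toReal
  set w : EV (n+1) → ℝ → ℝ≥0∞ := fun x τ =>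
    {a : EV (n+1) × ℝ | 0 ≤ a.2 ∧ a.2 < Dh γ a.1}.indicator (fun a => kkE r (Dh γ a.1 / 2)) (x, τ)
    with hw
  set g : EV (n+1) → ℝ → ℝ≥0∞ := fun x τ => ‖Z (x + (-τ) • eN n)‖ₑ with hg
  have mD := (Dh_cont h).measurable
  have mS : MeasurableSet {a : EV (n+1) × ℝ | 0 ≤ a.2 ∧ a.2 < Dh γ a.1} :=
    (measurableSet_le measurable_const measurable_snd).inter
      (measurableSet_lt measurable_snd (mD.comp measurable_fst))
  have mw : Measurable (Function.uncurry w) :=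
    ((kkE_meas hr.mr).comp ((mD.comp measurable_fst).div_const 2)).indicator mS
  have mg : Measurable (Function.uncurry g) :=
    (mZ.comp (by fun_prop : Measurable fun a : EV (n+1) × ℝ => a.1 + (-a.2) • eN n)).enorm
  have hpt : ∀ᵐ x : EV (n+1), kkE r (Dh γ x / 2) * ‖W x‖ₑ ≤ ∫⁻ τ, w x τ * g x τ := by
    filter_upwards [hardy_pt W Z mZ lW lZ zW hWD] with x hx
    have hgm : Measurable (g x) := mg.comp measurable_prodMk_left
    refine (mul_le_mul_right hx _).trans ?_
    rw [← lintegral_indicator measurableSet_Ici, ← lintegral_const_mul _ (hgm.indicator measurableSet_Ici)]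
    refine lintegral_mono fun τ => ?_
    by_cases h1 : 0 ≤ τ
    · rw [Set.indicator_of_mem (by exact h1)]
      by_cases h2 : τ < Dh γ x
      · simp only [hw]
        rw [Set.indicator_of_mem (by exact ⟨h1, h2⟩)]
      · have hz : g x τ = 0 := by
          simp only [hg]
          rw [zZ (x + (-τ) • eN n) (by rw [mem_hs, Dh_shift]; push Not; linarith)]; simp
        rw [hz, mul_zero, mul_zero]
    · rw [Set.indicator_of_notMem (by exact h1), mul_zero]; exact zero_le
  have hAw : ∀ᵐ x : EV (n+1), ∫⁻ τ, w x τ ≤ A := by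
    refine Eventually.of_forall fun x => ?_
    refine le_trans (le_of_eq ?_) (kkE_D hr (Dh γ x))
    have : ∀ τ, w x τ = (Set.Ico 0 (Dh γ x)).indicator (fun _ => kkE r (Dh γ x / 2)) τ := by
      intro τ; simp only [hw, Set.indicator]; rfl
    simp only [this]
    rw [lintegral_indicator_const measurableSet_Ico, Real.volume_Ico, sub_zero]
  have hsw : ∫⁻ τ, ∫⁻ x, w x τ * g x τ ^ q ≤ A * ∫⁻ y, ‖Z y‖ₑ ^ q := by
    have e1 : ∀ τ, ∫⁻ x, w x τ * g x τ ^ q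
        = ∫⁻ y, w (y + τ • eN n) τ * ‖Z y‖ₑ ^ q := by
      intro τ
      rw [← lintegral_add_right_eq_self (fun x => w x τ * g x τ ^ q) (τ • eN n)]
      congr 1; ext y
      simp only [hg]
      congr 4
      simp
    simp only [e1]
    have mw2 : Measurable (fun a : ℝ × EV (n+1) => w (a.2 + a.1 • eN n) a.1) :=
      mw.comp (by fun_prop : Measurable fun a : ℝ × EV (n+1) => (a.2 + a.1 • eN n, a.1))
    have mZ2 : Measurable (fun a : ℝ × EV (n+1) => ‖Z a.2‖ₑ ^ q) :=
      (mZ.comp measurable_snd).enorm.pow_const _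
    rw [lintegral_lintegral_swap (mw2.mul mZ2).aemeasurable,
      ← lintegral_const_mul _ (mZ.enorm.pow_const _)]
    refine lintegral_mono fun y => ?_
    have mw3 : Measurable (fun τ : ℝ => w (y + τ • eN n) τ) :=
      mw2.comp (by fun_prop : Measurable fun τ : ℝ => (τ, y))
    simp only
    rw [lintegral_mul_const _ mw3]
    by_cases hy : 0 < Dh γ y
    · gcongr
      refine le_trans ?_ (kkE_int hr hy.le)
      rw [← lintegral_indicator measurableSet_Ici]
      refine lintegral_mono fun τ => ?_
      simp only [hw, Set.indicator, Set.mem_ofPred_eq, Dh_shift, Set.mem_Ici]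
      split_ifs with h1 h2 h2
      · exact le_rfl
      · exact absurd h1.1 h2
      · exact zero_le
      · exact le_rfl
    · rw [zZ y (by rw [mem_hs]; exact hy)]
      simp [hq0]
  rw [← ENNReal.rpow_le_rpow_iff hq0, eLpNorm_pow _ _ _ hp1 hp]
  simp only [enorm_eq_self]
  calc ∫⁻ x, (kkE r (Dh γ x / 2) * ‖W x‖ₑ) ^ q
      ≤ ∫⁻ x, (∫⁻ τ, w x τ * g x τ) ^ q := by
        refine lintegral_mono_ae ?_
        filter_upwards [hpt] with x hx
        gcongr
    _ ≤ A ^ (q - 1) * ∫⁻ τ, ∫⁻ x, w x τ * g x τ ^ q := schur volume volume w g mw mg q hq A hAw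
    _ ≤ A ^ (q - 1) * (A * ∫⁻ y, ‖Z y‖ₑ ^ q) := mul_le_mul_right hsw _
    _ = _ := by
        rw [ENNReal.mul_rpow_of_nonneg _ _ hq0.le, ← mul_assoc, eLpNorm_pow _ _ _ hp1 hp]
        congr 1
        have h2 : A ^ (q - 1) * A ^ (1:ℝ) = A ^ q := by
          rw [← ENNReal.rpow_add_of_nonneg _ _ (by linarith) (by norm_num)]; congr 1; ring
        simpa using h2

end

section
variable {n : ℕ} {γ : EV n → ℝ} {p : ℝ≥0∞} {U : EV (n+1) → ℝ} {G : Fin (n+1) → EV (n+1) → ℝ}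
    {H : Fin (n+1) → Fin (n+1) → EV (n+1) → ℝ}

/-- the operator in terms of a derivative system -/
def LL (γ : EV n → ℝ) (r U : EV (n+1) → ℝ) (G : Fin (n+1) → EV (n+1) → ℝ) (x : EV (n+1)) : ℝ :=
  - TI (halfSpace γ) r U G x - BB (halfSpace γ) r (Dh γ x / 2) (fun j => G j x) x

lemma TI_meas {m : ℕ} {Ω : Set (EV m)} {r U : EV m → ℝ} {G : Fin m → EV m → ℝ}
    (mr : Measurable r) (mU : Measurable U) (mG : ∀ i, Measurable (G i)) :
    Measurable (TI Ω r U G) := by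
  unfold TI
  have : Measurable (fun q : EV m × EV m => kernelJ r (q.1 - q.2) * Rem U G q.1 (q.2 - q.1)) :=
    ((mJ mr).comp (by fun_prop)).mul
      ((mRem2 mU mG).comp (by fun_prop : Measurable fun q : EV m × EV m => (q.1, q.2 - q.1)))
  exact (this.stronglyMeasurable.integral_prod_right' (ν := volume.restrict Ω)).measurable

lemma TT_meas {m : ℕ} {Ω : Set (EV m)} {r U : EV m → ℝ} {G : Fin m → EV m → ℝ}
    (mr : Measurable r) (mU : Measurable U) (mG : ∀ i, Measurable (G i)) :
    Measurable (TT Ω r U G) := by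
  unfold TT
  have : Measurable (fun q : EV m × EV m => ‖kernelJ r (q.1 - q.2) * Rem U G q.1 (q.2 - q.1)‖ₑ) :=
    (((mJ mr).comp (by fun_prop)).mul
      ((mRem2 mU mG).comp (by fun_prop : Measurable fun q : EV m × EV m => (q.1, q.2 - q.1)))).enorm
  exact this.lintegral_prod_right'

lemma BB_meas (h : Lip1 γ) {r : EV (n+1) → ℝ} (mr : Measurable r) (mG : ∀ i, Measurable (G i)) :
    Measurable (fun x => BB (halfSpace γ) r (Dh γ x / 2) (fun j => G j x) x) := by
  have mΩ := (hs_open h).measurableSet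
  have mD := (Dh_cont h).measurable
  set S := {q : EV (n+1) × EV (n+1) | q.1 + q.2 ∈ halfSpace γ} ∩ {q | Dh γ q.1 / 2 ≤ ‖q.2‖} with hS
  have mS : MeasurableSet S :=
    (mΩ.preimage (by fun_prop : Measurable fun q : EV (n+1) × EV (n+1) => q.1 + q.2)).inter
      (measurableSet_le ((mD.comp measurable_fst).div_const 2) (by fun_prop))
  have mf : Measurable (S.indicator
      (fun q : EV (n+1) × EV (n+1) => kernelJ r q.2 * lin (fun j => G j q.1) q.2)) := by
    refine Measurable.indicator (((mJ mr).comp measurable_snd).mul ?_) mS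
    unfold lin
    refine Finset.measurable_sum _ fun j _ => Measurable.mul (by fun_prop) ((mG j).comp measurable_fst)
  have e : (fun x => BB (halfSpace γ) r (Dh γ x / 2) (fun j => G j x) x)
      = fun x => ∫ z, S.indicator
      (fun q : EV (n+1) × EV (n+1) => kernelJ r q.2 * lin (fun j => G j q.1) q.2) (x, z) := by
    ext x
    unfold BB
    rw [← integral_indicator]
    · rfl
    · exact mS.preimage (by fun_prop : Measurable fun z : EV (n+1) => (x, z))
  rw [e]
  exact mf.stronglyMeasurable.integral_prod_right'.measurable

lemma LL_meas (h : Lip1 γ) {r : EV (n+1) → ℝ} (mr : Measurable r) (S : SD (halfSpace γ) p U G H) :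
    Measurable (LL γ r U G) :=
  (TI_meas mr S.mU S.mG).neg.sub (BB_meas h mr S.mG)

lemma LL_bound {r : EV (n+1) → ℝ} (hr : KF r) (ho : OddSl r) {K : ℝ} (hK : 0 ≤ K) (hT : Thin r K)
    (h : Lip1 γ) (hγ : ContDiff ℝ 2 γ) {C : ℝ} (hC : 0 ≤ C) (hd1 : ∀ y, ‖fderiv ℝ γ y‖ ≤ 1)
    (hC2 : ∀ y v, |γ (y + v) - γ y - fderiv ℝ γ y v| ≤ C * ‖v‖^2)
    (hp1 : 1 ≤ p) (hp : p ≠ ⊤) (S : SD (halfSpace γ) p U G H)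
    (hN : ∀ φ : EV (n+1) → ℝ, ContDiff ℝ (⊤ : ℕ∞) φ → HasCompactSupport φ →
      ∑ i, ∫ x, H i i x * φ x = - ∑ i, ∫ x, G i x * fderiv ℝ φ x (EuclideanSpace.single i 1)) :
    eLpNorm ((halfSpace γ).indicator (LL γ r U G)) p volume
      ≤ ENNReal.ofReal (∫ z, r z) * (23 * (n+1 : ℕ) * SH p H)
        + ENNReal.ofReal ((n+2) * (C * K)) * (∑ j, eLpNorm (G j) p volume)
        + (n+1 : ℕ) * (ENNReal.ofReal (2 * ∫ z, r z) * ∑ j, eLpNorm (H (Fin.last n) j) p volume) := by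
  set Ω := halfSpace γ with hΩ
  have mΩ : MeasurableSet Ω := (hs_open h).measurableSet
  set f1 : EV (n+1) → ℝ≥0∞ := Ω.indicator (TT Ω r U G) with hf1
  set f2 : EV (n+1) → ℝ := fun x => ((n+2) * (C * K)) * ∑ j, ‖G j x‖ with hf2
  set f2' : EV (n+1) → ℝ≥0∞ := fun x => ‖f2 x‖ₑ with hf2'
  set f3 : EV (n+1) → ℝ≥0∞ := fun x => kkE r (Dh γ x / 2) * ‖WW γ G x‖ₑ with hf3
  have m1 : Measurable f1 := (TT_meas hr.mr S.mU S.mG).indicator mΩ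
  have m2 : Measurable f2 :=
    (Finset.measurable_sum _ fun j _ => (S.mG j).norm).const_mul _
  have m3 : Measurable f3 := ((kkE_meas hr.mr).comp ((Dh_cont h).measurable.div_const 2)).mul
    (WW_meas hγ S.mG).enorm
  have m4 : Measurable (fun x => ((n+1 : ℕ) : ℝ≥0∞) * f3 x) := m3.const_mul _
  have hpt : ∀ x, ‖Ω.indicator (LL γ r U G) x‖ₑ
      ≤ ‖(f1 + f2' + fun x => ((n+1 : ℕ) : ℝ≥0∞) * f3 x) x‖ₑ := by
    intro x
    rw [enorm_eq_self]
    by_cases hx : x ∈ Ω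
    · rw [Set.indicator_of_mem hx]
      have hD : 0 < Dh γ x := (mem_hs x).1 hx
      simp only [Pi.add_apply, hf1, Set.indicator_of_mem hx]
      have b1 : ‖TI Ω r U G x‖ₑ ≤ TT Ω r U G x := enorm_integral_le_lintegral_enorm _
      have b2 := BB_bound hr ho hK hT h hC hd1 hC2 x (D := Dh γ x) rfl hD (fun j => G j x)
      have b3 : ‖BB Ω r (Dh γ x / 2) (fun j => G j x) x‖ₑ
          ≤ f2' x + ((n+1 : ℕ) : ℝ≥0∞) * f3 x := by
        rw [Real.enorm_eq_ofReal_abs]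
        refine (ENNReal.ofReal_le_ofReal b2).trans ?_
        have hkk : 0 ≤ kk r (Dh γ x / 2) :=
          integral_nonneg fun z => mul_nonneg (hr.Jnn z) (norm_nonneg z)
        rw [ENNReal.ofReal_add (by positivity) (by positivity), mul_assoc ((n:ℝ)+1),
          ENNReal.ofReal_mul (p := (n:ℝ)+1) (by positivity), ENNReal.ofReal_mul hkk,
          kkE_eq hr (half_pos hD)]
        refine add_le_add (le_of_eq ?_) (le_of_eq ?_)
        · simp only [hf2']
          rw [Real.enorm_of_nonneg]
          · rfl
          · simp only [hf2]; positivity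
        · have : ENNReal.ofReal ((n:ℝ)+1) = ((n+1 : ℕ) : ℝ≥0∞) := by
            rw [← Nat.cast_succ, ENNReal.ofReal_natCast]
          rw [this]
          simp only [hf3, Real.enorm_eq_ofReal_abs]
          rfl
      unfold LL
      refine (enorm_sub_le).trans ?_
      rw [enorm_neg, add_assoc]
      exact add_le_add b1 b3
    · rw [Set.indicator_of_notMem hx]; simp
  refine (eLpNorm_mono_enorm hpt).trans ?_
  refine (eLpNorm_add_le (m1.add m2.enorm).aestronglyMeasurable m4.aestronglyMeasurable hp1).trans ?_
  refine add_le_add ((eLpNorm_add_le m1.aestronglyMeasurable m2.enorm.aestronglyMeasurable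
    hp1).trans ?_) ?_
  · refine add_le_add (TT_bound h hp1 hp S r hr.mr _ hr.lint.le) ?_
    have e1 : eLpNorm f2' p volume = eLpNorm f2 p volume := eLpNorm_enorm f2
    rw [e1]
    have e2 : f2 = ((n+2) * (C * K) : ℝ) • ∑ j, fun x => ‖G j x‖ := by
      ext x; simp [hf2]
    rw [e2, eLpNorm_const_smul, Real.enorm_of_nonneg (by positivity)]
    gcongr
    refine (eLpNorm_sum_le (fun j _ => (S.mG j).norm.aestronglyMeasurable) hp1).trans ?_
    simp only [eLpNorm_norm]; exact le_rfl
  · have e1 : eLpNorm (fun x => ((n+1 : ℕ) : ℝ≥0∞) * f3 x) p volume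
        ≤ (n+1 : ℕ) * eLpNorm f3 p volume := by
      have h0 : p ≠ 0 := by rintro rfl; simp at hp1
      have hq0 := ENNReal.toReal_pos h0 hp
      rw [← ENNReal.rpow_le_rpow_iff hq0, ENNReal.mul_rpow_of_nonneg _ _ hq0.le,
        eLpNorm_pow _ _ _ hp1 hp, eLpNorm_pow _ _ _ hp1 hp]
      simp only [enorm_eq_self, ENNReal.mul_rpow_of_nonneg _ _ hq0.le]
      rw [lintegral_const_mul _ (m3.pow_const _)]
    refine e1.trans ?_
    gcongr
    have zW : ∀ (F : Fin (n+1) → EV (n+1) → ℝ), (∀ i x, x ∉ Ω → F i x = 0) →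
        ∀ x, x ∉ Ω → WW γ F x = 0 := by
      intro F hF x hx
      unfold WW dotProduct
      exact Finset.sum_eq_zero fun j _ => by simp only [hF j x hx, zero_mul]
    refine (hardy h hp1 hp hr (WW γ G) (WW γ (H (Fin.last n))) (WW_meas hγ (S.mH _))
      (WW_loc hp1 hγ hd1 S.mG S.lG) (WW_loc hp1 hγ hd1 (S.mH _) (S.lH _)) (zW _ S.zG)
      (zW _ (S.zH _)) (WW_WD h hγ hp1 S hN)).trans ?_
    gcongr
    exact WW_eLp hp1 hd1 (S.mH _)

lemma TT_fin {r : EV (n+1) → ℝ} (hr : KF r) (h : Lip1 γ)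
    (hp1 : 1 ≤ p) (hp : p ≠ ⊤) (S : SD (halfSpace γ) p U G H) :
    ∀ᵐ x : EV (n+1), x ∈ halfSpace γ → TT (halfSpace γ) r U G x < ⊤ := by
  have mΩ : MeasurableSet (halfSpace γ) := (hs_open h).measurableSet
  have h0 : p ≠ 0 := by rintro rfl; simp at hp1
  have hq0 := ENNReal.toReal_pos h0 hp
  have b := TT_bound h hp1 hp S r hr.mr _ hr.lint.le
  have hfin : eLpNorm ((halfSpace γ).indicator (TT (halfSpace γ) r U G)) p volume < ⊤ := by
    refine b.trans_lt (ENNReal.mul_lt_top ENNReal.ofReal_lt_top (ENNReal.mul_lt_top ?_ ?_))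
    · exact ENNReal.mul_lt_top (by simp) (ENNReal.natCast_lt_top _)
    · exact ENNReal.sum_lt_top.2 fun j _ => ENNReal.sum_lt_top.2 fun i _ => (S.lH i j).eLpNorm_lt_top
  have m1 : Measurable ((halfSpace γ).indicator (TT (halfSpace γ) r U G)) :=
    (TT_meas hr.mr S.mU S.mG).indicator mΩ
  have h2 := eLpNorm_pow volume ((halfSpace γ).indicator (TT (halfSpace γ) r U G)) p hp1 hp
  have h3 : ∫⁻ x, ‖(halfSpace γ).indicator (TT (halfSpace γ) r U G) x‖ₑ ^ p.toReal ≠ ⊤ := by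
    rw [← h2]; exact (ENNReal.rpow_lt_top_of_nonneg hq0.le hfin.ne).ne
  filter_upwards [ae_lt_top (m1.enorm.pow_const _) h3] with x hx hxΩ
  rw [enorm_eq_self, Set.indicator_of_mem hxΩ, ENNReal.rpow_lt_top_iff_of_pos hq0] at hx
  exact hx

lemma LL_pv {r : EV (n+1) → ℝ} (hr : KF r) (h : Lip1 γ)
    (hp1 : 1 ≤ p) (hp : p ≠ ⊤) (S : SD (halfSpace γ) p U G H) :
    ∀ᵐ x : EV (n+1), x ∈ halfSpace γ → Tendsto (fun s : ℝ =>
      ∫ y in halfSpace γ ∩ {y : EV (n+1) | s ≤ dist x y}, kernelJ r (x - y) * (U x - U y))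
      (𝓝[>] 0) (𝓝 (LL γ r U G x)) := by
  have mΩ : MeasurableSet (halfSpace γ) := (hs_open h).measurableSet
  filter_upwards [TT_fin hr h hp1 hp S] with x hx0 hxΩ
  have hx := hx0 hxΩ
  have hD : 0 < Dh γ x := (mem_hs x).1 hxΩ
  refine pv_main mΩ hr S.mU S.mG (half_pos hD) ?_ hx
  intro y hy
  rw [mem_hs]
  rw [Metric.mem_ball, dist_eq_norm] at hy
  have h5 := h (firstCoords y) (firstCoords x)
  rw [← fc_sub] at h5
  have h6 := fc_norm_le (y - x)
  have h7 := coord_le (y - x) (Fin.last n)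
  rw [PiLp.sub_apply] at h7
  unfold Dh at *
  rw [abs_le] at h5 h7
  linarith

lemma pv_int {m : ℕ} {Ω : Set (EV m)} (hΩ : MeasurableSet Ω) {r U : EV m → ℝ} (h : KF r)
    {G : Fin m → EV m → ℝ} (mU : Measurable U) (mG : ∀ i, Measurable (G i)) {x : EV m}
    (hT : TT Ω r U G x < ⊤) {s : ℝ} (hs : 0 < s) :
    IntegrableOn (fun y => kernelJ r (x - y) * (U x - U y)) (Ω ∩ {y : EV m | s ≤ dist x y})
      volume := by
  have mS : MeasurableSet {y : EV m | s ≤ dist x y} := measurableSet_le (by fun_prop) (by fun_prop)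
  set f : EV m → ℝ := fun y => kernelJ r (x - y) * Rem U G x (y - x) with hf
  have mf : Measurable f := ((mJ h.mr).comp (by fun_prop)).mul
    ((mRem2 mU mG).comp (by fun_prop : Measurable fun y : EV m => (x, y - x)))
  have hfi : IntegrableOn f Ω volume := ⟨mf.aestronglyMeasurable, hT⟩
  set a := fun j => G j x with ha
  have mset : MeasurableSet (Ω ∩ {y : EV m | s ≤ dist x y}) := hΩ.inter mS
  have ms0 : MeasurableSet {z : EV m | s ≤ ‖z‖} :=
    measurableSet_le (by fun_prop) (by fun_prop)
  have mΩx : MeasurableSet {z | x + z ∈ Ω} := hΩ.preimage (measurable_const_add x)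
  have gae : ∀ᵐ z : EV m, kernelJ r (x - (x + z)) * lin a (x + z - x) = kernelJ r z * lin a z := by
    filter_upwards [h.Jev] with z hz
    rw [add_sub_cancel_left, sub_add_cancel_left, hz]
  have i0 : IntegrableOn (fun z => kernelJ r z * lin a z) ({z | x + z ∈ Ω} ∩ {z | s ≤ ‖z‖}) :=
    (h.Jlin_int a hs).mono_set Set.inter_subset_right
  have i1 : IntegrableOn (fun y => kernelJ r (x - y) * lin a (y - x))
      (Ω ∩ {y : EV m | s ≤ dist x y}) volume := by
    have i2 : Integrable ((({z | x + z ∈ Ω} ∩ {z | s ≤ ‖z‖}).indicator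
      (fun z => kernelJ r (x - (x+z)) * lin a ((x + z) - x)))) volume := by
      rw [integrable_indicator_iff (mΩx.inter ms0)]
      exact i0.congr (ae_restrict_of_ae (gae.mono fun z hz => hz.symm))
    have i3 := i2.comp_sub_right x
    rw [← integrable_indicator_iff mset]
    refine i3.congr (Eventually.of_forall fun y => ?_)
    simp only [Set.indicator]
    congr 1
    · simp [dist_eq_norm, norm_sub_rev]
    · simp
  refine ((hfi.mono_set Set.inter_subset_left).neg.sub i1).congr
    (Eventually.of_forall fun y => ?_)
  simp only [hf, Rem, lin, ha, Pi.sub_apply, Pi.neg_apply]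
  rw [add_sub_cancel]
  ring

end

section
variable {n : ℕ} {γ : EV n → ℝ} {p : ℝ≥0∞}

lemma geom_lip (hγ : ContDiff ℝ 3 γ) (hd1 : ∀ y, ‖fderiv ℝ γ y‖ ≤ 1) : Lip1 γ := by
  intro a b
  have := Convex.norm_image_sub_le_of_norm_fderiv_le (𝕜 := ℝ) (f := γ) (C := 1) (s := Set.univ)
    (x := b) (y := a)
    (fun x _ => (hγ.differentiable (by norm_num)) x) (fun x _ => hd1 x) convex_univ
    (Set.mem_univ _) (Set.mem_univ _)
  simpa using this

lemma geom_taylor (hγ : Ckb 3 γ) :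
    ∃ C : ℝ, 0 ≤ C ∧ ∀ y v, |γ (y + v) - γ y - fderiv ℝ γ y v| ≤ C * ‖v‖^2 := by
  obtain ⟨C, hC⟩ := hγ.2 2 (by norm_num)
  have hC0 : 0 ≤ C := (norm_nonneg _).trans (hC 0)
  have hd : Differentiable ℝ γ := hγ.1.differentiable (by norm_num)
  have hdd : Differentiable ℝ (fderiv ℝ γ) :=
    (hγ.1.fderiv_right (m := 2) (by norm_num)).differentiable (by norm_num)
  have h2 : ∀ x, ‖fderiv ℝ (fderiv ℝ γ) x‖ ≤ C := by
    intro x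
    have := hC x
    rwa [← norm_iteratedFDeriv_fderiv, norm_iteratedFDeriv_one] at this
  have hL : ∀ a b, ‖fderiv ℝ γ a - fderiv ℝ γ b‖ ≤ C * ‖a - b‖ := by
    intro a b
    exact Convex.norm_image_sub_le_of_norm_fderiv_le (𝕜 := ℝ) (s := Set.univ)
      (fun x _ => hdd x) (fun x _ => h2 x) convex_univ (Set.mem_univ _) (Set.mem_univ _)
  refine ⟨C, hC0, fun y v => ?_⟩
  have := Convex.norm_image_sub_le_of_norm_fderiv_le' (𝕜 := ℝ) (f := γ) (φ := fderiv ℝ γ y)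
    (C := C * ‖v‖) (s := Metric.closedBall y ‖v‖) (x := y) (y := y + v)
    (fun x _ => hd x) (fun x hx => (hL x y).trans ?_) (convex_closedBall _ _)
    (Metric.mem_closedBall_self (norm_nonneg _)) (by simp)
  · simp only [add_sub_cancel_left, Real.norm_eq_abs] at this
    calc _ ≤ _ := this
      _ = _ := by ring
  · rw [mem_closedBall_iff_norm] at hx
    gcongr

lemma repr_ae {m : ℕ} {Ω : Set (EV m)} (hΩ : MeasurableSet Ω) (f : EV m → ℝ)
    (hf : AEStronglyMeasurable f (volume.restrict Ω)) :
    ∃ g : EV m → ℝ, Measurable g ∧ (∀ x, x ∉ Ω → g x = 0) ∧ g =ᵐ[volume.restrict Ω] f := by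
  refine ⟨Ω.indicator (hf.mk f), hf.stronglyMeasurable_mk.measurable.indicator hΩ,
    fun x hx => Set.indicator_of_notMem hx _, ?_⟩
  exact (indicator_ae_eq_restrict hΩ).trans hf.ae_eq_mk.symm

lemma int_repr {m : ℕ} {Ω : Set (EV m)} {f g φ : EV m → ℝ}
    (hz : ∀ x, x ∉ Ω → g x = 0) (he : g =ᵐ[volume.restrict Ω] f) :
    ∫ x, g x * φ x = ∫ x in Ω, f x * φ x := by
  rw [← setIntegral_eq_integral_of_forall_compl_eq_zero (s := Ω) (fun x hx => by simp [hz x hx])]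
  exact integral_congr_ae (he.mono fun x hx => by simp only [hx])

lemma norm_repr {m : ℕ} {Ω : Set (EV m)} (hΩ : MeasurableSet Ω) {f g : EV m → ℝ}
    (hz : ∀ x, x ∉ Ω → g x = 0) (he : g =ᵐ[volume.restrict Ω] f) :
    eLpNorm g p volume = eLpNorm f p (volume.restrict Ω) := by
  rw [← eLpNorm_congr_ae he, ← eLpNorm_indicator_eq_eLpNorm_restrict hΩ]
  congr 1
  ext x
  by_cases hx : x ∈ Ω
  · simp [hx]
  · simp [hx, hz x hx]

lemma red {m : ℕ} {Ω : Set (EV m)} (hΩ : MeasurableSet Ω) {u : EV m → ℝ}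
    {D : List (Fin m) → EV m → ℝ} (hD : IsSobDerivs Ω 2 p u D) (hB : NeumannBC Ω 1 p u) :
    ∃ (U : EV m → ℝ) (G : Fin m → EV m → ℝ) (H : Fin m → Fin m → EV m → ℝ),
      SD Ω p U G H ∧ U =ᵐ[volume.restrict Ω] u ∧
      (∀ i, eLpNorm (G i) p volume = eLpNorm (D [i]) p (volume.restrict Ω)) ∧
      (∀ i j, eLpNorm (H i j) p volume = eLpNorm (D [i, j]) p (volume.restrict Ω)) ∧
      (∀ φ : EV m → ℝ, ContDiff ℝ (⊤ : ℕ∞) φ → HasCompactSupport φ →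
      ∑ i, ∫ x, H i i x * φ x = - ∑ i, ∫ x, G i x * fderiv ℝ φ x (EuclideanSpace.single i 1)) := by
  obtain ⟨h0, hw, hl⟩ := hD
  have key : ∀ l : List (Fin m), ∃ g : EV m → ℝ, l.length ≤ 2 → (Measurable g ∧
      (∀ x, x ∉ Ω → g x = 0) ∧ g =ᵐ[volume.restrict Ω] D l) := by
    intro l
    by_cases h : l.length ≤ 2
    · obtain ⟨g, hg⟩ := repr_ae hΩ (D l) (hl l h).1
      exact ⟨g, fun _ => hg⟩
    · exact ⟨0, fun h' => absurd h' h⟩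
  choose E hE using key
  have e0 := hE [] (by simp)
  have e1 := fun i => hE [i] (by simp)
  have e2 := fun i j => hE [i, j] (by simp)
  have mm : ∀ l : List (Fin m), l.length ≤ 2 → MemLp (E l) p volume := by
    intro l h
    have hh := hE l h
    refine ⟨hh.1.aestronglyMeasurable, ?_⟩
    rw [norm_repr hΩ hh.2.1 hh.2.2]
    exact (hl l h).2
  refine ⟨E [], fun i => E [i], fun i j => E [i, j],
    ⟨e0.1, fun i => (e1 i).1, fun i j => (e2 i j).1, e0.2.1, fun i => (e1 i).2.1,
      fun i j => (e2 i j).2.1, mm _ (by simp), fun i => mm _ (by simp), fun i j => mm _ (by simp),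
      ?_, ?_⟩, h0 ▸ e0.2.2, fun i => norm_repr hΩ (e1 i).2.1 (e1 i).2.2,
      fun i j => norm_repr hΩ (e2 i j).2.1 (e2 i j).2.2, ?_⟩
  · intro i φ h1 h2 h3
    rw [int_repr e0.2.1 e0.2.2, int_repr (e1 i).2.1 (e1 i).2.2]
    exact hw [] (by simp) i φ h1 h2 h3
  · intro i j φ h1 h2 h3
    rw [int_repr (e1 j).2.1 (e1 j).2.2, int_repr (e2 i j).2.1 (e2 i j).2.2]
    exact hw [j] (by simp) i φ h1 h2 h3
  · intro φ h1 h2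
    have hb := hB D ⟨h0, hw, hl⟩ φ h1 h2
    simp only [Matrix.one_apply, ite_mul, one_mul, zero_mul, Finset.sum_ite_eq,
      Finset.mem_univ, if_true] at hb
    have a1 : ∀ i, ∫ x, E [i, i] x * φ x = ∫ x in Ω, D [i, i] x * φ x :=
      fun i => int_repr (e2 i i).2.1 (e2 i i).2.2
    have a2 : ∀ i, ∫ x, E [i] x * fderiv ℝ φ x (EuclideanSpace.single i 1)
        = ∫ x in Ω, D [i] x * partialD i φ x :=
      fun i => int_repr (e1 i).2.1 (e1 i).2.2
    simp only [a1, a2]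
    exact hb

/-- the operator as a limit of truncated integrals -/
def Lop {m : ℕ} (Ω : Set (EV m)) (r u : EV m → ℝ) (x : EV m) : ℝ :=
  limUnder (𝓝[>] (0:ℝ)) (fun s : ℝ =>
    ∫ y in Ω ∩ {y : EV m | s ≤ dist x y}, kernelJ r (x - y) * (u x - u y))

/-- summary of the facts about a function with derivative system -/
lemma facts {r : EV (n+1) → ℝ} (hr : KF r) (h : Lip1 γ) (hp1 : 1 ≤ p) (hp : p ≠ ⊤)
    {u U : EV (n+1) → ℝ} {G H} (S : SD (halfSpace γ) p U G H)
    (hu : U =ᵐ[volume.restrict (halfSpace γ)] u) :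
    ∀ᵐ x ∂(volume.restrict (halfSpace γ)),
      Tendsto (fun s : ℝ =>
        ∫ y in halfSpace γ ∩ {y : EV (n+1) | s ≤ dist x y}, kernelJ r (x - y) * (u x - u y))
        (𝓝[>] 0) (𝓝 (LL γ r U G x)) ∧ Lop (halfSpace γ) r u x = LL γ r U G x ∧
      ∀ s : ℝ, 0 < s → IntegrableOn (fun y => kernelJ r (x - y) * (u x - u y))
        (halfSpace γ ∩ {y : EV (n+1) | s ≤ dist x y}) volume := by
  have mΩ : MeasurableSet (halfSpace γ) := (hs_open h).measurableSet
  filter_upwards [hu, ae_restrict_of_ae (LL_pv hr h hp1 hp S),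
    ae_restrict_of_ae (TT_fin hr h hp1 hp S), ae_restrict_mem mΩ] with x hx hpv ht hm
  have hc : ∀ s : ℝ, (fun y => kernelJ r (x - y) * (U x - U y)) =ᵐ[volume.restrict
      (halfSpace γ ∩ {y : EV (n+1) | s ≤ dist x y})] (fun y => kernelJ r (x - y) * (u x - u y)) := by
    intro s
    have := ae_mono (Measure.restrict_mono_set volume
      (Set.inter_subset_left : halfSpace γ ∩ {y : EV (n+1) | s ≤ dist x y} ⊆ _)) hu
    filter_upwards [this] with y hy
    rw [hx, hy]
  have t : Tendsto (fun s : ℝ =>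
        ∫ y in halfSpace γ ∩ {y : EV (n+1) | s ≤ dist x y}, kernelJ r (x - y) * (u x - u y))
        (𝓝[>] 0) (𝓝 (LL γ r U G x)) := by
    refine (hpv hm).congr fun s => integral_congr_ae (hc s)
  exact ⟨t, t.limUnder_eq, fun s hs => (pv_int mΩ hr S.mU S.mG (ht hm) hs).congr (hc s)⟩

end

section
variable {n : ℕ} {γ : EV n → ℝ} {p : ℝ≥0∞}

lemma WNormD_le {m : ℕ} {k : ℕ} {μ : Measure (EV m)} (D : List (Fin m) → EV m → ℝ)
    (l : List (Fin m)) (hl : l.length ≤ k) : eLpNorm (D l) p μ ≤ WNormD k p μ D := by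
  have := ENNReal.le_tsum (f := fun l : List (Fin m) =>
    if l.length ≤ k then eLpNorm (D l) p μ else 0) l
  simpa [hl, WNormD] using this

/-- the constant -/
def BC (n : ℕ) (R C K : ℝ) : ℝ≥0∞ :=
  ENNReal.ofReal R * (23 * (n+1 : ℕ) * ((n+1 : ℕ) * (n+1 : ℕ)))
    + ENNReal.ofReal ((n+2) * (C * K)) * (n+1 : ℕ)
    + (n+1 : ℕ) * (ENNReal.ofReal (2 * R) * (n+1 : ℕ))

lemma BC_ne (n : ℕ) (R C K : ℝ) : BC n R C K ≠ ⊤ := by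
  unfold BC
  finiteness

lemma sum_bd {m : ℕ} {f : Fin m → ℝ≥0∞} {W : ℝ≥0∞} (h : ∀ i, f i ≤ W) :
    ∑ i, f i ≤ (m : ℕ) * W := by
  calc ∑ i, f i ≤ ∑ _i : Fin m, W := Finset.sum_le_sum fun i _ => h i
    _ = _ := by simp

lemma final_bound {r : EV (n+1) → ℝ} (hr : KF r) (ho : OddSl r) {K : ℝ} (hK : 0 ≤ K)
    (hT : Thin r K) (h : Lip1 γ) (hγ : ContDiff ℝ 2 γ) {C : ℝ} (hC : 0 ≤ C)
    (hd1 : ∀ y, ‖fderiv ℝ γ y‖ ≤ 1)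
    (hC2 : ∀ y v, |γ (y + v) - γ y - fderiv ℝ γ y v| ≤ C * ‖v‖^2)
    (hp1 : 1 ≤ p) (hp : p ≠ ⊤) {u : EV (n+1) → ℝ} {D} (hD : IsSobDerivs (halfSpace γ) 2 p u D)
    (hB : NeumannBC (halfSpace γ) 1 p u) :
    AEStronglyMeasurable (Lop (halfSpace γ) r u) (volume.restrict (halfSpace γ)) ∧
    eLpNorm (Lop (halfSpace γ) r u) p (volume.restrict (halfSpace γ)) < ⊤ ∧
    eLpNorm (Lop (halfSpace γ) r u) p (volume.restrict (halfSpace γ))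
      ≤ BC n (∫ z, r z) C K * WNormD 2 p (volume.restrict (halfSpace γ)) D := by
  have mΩ : MeasurableSet (halfSpace γ) := (hs_open h).measurableSet
  obtain ⟨U, G, H, S, hu, hG, hH, hN⟩ := red mΩ hD hB
  have he : Lop (halfSpace γ) r u =ᵐ[volume.restrict (halfSpace γ)] LL γ r U G := by
    filter_upwards [facts hr h hp1 hp S hu] with x hx using hx.2.1
  have hb := LL_bound hr ho hK hT h hγ hC hd1 hC2 hp1 hp S hN
  rw [eLpNorm_indicator_eq_eLpNorm_restrict mΩ] at hb
  refine ⟨((LL_meas h hr.mr S).aestronglyMeasurable).congr he.symm, ?_, ?_⟩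
  · rw [eLpNorm_congr_ae he]
    refine hb.trans_lt ?_
    have g : ∀ j, eLpNorm (G j) p volume ≠ ⊤ := fun j => (S.lG j).2.ne
    have hh : ∀ i j, eLpNorm (H i j) p volume ≠ ⊤ := fun i j => (S.lH i j).2.ne
    have s1 : ∑ j, eLpNorm (G j) p volume ≠ ⊤ := ENNReal.sum_ne_top.2 fun j _ => g j
    have s2 : SH p H ≠ ⊤ := ENNReal.sum_ne_top.2 fun j _ => ENNReal.sum_ne_top.2 fun i _ => hh i j
    have s3 : ∑ j, eLpNorm (H (Fin.last n) j) p volume ≠ ⊤ := ENNReal.sum_ne_top.2 fun j _ => hh _ j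
    finiteness
  · rw [eLpNorm_congr_ae he]
    refine hb.trans ?_
    set W := WNormD 2 p (volume.restrict (halfSpace γ)) D with hW
    have g : ∀ j, eLpNorm (G j) p volume ≤ W := fun j => (hG j).trans_le (WNormD_le D _ (by simp))
    have hh : ∀ i j, eLpNorm (H i j) p volume ≤ W :=
      fun i j => (hH i j).trans_le (WNormD_le D _ (by simp))
    have s1 : ∑ j, eLpNorm (G j) p volume ≤ (n+1 : ℕ) * W := sum_bd g
    have s2 : SH p H ≤ (n+1 : ℕ) * ((n+1 : ℕ) * W) := sum_bd fun j => sum_bd fun i => hh i j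
    have s3 : ∑ j, eLpNorm (H (Fin.last n) j) p volume ≤ (n+1 : ℕ) * W := sum_bd fun j => hh _ j
    calc _ ≤ ENNReal.ofReal (∫ z, r z) * (23 * (n+1 : ℕ) * ((n+1 : ℕ) * ((n+1 : ℕ) * W)))
        + ENNReal.ofReal ((n+2) * (C * K)) * ((n+1 : ℕ) * W)
        + (n+1 : ℕ) * (ENNReal.ofReal (2 * ∫ z, r z) * ((n+1 : ℕ) * W)) := by gcongr
      _ = _ := by unfold BC; ring

end

/-- bounded extension on a curved half space: let `γ ∈ C³_b(ℝ^{n-1})`,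
`p ∈ [1,∞)`, `ε ∈ (0,1]`, and let `ρ` satisfy (A1) and (A2) with `M = I`. If
`‖γ‖_{C¹_b}` is sufficiently small, the nonlocal operator
`u ↦ P.V. ∫_{ℝⁿ_γ} J_ε(·-y)(u(·)-u(y)) dy` extends to a bounded linear operator
`L_ε^{ℝⁿ_γ} : W^{2,p}_I(ℝⁿ_γ) → L^p(ℝⁿ_γ)` with
`‖L_ε^{ℝⁿ_γ} u‖_{L^p} ≤ c_γ ‖u‖_{W^{2,p}}`, where `c_γ > 0` depends only on
`γ`, `ρ` and `p`. -/
theorem nlOp_extension_half_space (n : ℕ) (ρ : EV (n + 1) → ℝ)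
    (hρ1 : A1 ρ) (hρ2 : A2 ρ) (hM : momentum ρ = 1)
    (p : ℝ≥0∞) (hp1 : 1 ≤ p) (hp : p ≠ ⊤) :
    ∃ δ : ℝ, 0 < δ ∧ ∀ γ : EV n → ℝ, Ckb 3 γ →
      (∀ x : EV n, |γ x| ≤ δ ∧ ‖fderiv ℝ γ x‖ ≤ δ) →
      ∃ c : ℝ, 0 < c ∧ ∀ ε : ℝ, 0 < ε → ε ≤ 1 →
        ∃ L : (EV (n + 1) → ℝ) → EV (n + 1) → ℝ,
          IsNLExtOn (halfSpace γ) (1 : Matrix (Fin (n + 1)) (Fin (n + 1)) ℝ) ρ p ε c L := by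
  refine ⟨1, one_pos, fun γ hγ hsm => ?_⟩
  have hd1 : ∀ y, ‖fderiv ℝ γ y‖ ≤ 1 := fun y => (hsm y).2
  have h : Lip1 γ := geom_lip hγ.1 hd1
  have mΩ : MeasurableSet (halfSpace γ) := (hs_open h).measurableSet
  obtain ⟨C, hC, hC2⟩ := geom_taylor hγ
  have hγ2 : ContDiff ℝ 2 γ := hγ.1.of_le (by norm_num)
  obtain ⟨K, hK, hT⟩ := thin_scaled hρ1.kf hρ2
  have hc0 : 0 < (BC n (∫ z, ρ z) C K).toReal + 1 := by positivity
  refine ⟨(BC n (∫ z, ρ z) C K).toReal + 1, hc0, fun ε hε _ => ⟨Lop (halfSpace γ) (scaled ρ ε), ?_⟩⟩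
  have hr : KF (scaled ρ ε) := hρ1.kf.scaled hε
  have ho : OddSl (scaled ρ ε) := (hρ2.oddSl hM).scaled hε
  have fb := fun (u : EV (n+1) → ℝ) D (hD : IsSobDerivs (halfSpace γ) 2 p u D)
    (hB : NeumannBC (halfSpace γ) 1 p u) =>
    final_bound hr ho hK (hT ε hε) h hγ2 hC hd1 hC2 hp1 hp hD hB
  refine ⟨?_, ?_, ?_, ?_⟩
  · rintro u - - ⟨⟨D, hD⟩, hB⟩
    obtain ⟨U, G, H, S, hu, -⟩ := red mΩ hD hB
    filter_upwards [facts hr h hp1 hp S hu] with x hx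
    rw [hx.2.1]
    exact hx.1
  · rintro u v ⟨⟨D, hD⟩, hB⟩ ⟨⟨D2, hD2⟩, hB2⟩ a b
    obtain ⟨U, G, H, S, hu, -⟩ := red mΩ hD hB
    obtain ⟨U2, G2, H2, S2, hu2, -⟩ := red mΩ hD2 hB2
    filter_upwards [facts hr h hp1 hp S hu, facts hr h hp1 hp S2 hu2] with x hx hy
    rw [hx.2.1, hy.2.1]
    refine Tendsto.limUnder_eq (((hx.1.const_mul a).add (hy.1.const_mul b)).congr' ?_)
    filter_upwards [self_mem_nhdsWithin] with s hs
    rw [← integral_const_mul, ← integral_const_mul,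
      ← integral_add ((hx.2.2 s hs).const_mul a) ((hy.2.2 s hs).const_mul b)]
    refine integral_congr_ae (Eventually.of_forall fun y => ?_)
    simp only
    ring
  · rintro u ⟨⟨D, hD⟩, hB⟩
    exact ⟨(fb u D hD hB).1, (fb u D hD hB).2.1⟩
  · rintro u D ⟨-, hB⟩ hD
    have := (fb u D hD hB).2.2
    rw [scaled_integral ρ hε] at this
    refine this.trans ?_
    gcongr
    rw [ENNReal.le_ofReal_iff_toReal_le (BC_ne _ _ _ _) hc0.le]
    linarith
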